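/- Let P¹, P² : ℂ → Prob(C([0,∞),ℂ)) be continuous maps, each of which defines a Markovian time-changed Brownian motion, and suppose there exists a non-zero σ-finite Borel measure μ on ℂ that is invariant for both P¹ and P². Then there is a constant c > 0 such that for every z ∈ ℂ, a process with law P¹_z is obtained from a process with law P²_z by the linear time change t ↦ ct; that is, P¹_z is the pushforward of P²_z under the map X ↦ (t ↦ X_{ct}). -/

import Mathlib

open MeasureTheory ProbabilityTheory Filter Topology
open scoped ENNReal NNReal

noncomputable section

/-- The space `C([0,∞), ℂ)` of continuous paths, with the topology of uniform convergence
on compact time intervals. -/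
abbrev PathSp : Type := C(ℝ≥0, ℂ)

instance : MeasurableSpace PathSp := borel PathSp

instance : BorelSpace PathSp := ⟨rfl⟩

/-- The centered planar Gaussian law on `ℂ` with covariance matrix `v·I₂`. -/
def planarGaussian (v : ℝ≥0) : Measure ℂ :=
  ((gaussianReal 0 v).prod (gaussianReal 0 v)).map fun p => Complex.equivRealProd.symm p

/-- `B` is a standard planar Brownian motion on `(Ω, μ)` started from `z`: it starts at `z`,
has continuous sample paths, and for `s ≤ t` the increment `B_t − B_s` is independent of
`(B_u)_{u ≤ s}` and centered Gaussian with covariance matrix `(t−s)·I₂`. -/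
structure IsPlanarBM {Ω : Type*} [MeasurableSpace Ω] (μ : Measure Ω)
    (B : ℝ≥0 → Ω → ℂ) (z : ℂ) : Prop where
  meas : ∀ t : ℝ≥0, Measurable (B t)
  start : ∀ᵐ ω ∂μ, B 0 ω = z
  cont : ∀ᵐ ω ∂μ, Continuous fun t => B t ω
  indep : ∀ s t : ℝ≥0, s ≤ t →
    Indep (MeasurableSpace.comap (fun ω => B t ω - B s ω) inferInstance)
      (⨆ u ∈ Set.Iic s, MeasurableSpace.comap (B u) inferInstance) μ
  incr : ∀ s t : ℝ≥0, s ≤ t → μ.map (fun ω => B t ω - B s ω) = planarGaussian (t - s)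

/-- Shift of a path by time `s`: `(pathShift s X) t = X (s + t)`. -/
def pathShift (s : ℝ≥0) (X : PathSp) : PathSp :=
  X.comp ⟨fun t => s + t, continuous_add_left s⟩

/-- The σ-algebra on path space generated by the coordinates `(X_u)_{0 ≤ u ≤ s}`. -/
def pastAlg (s : ℝ≥0) : MeasurableSpace PathSp :=
  ⨆ u ∈ Set.Iic s, MeasurableSpace.comap (fun X : PathSp => X u) inferInstance

/-- Each `P_z` is supported on paths starting at `z`. -/
def StartsAt (P : ℂ → ProbabilityMeasure PathSp) : Prop :=
  ∀ z : ℂ, (P z : Measure PathSp) {X : PathSp | X 0 = z} = 1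

/-- `P` is Markovian: for each `z` and `s ≥ 0`, the conditional law under `P_z` of the
shifted path `(X_{s+t})_{t ≥ 0}` given the past `(X_u)_{0 ≤ u ≤ s}` is almost surely
`P_{X_s}`, expressed by integration against events of the past σ-algebra. -/
def IsMarkovian (P : ℂ → ProbabilityMeasure PathSp) : Prop :=
  ∀ (z : ℂ) (s : ℝ≥0) (A : Set PathSp), MeasurableSet[pastAlg s] A →
    ∀ g : PathSp → ℝ, Measurable g → (∃ C : ℝ, ∀ X, |g X| ≤ C) →
      ∫ X in A, g (pathShift s X) ∂(P z : Measure PathSp) =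
        ∫ X in A, (∫ Y, g Y ∂(P (X s) : Measure PathSp)) ∂(P z : Measure PathSp)

/-- `(Ω, μ, B, τ, F)` realizes `ν` as a time-changed Brownian motion started from `z`:
`B` is a planar Brownian motion started at `z`, `τ` is a random continuous strictly
increasing time change with `τ_0 = 0` and `τ_u → ∞`, and the path `u ↦ B_{τ_u}`
(represented by the random continuous path `F`) has law `ν`. -/
def Realizes {Ω : Type} [MeasurableSpace Ω] (μ : Measure Ω) (B : ℝ≥0 → Ω → ℂ)
    (τ : ℝ≥0 → Ω → ℝ≥0) (F : Ω → PathSp) (z : ℂ) (ν : Measure PathSp) : Prop :=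
  IsProbabilityMeasure μ ∧ IsPlanarBM μ B z ∧
  (∀ᵐ ω ∂μ, τ 0 ω = 0 ∧ StrictMono (fun u => τ u ω) ∧
    Continuous (fun u => τ u ω) ∧ Tendsto (fun u => τ u ω) atTop atTop) ∧
  Measurable F ∧ (∀ᵐ ω ∂μ, ∀ u : ℝ≥0, F ω u = B (τ u ω) ω) ∧
  μ.map F = ν

/-- `P` is a time-changed Brownian motion: for each `z`, a process with law `P_z` can be
realized as `X_u = B_{τ_u}` for a planar Brownian motion `B` started from `z` and a random
continuous strictly increasing time change `τ` with `τ_0 = 0` and `τ_u → ∞`. -/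
def IsTimeChangedBM (P : ℂ → ProbabilityMeasure PathSp) : Prop :=
  ∀ z : ℂ, ∃ (Ω : Type) (mΩ : MeasurableSpace Ω) (μ : @Measure Ω mΩ)
    (B : ℝ≥0 → Ω → ℂ) (τ : ℝ≥0 → Ω → ℝ≥0) (F : Ω → PathSp),
      @Realizes Ω mΩ μ B τ F z (P z : Measure PathSp)

/-- `P` defines a Markovian time-changed Brownian motion. -/
def DefinesMTCBM (P : ℂ → ProbabilityMeasure PathSp) : Prop :=
  StartsAt P ∧ IsMarkovian P ∧ IsTimeChangedBM P

/-- The Borel measure `μ` on `ℂ` is invariant for `P`. -/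
def InvariantFor (P : ℂ → ProbabilityMeasure PathSp) (μ : Measure ℂ) : Prop :=
  ∀ (t : ℝ≥0) (A : Set ℂ), MeasurableSet A →
    ∫⁻ z, (P z : Measure PathSp) {X : PathSp | X t ∈ A} ∂μ = μ A

/-! ### Lebesgue measure on the half-line -/

/-- Lebesgue measure on `ℝ≥0`. -/
def halfLine : Measure ℝ≥0 := (volume.restrict (Set.Ici (0 : ℝ))).map Real.toNNReal

lemma lintegral_halfLine {g : ℝ≥0 → ℝ≥0∞} (hg : Measurable g) :
    ∫⁻ t, g t ∂halfLine = ∫⁻ x in Set.Ici (0 : ℝ), g x.toNNReal := by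
  rw [halfLine, lintegral_map hg measurable_real_toNNReal]

lemma setLIntegral_halfLine {g : ℝ≥0 → ℝ≥0∞} (hg : Measurable g) {s : Set ℝ≥0}
    (hs : MeasurableSet s) :
    ∫⁻ t in s, g t ∂halfLine =
      ∫⁻ x in Set.Ici (0 : ℝ), (s.indicator g) x.toNNReal := by
  rw [← lintegral_indicator hs, lintegral_halfLine (hg.indicator hs)]

lemma lintegral_halfLine_split {g : ℝ≥0 → ℝ≥0∞} (hg : Measurable g) (a : ℝ≥0) :
    ∫⁻ t, g t ∂halfLine =
      ∫⁻ t in Set.Iio a, g t ∂halfLine + ∫⁻ s, g (a + s) ∂halfLine := by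
  rw [← lintegral_add_compl g (measurableSet_Iio (a := a))]
  congr 1
  rw [setLIntegral_halfLine hg measurableSet_Iio.compl,
    lintegral_halfLine (g := fun s => g (a + s)) (hg.comp (measurable_const_add a)),
    ← lintegral_indicator measurableSet_Ici, ← lintegral_indicator measurableSet_Ici,
    ← lintegral_add_left_eq_self _ (a : ℝ)]
  refine lintegral_congr fun x => ?_
  by_cases hx : 0 ≤ x
  · have h1 : (0 : ℝ) ≤ a + x := by positivity
    have h2 : (a + x : ℝ).toNNReal = a + x.toNNReal := by
      rw [Real.toNNReal_add a.coe_nonneg hx, Real.toNNReal_coe]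
    rw [Set.indicator_of_mem (s := Set.Ici (0 : ℝ)) (by exact h1),
      Set.indicator_of_mem (s := Set.Ici (0 : ℝ)) (by exact hx), h2, Set.indicator_of_mem]
    simp
  · rw [Set.indicator_of_notMem (s := Set.Ici (0 : ℝ)) (a := x) (by simpa using hx)]
    by_cases h1 : (0 : ℝ) ≤ a + x
    · rw [Set.indicator_of_mem (by exact h1), Set.indicator_of_notMem]
      simp only [Set.mem_compl_iff, Set.mem_Iio, not_not]
      rw [Real.toNNReal_lt_iff_lt_coe h1]
      linarith
    · rw [Set.indicator_of_notMem (by simpa using h1)]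

instance : SigmaFinite halfLine := by
  refine ⟨⟨⟨fun n => Set.Iio (n : ℝ≥0), fun _ => trivial, fun n => ?_, ?_⟩⟩⟩
  · rw [halfLine, Measure.map_apply measurable_real_toNNReal measurableSet_Iio,
      Measure.restrict_apply (measurable_real_toNNReal measurableSet_Iio)]
    refine lt_of_le_of_lt (measure_mono (t := Set.Icc (0 : ℝ) n) ?_) (by simp)
    rintro x ⟨h1, h2⟩
    have h2' : (0 : ℝ) ≤ x := h2
    have h1' : x.toNNReal < (n : ℝ≥0) := h1
    rw [Real.toNNReal_lt_iff_lt_coe h2'] at h1'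
    exact ⟨h2', by simpa using h1'.le⟩
  · refine Set.eq_univ_of_forall fun x => Set.mem_iUnion.2 ?_
    obtain ⟨n, hn⟩ := exists_nat_gt x
    exact ⟨n, hn⟩

lemma halfLine_Ico (a b : ℝ≥0) : halfLine (Set.Ico a b) = ENNReal.ofReal (b - a) := by
  rw [halfLine, Measure.map_apply measurable_real_toNNReal measurableSet_Ico,
    Measure.restrict_apply (measurable_real_toNNReal measurableSet_Ico), ← Real.volume_Ico]
  congr 1
  ext x
  simp only [Set.mem_inter_iff, Set.mem_preimage, Set.mem_Ico, Set.mem_Ici]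
  constructor
  · rintro ⟨⟨h1, h2⟩, h3⟩
    rw [Real.toNNReal_lt_iff_lt_coe h3] at h2
    rw [Real.le_toNNReal_iff_coe_le h3] at h1
    exact ⟨h1, h2⟩
  · rintro ⟨h1, h2⟩
    have h3 : 0 ≤ x := a.2.trans h1
    rw [Real.toNNReal_lt_iff_lt_coe h3, Real.le_toNNReal_iff_coe_le h3]
    exact ⟨⟨h1, h2⟩, h3⟩

lemma halfLine_pos_of_mem_nhds {t : ℝ≥0} {s : Set ℝ≥0} (hs : s ∈ 𝓝 t) : 0 < halfLine s := by
  obtain ⟨u, hu, hus⟩ := exists_Ico_subset_of_mem_nhds hs ⟨t + 1, by simp⟩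
  refine lt_of_lt_of_le ?_ (measure_mono hus)
  rw [halfLine_Ico]
  simpa using hu

/-! ### The Borel structure of path space -/

lemma measurable_eval (t : ℝ≥0) : Measurable fun X : PathSp => X t :=
  (ContinuousEvalConst.continuous_eval_const t).measurable

lemma measurable_eval_uncurry : Measurable fun p : ℝ≥0 × PathSp => p.2 p.1 :=
  (continuous_eval.comp continuous_swap).measurable

lemma borel_pathSp :
    borel PathSp = ⨆ t : ℝ≥0, MeasurableSpace.comap (fun X : PathSp => X t) inferInstance := by
  apply le_antisymm
  · rw [borel_eq_generateFrom_of_subbasis ContinuousMap.compactOpen_eq]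
    refine MeasurableSpace.generateFrom_le ?_
    rintro _ ⟨K, hK, U, hU, rfl⟩
    beta_reduce
    have hK : IsCompact K := hK
    have hU : IsOpen U := hU
    have hev : ∀ t : ℝ≥0, Measurable[⨆ t : ℝ≥0, MeasurableSpace.comap
        (fun X : PathSp => X t) inferInstance] (fun X : PathSp => X t) := fun t =>
      Measurable.mono (comap_measurable _) (le_iSup (fun t : ℝ≥0 => MeasurableSpace.comap
        (fun X : PathSp => X t) inferInstance) t) le_rfl
    obtain ⟨D, hDK, hDc, hKD⟩ := hK.isSeparable.exists_countable_dense_subset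
    rcases Uᶜ.eq_empty_or_nonempty with hUe | hUn
    · have : U = Set.univ := Set.compl_empty_iff.1 hUe
      subst this
      have : {f : PathSp | Set.MapsTo f K Set.univ} = Set.univ := by
        ext f; simp [Set.mapsTo_univ]
      rw [this]; exact MeasurableSet.univ
    have key : {f : PathSp | Set.MapsTo f K U} =
        ⋃ n : ℕ, ⋂ q ∈ D, {f : PathSp | (1 : ℝ) / (n + 1) ≤ Metric.infDist (f q) Uᶜ} := by
      ext f
      simp only [Set.mem_ofPred_eq, Set.mem_iUnion, Set.mem_iInter]
      constructor
      · intro hf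
        rcases K.eq_empty_or_nonempty with rfl | hKn
        · refine ⟨0, fun q hq => absurd (hDK hq) (by simp)⟩
        obtain ⟨x, hx, hmin⟩ := hK.exists_isMinOn hKn
          ((Metric.continuous_infDist_pt Uᶜ).comp f.continuous).continuousOn
        have hpos : 0 < Metric.infDist (f x) Uᶜ := by
          rw [← hU.isClosed_compl.notMem_iff_infDist_pos hUn]
          simpa using hf hx
        obtain ⟨n, hn⟩ := exists_nat_one_div_lt hpos
        exact ⟨n, fun q hq => hn.le.trans (hmin (hDK hq))⟩
      · rintro ⟨n, hn⟩ x hx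
        have hcl : IsClosed {y : ℝ≥0 | (1 : ℝ) / (n + 1) ≤ Metric.infDist (f y) Uᶜ} :=
          isClosed_le continuous_const ((Metric.continuous_infDist_pt Uᶜ).comp f.continuous)
        have := hcl.closure_subset_iff.2 (fun q hq => hn q hq) (hKD hx)
        by_contra hxU
        have h0 : Metric.infDist (f x) Uᶜ = 0 := Metric.infDist_zero_of_mem hxU
        have h1 : (1 : ℝ) / (n + 1) ≤ 0 := h0 ▸ this
        exact absurd h1 (not_le.2 (by positivity))
    rw [key]
    refine MeasurableSet.iUnion fun n => MeasurableSet.biInter hDc fun q _ => ?_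
    exact (measurableSet_le measurable_const
      ((Metric.continuous_infDist_pt Uᶜ).measurable.comp (hev q)))
  · exact iSup_le fun t => (measurable_eval t).comap_le

lemma measurable_path_iff {Ω : Type*} {m : MeasurableSpace Ω} {F : Ω → PathSp} :
    Measurable F ↔ ∀ t, Measurable fun ω => F ω t := by
  refine ⟨fun h t => (measurable_eval t).comp h, fun h => ?_⟩
  rw [measurable_iff_comap_le]
  change (borel PathSp).comap F ≤ m
  rw [borel_pathSp, MeasurableSpace.comap_iSup]
  refine iSup_le fun t => ?_
  rw [MeasurableSpace.comap_comp]
  exact (h t).comap_le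

/-! ### Shifted and stopped paths -/

@[simp] lemma pathShift_apply (s t : ℝ≥0) (X : PathSp) : pathShift s X t = X (s + t) := rfl

lemma measurable_pathShift_uncurry : Measurable fun p : ℝ≥0 × PathSp => pathShift p.1 p.2 := by
  rw [measurable_path_iff]
  intro t
  exact measurable_eval_uncurry.comp
    ((measurable_fst.add_const t).prodMk measurable_snd)

lemma measurable_pathShift (s : ℝ≥0) : Measurable (pathShift s) :=
  measurable_pathShift_uncurry.comp (measurable_const.prodMk measurable_id)

lemma continuous_pathShift_left (X : PathSp) : Continuous fun s => pathShift s X :=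
  ContinuousMap.continuous_of_continuous_uncurry _
    (X.continuous.comp (continuous_fst.add continuous_snd))

/-- The path stopped at time `s`. -/
def pathStop (s : ℝ≥0) (X : PathSp) : PathSp :=
  X.comp ⟨fun t => min s t, continuous_const.min continuous_id⟩

@[simp] lemma pathStop_apply (s t : ℝ≥0) (X : PathSp) : pathStop s X t = X (min s t) := rfl

lemma measurable_pathStop (s : ℝ≥0) : Measurable[pastAlg s] (pathStop s) := by
  rw [measurable_path_iff]
  intro t
  refine Measurable.mono (comap_measurable fun X : PathSp => X (min s t)) ?_ le_rfl
  exact le_iSup₂_of_le (min s t) (Set.mem_Iic.2 (min_le_left _ _)) le_rfl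

lemma pastAlg_le (s : ℝ≥0) : pastAlg s ≤ (inferInstance : MeasurableSpace PathSp) :=
  iSup₂_le fun u _ => (measurable_eval u).comap_le

lemma measurableSet_pastAlg {s : ℝ≥0} {A : Set PathSp} (hA : MeasurableSet A)
    (h : ∀ X, pathStop s X ∈ A ↔ X ∈ A) : MeasurableSet[pastAlg s] A := by
  have : A = pathStop s ⁻¹' A := by ext X; exact (h X).symm
  rw [this]
  exact measurable_pathStop s hA

/-! ### Families of laws on path space -/

lemma measurable_law {P : ℂ → ProbabilityMeasure PathSp} (hP : Continuous P) :
    Measurable fun x => (P x : Measure PathSp) := by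
  refine Measurable.measure_of_isPiSystem_of_isProbabilityMeasure
    (S := {s : Set PathSp | IsClosed s}) borel_eq_generateFrom_isClosed isPiSystem_isClosed ?_
  intro s hs
  have hs : IsClosed s := hs
  have h1 : ∀ n : ℕ, Measurable fun x => ∫⁻ X, hs.apprSeq n X ∂(P x : Measure PathSp) := by
    intro n
    refine Continuous.measurable ?_
    rw [continuous_iff_continuousAt]
    intro x
    exact (ProbabilityMeasure.tendsto_iff_forall_lintegral_tendsto.1 (hP.tendsto x)) _
  refine measurable_of_tendsto_metrizable' atTop h1 ?_
  rw [tendsto_pi_nhds]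
  intro x
  exact HasOuterApproxClosed.tendsto_lintegral_apprSeq hs (P x : Measure PathSp)

lemma measurable_lintegral_law {P : ℂ → ProbabilityMeasure PathSp} (hP : Continuous P)
    {g : PathSp → ℝ≥0∞} (hg : Measurable g) :
    Measurable fun x => ∫⁻ X, g X ∂(P x : Measure PathSp) :=
  (Measure.measurable_lintegral hg).comp (measurable_law hP)

lemma markov_lintegral {P : ℂ → ProbabilityMeasure PathSp} (hP : Continuous P)
    (hM : IsMarkovian P) (z : ℂ) (s : ℝ≥0) {A : Set PathSp} (hA : MeasurableSet[pastAlg s] A)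
    {g : PathSp → ℝ≥0∞} (hg : Measurable g) :
    ∫⁻ X in A, g (pathShift s X) ∂(P z : Measure PathSp) =
      ∫⁻ X in A, ∫⁻ Y, g Y ∂(P (X s) : Measure PathSp) ∂(P z : Measure PathSp) := by
  have hl : Measurable fun X : PathSp => (P (X s) : Measure PathSp) :=
    (measurable_law hP).comp (measurable_eval s)
  suffices h : ((P z : Measure PathSp).restrict A).map (pathShift s) =
      ((P z : Measure PathSp).restrict A).bind fun X => (P (X s) : Measure PathSp) by
    rw [← lintegral_map hg (measurable_pathShift s), h,
      Measure.lintegral_bind hl.aemeasurable hg.aemeasurable]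
  ext B hB
  rw [Measure.map_apply (measurable_pathShift s) hB, Measure.bind_apply hB hl.aemeasurable]
  have h := hM z s A hA (B.indicator fun _ => 1) (measurable_const.indicator hB)
    ⟨1, fun X => by by_cases hX : X ∈ B <;> simp [hX]⟩
  have h1 : ∀ ν : Measure PathSp, ∀ Y : Set PathSp, MeasurableSet Y →
      ∫ X, Y.indicator (fun _ => (1 : ℝ)) X ∂ν = ν.real Y := by
    intro ν Y hY
    rw [integral_indicator hY]; simp
  simp only [h1 _ B hB] at h
  have h2 : (fun X => B.indicator (fun _ => (1 : ℝ)) (pathShift s X)) =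
      (pathShift s ⁻¹' B).indicator fun _ => 1 := rfl
  rw [h2, h1 _ _ (measurable_pathShift s hB)] at h
  have h3 : ∫⁻ X in A, (P (X s) : Measure PathSp) B ∂(P z : Measure PathSp) =
      ENNReal.ofReal (∫ X in A, (P (X s) : Measure PathSp).real B ∂(P z : Measure PathSp)) := by
    rw [ofReal_integral_eq_lintegral_ofReal]
    · simp
    · refine Integrable.of_bound (C := 1) ?_ ?_
      · exact ((Measure.measurable_coe hB).comp hl).ennreal_toReal.aestronglyMeasurable
      · refine ae_of_all _ fun X => ?_
        simp only [Real.norm_eq_abs, abs_of_nonneg measureReal_nonneg]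
        exact measureReal_le_one
    · exact ae_of_all _ fun _ => measureReal_nonneg
  rw [h3, ← h]
  simp

/-! ### Hitting times of closed sets -/

/-- The paths that visit `F` by time `t`. -/
def hitBy (F : Set ℂ) (t : ℝ≥0) : Set PathSp := {X | ∃ u ≤ t, X u ∈ F}

/-- The paths that visit `F`. -/
def hits (F : Set ℂ) : Set PathSp := {X | ∃ u, X u ∈ F}

/-- The first time a path visits `F`. -/
def hitTime (F : Set ℂ) (X : PathSp) : ℝ≥0 := sInf {t | X t ∈ F}

/-- The first point of `F` that a path visits. -/
def hitPt (F : Set ℂ) (X : PathSp) : ℂ := X (hitTime F X)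

lemma hitBy_mono (F : Set ℂ) {s t : ℝ≥0} (h : s ≤ t) : hitBy F s ⊆ hitBy F t :=
  fun _ ⟨u, hu, hX⟩ => ⟨u, hu.trans h, hX⟩

lemma hitBy_subset {F F' : Set ℂ} (h : F ⊆ F') (t : ℝ≥0) : hitBy F t ⊆ hitBy F' t :=
  fun _ ⟨u, hu, hX⟩ => ⟨u, hu, h hX⟩

lemma hits_subset {F F' : Set ℂ} (h : F ⊆ F') : hits F ⊆ hits F' :=
  fun _ ⟨u, hX⟩ => ⟨u, h hX⟩

@[simp] lemma hitBy_empty (t : ℝ≥0) : hitBy ∅ t = ∅ := by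
  ext X; simp [hitBy]

lemma hits_eq_iUnion (F : Set ℂ) : hits F = ⋃ n : ℕ, hitBy F n := by
  ext X
  simp only [hits, hitBy, Set.mem_iUnion, Set.mem_ofPred_eq]
  constructor
  · rintro ⟨u, hu⟩
    obtain ⟨n, hn⟩ := exists_nat_ge u
    exact ⟨n, u, hn, hu⟩
  · rintro ⟨n, u, _, hu⟩
    exact ⟨u, hu⟩

lemma isClosed_hitBy_uncurry {F : Set ℂ} (hF : IsClosed F) :
    IsClosed {p : ℝ≥0 × PathSp | p.2 ∈ hitBy F p.1} := by
  have h : IsClosed {q : Set.Icc (0 : ℝ≥0) 1 × (ℝ≥0 × PathSp) | q.2.2 (q.1.1 * q.2.1) ∈ F} := by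
    refine hF.preimage ?_
    fun_prop
  have h2 := isClosedMap_snd_of_compactSpace _ h
  convert h2 using 1
  ext ⟨t, X⟩
  simp only [hitBy, Set.mem_ofPred_eq, Set.mem_image, Prod.exists, exists_eq_right]
  constructor
  · rintro ⟨u, hu, hX⟩
    rcases eq_or_ne t 0 with rfl | ht
    · refine ⟨⟨0, by simp⟩, ?_⟩
      have : u = 0 := le_antisymm hu zero_le
      simpa [this] using hX
    · refine ⟨⟨u / t, by simp, div_le_one_of_le₀ hu zero_le⟩, ?_⟩
      simpa [div_mul_cancel₀ u ht] using hX
  · rintro ⟨v, hv⟩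
    exact ⟨v * t, mul_le_of_le_one_left zero_le v.2.2, hv⟩

lemma measurableSet_hitBy_uncurry {F : Set ℂ} (hF : IsClosed F) :
    MeasurableSet {p : ℝ≥0 × PathSp | p.2 ∈ hitBy F p.1} :=
  (isClosed_hitBy_uncurry hF).measurableSet

lemma isClosed_hitBy {F : Set ℂ} (hF : IsClosed F) (t : ℝ≥0) : IsClosed (hitBy F t) :=
  (isClosed_hitBy_uncurry hF).preimage (Continuous.prodMk_right t)

lemma measurableSet_hitBy {F : Set ℂ} (hF : IsClosed F) (t : ℝ≥0) : MeasurableSet (hitBy F t) :=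
  (isClosed_hitBy hF t).measurableSet

lemma measurableSet_hits {F : Set ℂ} (hF : IsClosed F) : MeasurableSet (hits F) := by
  rw [hits_eq_iUnion]
  exact MeasurableSet.iUnion fun n => measurableSet_hitBy hF n

lemma hitPt_mem {F : Set ℂ} (hF : IsClosed F) {X : PathSp} (hX : X ∈ hits F) :
    hitPt F X ∈ F := by
  have : IsClosed {t | X t ∈ F} := hF.preimage X.continuous
  exact this.csInf_mem hX (OrderBot.bddBelow _)

lemma hitTime_le {F : Set ℂ} {X : PathSp} {u : ℝ≥0} (hu : X u ∈ F) : hitTime F X ≤ u :=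
  csInf_le (OrderBot.bddBelow _) hu

lemma hitTime_le_iff {F : Set ℂ} (hF : IsClosed F) {X : PathSp} (hX : X ∈ hits F) {t : ℝ≥0} :
    hitTime F X ≤ t ↔ X ∈ hitBy F t :=
  ⟨fun h => ⟨_, h, hitPt_mem hF hX⟩, fun ⟨_, hu, hX⟩ => (hitTime_le hX).trans hu⟩

lemma hitTime_of_notMem {F : Set ℂ} {X : PathSp} (hX : X ∉ hits F) : hitTime F X = 0 := by
  have : {t | X t ∈ F} = ∅ := by
    ext t; simp only [Set.mem_ofPred_eq, Set.mem_empty_iff_false, iff_false]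
    exact fun h => hX ⟨t, h⟩
  rw [hitTime, this]
  exact NNReal.sInf_empty

lemma measurable_hitTime {F : Set ℂ} (hF : IsClosed F) : Measurable (hitTime F) := by
  refine measurable_of_Iic fun t => ?_
  have : hitTime F ⁻¹' Set.Iic t = hitBy F t ∪ (hits F)ᶜ := by
    ext X
    simp only [Set.mem_preimage, Set.mem_Iic, Set.mem_union, Set.mem_compl_iff]
    by_cases hX : X ∈ hits F
    · rw [hitTime_le_iff hF hX]; simp [hX]
    · simp [hX, hitTime_of_notMem hX]
  rw [this]
  exact (measurableSet_hitBy hF t).union (measurableSet_hits hF).compl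

lemma measurable_hitPt {F : Set ℂ} (hF : IsClosed F) : Measurable (hitPt F) :=
  measurable_eval_uncurry.comp ((measurable_hitTime hF).prodMk measurable_id)

lemma measurableSet_pastAlg_hitBy {F : Set ℂ} (hF : IsClosed F) (t : ℝ≥0) :
    MeasurableSet[pastAlg t] (hitBy F t) := by
  refine measurableSet_pastAlg (measurableSet_hitBy hF t) fun X => ?_
  constructor <;> rintro ⟨u, hu, hX⟩ <;> refine ⟨u, hu, ?_⟩ <;> simpa [min_eq_right hu] using hX

/-- The paths that visit `F` strictly before time `t`. -/
def hitBefore (F : Set ℂ) (t : ℝ≥0) : Set PathSp := {X | ∃ u < t, X u ∈ F}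

lemma measurableSet_pastAlg_hitBefore {F : Set ℂ} (hF : IsClosed F) (t : ℝ≥0) :
    MeasurableSet[pastAlg t] (hitBefore F t) := by
  refine measurableSet_pastAlg ?_ fun X => ?_
  · have : hitBefore F t = ⋃ n : ℕ, if 0 < t then hitBy F (t - t / (n + 1)) else ∅ := by
      ext X
      simp only [hitBefore, Set.mem_ofPred_eq, Set.mem_iUnion]
      constructor
      · rintro ⟨u, hu, hX⟩
        have ht : 0 < t := zero_le.trans_lt hu
        obtain ⟨n, hn⟩ := exists_nat_gt (t / (t - u))
        refine ⟨n, ?_⟩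
        rw [if_pos ht]
        refine ⟨u, ?_, hX⟩
        have h1 : 0 < t - u := tsub_pos_of_lt hu
        rw [div_lt_iff₀ h1] at hn
        rw [le_tsub_iff_right (div_le_self zero_le (le_add_of_nonneg_left zero_le)),
          ← le_tsub_iff_left hu.le,
          div_le_iff₀ (by positivity)]
        calc t ≤ n * (t - u) := hn.le
          _ ≤ (t - u) * (n + 1) := by rw [mul_comm]; gcongr; simp
      · rintro ⟨n, h⟩
        by_cases ht : 0 < t
        · rw [if_pos ht] at h
          obtain ⟨u, hu, hX⟩ := h
          exact ⟨u, hu.trans_lt (tsub_lt_self ht (by positivity)), hX⟩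
        · rw [if_neg ht] at h; exact h.elim
    rw [this]
    refine MeasurableSet.iUnion fun n => ?_
    split_ifs
    · exact measurableSet_hitBy hF _
    · exact MeasurableSet.empty
  · constructor <;> rintro ⟨u, hu, hX⟩ <;> refine ⟨u, hu, ?_⟩ <;>
      simpa [min_eq_right hu.le] using hX

lemma mem_hitBefore_iff {F : Set ℂ} (hF : IsClosed F) {X : PathSp} (hX : X ∈ hits F) {t : ℝ≥0} :
    X ∈ hitBefore F t ↔ hitTime F X < t :=
  ⟨fun ⟨_, hu, h⟩ => (hitTime_le h).trans_lt hu, fun h => ⟨_, h, hitPt_mem hF hX⟩⟩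

/-! ### The strong Markov property at hitting times -/

/-- Continuous families of laws that define a Markovian time-changed Brownian motion. -/
structure ContMTCBM (P : ℂ → ProbabilityMeasure PathSp) : Prop where
  cont : Continuous P
  start : StartsAt P
  markov : IsMarkovian P
  timeChange : IsTimeChangedBM P

/-- The law of the first point of `F` that is visited, under `P x`. -/
def hitLaw (P : ℂ → ProbabilityMeasure PathSp) (F : Set ℂ) (x : ℂ) : Measure ℂ :=
  (P x : Measure PathSp).map (hitPt F)

lemma measurable_hitLaw {P : ℂ → ProbabilityMeasure PathSp} (hP : Continuous P) {F : Set ℂ}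
    (hF : IsClosed F) : Measurable (hitLaw P F) :=
  (Measure.measurable_map _ (measurable_hitPt hF)).comp (measurable_law hP)

lemma lintegral_hitLaw {P : ℂ → ProbabilityMeasure PathSp} {F : Set ℂ} (hF : IsClosed F)
    (x : ℂ) {f : ℂ → ℝ≥0∞} (hf : Measurable f) :
    ∫⁻ y, f y ∂hitLaw P F x = ∫⁻ X, f (hitPt F X) ∂(P x : Measure PathSp) :=
  lintegral_map hf (measurable_hitPt hF)

lemma isProbabilityMeasure_hitLaw (P : ℂ → ProbabilityMeasure PathSp) {F : Set ℂ}
    (hF : IsClosed F) (x : ℂ) : IsProbabilityMeasure (hitLaw P F x) :=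
  Measure.isProbabilityMeasure_map (measurable_hitPt hF).aemeasurable

/-- Approximation of a time from above by multiples of `1 / (n + 1)`. -/
def upTime (n : ℕ) (t : ℝ≥0) : ℝ≥0 := (⌊(n + 1) * t⌋₊ + 1) / (n + 1)

lemma measurable_upTime (n : ℕ) : Measurable (upTime n) := by
  unfold upTime
  have : Measurable fun t : ℝ≥0 => ((⌊(n + 1) * t⌋₊ : ℕ) : ℝ≥0) :=
    measurable_from_nat.comp (Nat.measurable_floor.comp (measurable_const_mul _))
  exact (this.add_const 1).div_const _

lemma tendsto_upTime (t : ℝ≥0) : Tendsto (fun n => upTime n t) atTop (𝓝 t) := by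
  have h1 : Tendsto (fun n : ℕ => t + 1 / ((n : ℝ≥0) + 1)) atTop (𝓝 (t + 0)) :=
    tendsto_const_nhds.add tendsto_one_div_add_atTop_nhds_zero_nat
  rw [add_zero] at h1
  refine tendsto_of_tendsto_of_tendsto_of_le_of_le tendsto_const_nhds h1 (fun n => ?_) fun n => ?_
  · change t ≤ _ / _
    rw [le_div_iff₀ (by positivity), mul_comm]
    exact (Nat.lt_floor_add_one _).le
  · change _ / _ ≤ _
    rw [add_div]
    gcongr
    rw [div_le_iff₀ (by positivity), mul_comm]
    exact Nat.floor_le zero_le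

lemma upTime_eq_iff {n k : ℕ} {t : ℝ≥0} (h1 : (k : ℝ≥0) / (n + 1) ≤ t)
    (h2 : t < ((k : ℝ≥0) + 1) / (n + 1)) : upTime n t = (k + 1) / (n + 1) := by
  have : ⌊((n : ℝ≥0) + 1) * t⌋₊ = k := by
    rw [Nat.floor_eq_iff zero_le]
    rw [div_le_iff₀ (by positivity)] at h1
    rw [lt_div_iff₀ (by positivity)] at h2
    rw [mul_comm]
    exact ⟨h1, h2⟩
  rw [upTime, this]

lemma lintegral_upTime {P : ℂ → ProbabilityMeasure PathSp} (hP : ContMTCBM P) {F : Set ℂ}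
    (hF : IsClosed F) (z : ℂ) (hz : ∀ᵐ X ∂(P z : Measure PathSp), X ∈ hits F)
    {g : PathSp → ℝ≥0∞} (hg : Measurable g) (n : ℕ) :
    ∫⁻ X, g (pathShift (upTime n (hitTime F X)) X) ∂(P z : Measure PathSp) =
      ∫⁻ X, ∫⁻ Y, g Y ∂(P (X (upTime n (hitTime F X))) : Measure PathSp)
        ∂(P z : Measure PathSp) := by
  let d : ℕ → ℝ≥0 := fun k => (k : ℝ≥0) / (n + 1)
  let B : ℕ → Set PathSp := fun k => hitBefore F (d (k + 1)) \ hitBefore F (d k)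
  have hd : Monotone d := fun a b hab => by
    change (a : ℝ≥0) / (n + 1) ≤ b / (n + 1); gcongr
  have hpast : ∀ k, MeasurableSet[pastAlg (d (k + 1))] (B k) := fun k => by
    refine (measurableSet_pastAlg_hitBefore hF _).diff ?_
    refine measurableSet_pastAlg ?_ fun X => ?_
    · exact pastAlg_le _ _ (measurableSet_pastAlg_hitBefore hF _)
    · have hk := hd k.le_succ
      constructor <;> rintro ⟨u, hu, hX⟩ <;> refine ⟨u, hu, ?_⟩ <;>
        simpa [min_eq_right (hu.le.trans hk)] using hX
  have hB : ∀ k, MeasurableSet (B k) := fun k => pastAlg_le _ _ (hpast k)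
  have hmem : ∀ k X, X ∈ B k → upTime n (hitTime F X) = d (k + 1) := by
    rintro k X ⟨h1, h2⟩
    have hX : X ∈ hits F := by obtain ⟨u, -, hu⟩ := h1; exact ⟨u, hu⟩
    rw [mem_hitBefore_iff hF hX] at h1 h2
    have := upTime_eq_iff (n := n) (k := k) (t := hitTime F X) (not_lt.1 h2)
      (by simpa [d] using h1)
    simpa [d] using this
  have hdisj : Pairwise (Function.onFun Disjoint B) := by
    have key : ∀ i j, i < j → Disjoint (B i) (B j) := by
      intro i j hij
      rw [Set.disjoint_left]
      rintro X ⟨⟨u, hu, hX⟩, -⟩ ⟨-, h2⟩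
      exact h2 ⟨u, hu.trans_le (hd hij), hX⟩
    intro i j hij
    rcases lt_or_gt_of_ne hij with h | h
    · exact key i j h
    · exact (key j i h).symm
  have hcov : ∀ᵐ X ∂(P z : Measure PathSp), X ∈ ⋃ k, B k := by
    filter_upwards [hz] with X hX
    refine Set.mem_iUnion.2 ⟨⌊(n + 1) * hitTime F X⌋₊, ?_, ?_⟩
    · rw [mem_hitBefore_iff hF hX, lt_div_iff₀ (by positivity), mul_comm]
      push_cast
      exact Nat.lt_floor_add_one _
    · rw [mem_hitBefore_iff hF hX, not_lt, div_le_iff₀ (by positivity), mul_comm (hitTime F X)]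
      exact Nat.floor_le zero_le
  have hres : (P z : Measure PathSp).restrict (⋃ k, B k) = (P z : Measure PathSp) :=
    Measure.restrict_eq_self_of_ae_mem hcov
  rw [← hres, lintegral_iUnion hB hdisj, lintegral_iUnion hB hdisj]
  refine tsum_congr fun k => ?_
  rw [setLIntegral_congr_fun (hB k) fun X hX => by rw [hmem k X hX],
    markov_lintegral hP.cont hP.markov z _ (hpast k) hg]
  exact setLIntegral_congr_fun (hB k) fun X hX => by rw [hmem k X hX]

lemma strong_markov {P : ℂ → ProbabilityMeasure PathSp} (hP : ContMTCBM P) {F : Set ℂ}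
    (hF : IsClosed F) (z : ℂ) (hz : ∀ᵐ X ∂(P z : Measure PathSp), X ∈ hits F)
    {g : PathSp → ℝ≥0∞} (hg : Measurable g) :
    ∫⁻ X, g (pathShift (hitTime F X) X) ∂(P z : Measure PathSp) =
      ∫⁻ y, ∫⁻ Y, g Y ∂(P y : Measure PathSp) ∂hitLaw P F z := by
  have hθ : Measurable fun X => pathShift (hitTime F X) X :=
    measurable_pathShift_uncurry.comp ((measurable_hitTime hF).prodMk measurable_id)
  have hl := measurable_law hP.cont
  suffices h : (P z : Measure PathSp).map (fun X => pathShift (hitTime F X) X) =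
      (hitLaw P F z).bind fun y => (P y : Measure PathSp) by
    rw [← lintegral_map hg hθ, h, Measure.lintegral_bind hl.aemeasurable hg.aemeasurable]
  have : IsProbabilityMeasure ((P z : Measure PathSp).map fun X => pathShift (hitTime F X) X) :=
    Measure.isProbabilityMeasure_map hθ.aemeasurable
  refine ext_of_forall_lintegral_eq_of_IsFiniteMeasure fun f => ?_
  have hfm : Measurable fun X : PathSp => (f X : ℝ≥0∞) :=
    measurable_coe_nnreal_ennreal.comp f.continuous.measurable
  have hfc : Continuous fun X : PathSp => (f X : ℝ≥0∞) :=
    ENNReal.continuous_coe.comp f.continuous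
  have hΦ : Continuous fun y => ∫⁻ Y, (f Y : ℝ≥0∞) ∂(P y : Measure PathSp) := by
    rw [continuous_iff_continuousAt]
    intro x
    exact (ProbabilityMeasure.tendsto_iff_forall_lintegral_tendsto.1 (hP.cont.tendsto x)) f
  obtain ⟨C, hC⟩ : ∃ C : ℝ≥0, ∀ X, f X ≤ C := ⟨nndist f 0, fun X => by
    have := f.nndist_coe_le_nndist (g := 0) X
    simpa using this⟩
  rw [lintegral_map hfm hθ, Measure.lintegral_bind hl.aemeasurable hfm.aemeasurable,
    lintegral_hitLaw hF z hΦ.measurable]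
  have hT : ∀ n, Measurable fun X => upTime n (hitTime F X) := fun n =>
    (measurable_upTime n).comp (measurable_hitTime hF)
  have h1 : Tendsto (fun n => ∫⁻ X, (f (pathShift (upTime n (hitTime F X)) X) : ℝ≥0∞)
      ∂(P z : Measure PathSp)) atTop
      (𝓝 (∫⁻ X, (f (pathShift (hitTime F X) X) : ℝ≥0∞) ∂(P z : Measure PathSp))) := by
    refine tendsto_lintegral_of_dominated_convergence (fun _ => (C : ℝ≥0∞)) (fun n => ?_)
      (fun n => ae_of_all _ fun X => ENNReal.coe_le_coe.2 (hC _)) (by simp)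
      (ae_of_all _ fun X => ?_)
    · exact hfm.comp (measurable_pathShift_uncurry.comp ((hT n).prodMk measurable_id))
    · exact (hfc.comp (continuous_pathShift_left X)).tendsto _ |>.comp (tendsto_upTime _)
  have h2 : Tendsto (fun n => ∫⁻ X, ∫⁻ Y, (f Y : ℝ≥0∞)
      ∂(P (X (upTime n (hitTime F X))) : Measure PathSp) ∂(P z : Measure PathSp)) atTop
      (𝓝 (∫⁻ X, ∫⁻ Y, (f Y : ℝ≥0∞) ∂(P (hitPt F X) : Measure PathSp)
        ∂(P z : Measure PathSp))) := by
    refine tendsto_lintegral_of_dominated_convergence (fun _ => (C : ℝ≥0∞)) (fun n => ?_)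
      (fun n => ae_of_all _ fun X => ?_) (by simp) (ae_of_all _ fun X => ?_)
    · exact hΦ.measurable.comp (measurable_eval_uncurry.comp ((hT n).prodMk measurable_id))
    · calc ∫⁻ Y, (f Y : ℝ≥0∞) ∂(P (X (upTime n (hitTime F X))) : Measure PathSp)
          ≤ ∫⁻ _, (C : ℝ≥0∞) ∂(P (X (upTime n (hitTime F X))) : Measure PathSp) :=
            lintegral_mono fun Y => ENNReal.coe_le_coe.2 (hC Y)
        _ = C := by simp
    · exact (hΦ.comp X.continuous).tendsto _ |>.comp (tendsto_upTime _)
  refine tendsto_nhds_unique h1 (h2.congr fun n => ?_)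
  exact (lintegral_upTime hP hF z hz hfm n).symm

/-! ### Exponential discounting -/

/-- The discount factor `exp (-α t)`. -/
def disc (α t : ℝ≥0) : ℝ≥0∞ := ENNReal.ofReal (Real.exp (-(α * t)))

lemma disc_ne_zero (α t : ℝ≥0) : disc α t ≠ 0 := by
  simp [disc, Real.exp_pos]

lemma disc_ne_top (α t : ℝ≥0) : disc α t ≠ ∞ := ENNReal.ofReal_ne_top

@[simp] lemma disc_zero_left (t : ℝ≥0) : disc 0 t = 1 := by simp [disc]

lemma disc_le_one (α t : ℝ≥0) : disc α t ≤ 1 := by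
  rw [disc, ENNReal.ofReal_le_one, Real.exp_le_one_iff]
  have : (0 : ℝ) ≤ α * t := by positivity
  linarith

lemma disc_add_right (α s t : ℝ≥0) : disc α (s + t) = disc α s * disc α t := by
  rw [disc, disc, disc, ← ENNReal.ofReal_mul (Real.exp_pos _).le, ← Real.exp_add]
  congr 2
  push_cast
  ring

lemma disc_add_left (α β t : ℝ≥0) : disc (α + β) t = disc α t * disc β t := by
  rw [disc, disc, disc, ← ENNReal.ofReal_mul (Real.exp_pos _).le, ← Real.exp_add]
  congr 2
  push_cast
  ring

lemma continuous_disc (α : ℝ≥0) : Continuous (disc α) :=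
  ENNReal.continuous_ofReal.comp (by fun_prop)

lemma measurable_disc (α : ℝ≥0) : Measurable (disc α) := (continuous_disc α).measurable

lemma disc_inv (α t : ℝ≥0) : (disc α t)⁻¹ = ENNReal.ofReal (Real.exp (α * t)) := by
  rw [disc, ← ENNReal.ofReal_inv_of_pos (Real.exp_pos _), ← Real.exp_neg, neg_neg]

lemma setLIntegral_halfLine_Iio (h : ℝ → ℝ≥0∞) (hh : Measurable h) (u : ℝ≥0) :
    ∫⁻ t in Set.Iio u, h t ∂halfLine = ∫⁻ x in Set.Ico (0 : ℝ) u, h x := by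
  rw [setLIntegral_halfLine (g := fun t : ℝ≥0 => h t) (hh.comp measurable_coe_nnreal_real)
    measurableSet_Iio, ← lintegral_indicator measurableSet_Ici, ← lintegral_indicator
    measurableSet_Ico]
  refine lintegral_congr fun x => ?_
  by_cases hx : 0 ≤ x
  · rw [Set.indicator_of_mem (s := Set.Ici (0 : ℝ)) (by exact hx)]
    by_cases h2 : x < u
    · rw [Set.indicator_of_mem, Set.indicator_of_mem (by exact ⟨hx, h2⟩), Real.coe_toNNReal _ hx]
      exact (Real.toNNReal_lt_iff_lt_coe hx).2 h2
    · rw [Set.indicator_of_notMem, Set.indicator_of_notMem (fun h => h2 h.2)]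
      exact fun h => h2 ((Real.toNNReal_lt_iff_lt_coe hx).1 h)
  · rw [Set.indicator_of_notMem (s := Set.Ici (0 : ℝ)) (by simpa using hx),
      Set.indicator_of_notMem (fun h => hx h.1)]

lemma lintegral_disc_inv (γ u : ℝ≥0) :
    γ * ∫⁻ t in Set.Iio u, (disc γ t)⁻¹ ∂halfLine + 1 = (disc γ u)⁻¹ := by
  simp only [disc_inv]
  rw [setLIntegral_halfLine_Iio (fun x => ENNReal.ofReal (Real.exp (γ * x)))
    (by fun_prop) u, ← lintegral_const_mul _ (by fun_prop)]
  have h1 : ∀ x : ℝ, (γ : ℝ≥0∞) * ENNReal.ofReal (Real.exp (γ * x)) =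
      ENNReal.ofReal (γ * Real.exp (γ * x)) := fun x => by
    rw [ENNReal.ofReal_mul γ.coe_nonneg, ENNReal.ofReal_coe_nnreal]
  simp only [h1]
  have hc : Continuous fun x : ℝ => (γ : ℝ) * Real.exp (γ * x) := by fun_prop
  rw [← ofReal_integral_eq_lintegral_ofReal
    ((hc.integrableOn_Icc (a := (0 : ℝ)) (b := (u : ℝ))).mono_set Set.Ico_subset_Icc_self)
    (ae_of_all _ fun x => by positivity), integral_Ico_eq_integral_Ioc,
    ← intervalIntegral.integral_of_le u.coe_nonneg,
    intervalIntegral.integral_eq_sub_of_hasDerivAt (f := fun x : ℝ => Real.exp (γ * x))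
      (fun x _ => by
        have := ((hasDerivAt_id x).const_mul (γ : ℝ)).exp
        simpa [mul_comm] using this) (hc.intervalIntegrable _ _), ← ENNReal.ofReal_one,
    ← ENNReal.ofReal_add _ zero_le_one]
  · congr 1
    simp
  · simp only [mul_zero, Real.exp_zero, sub_nonneg]
    exact Real.one_le_exp (by positivity)

instance : NullSingletonClass halfLine := ⟨fun t => by
  rw [halfLine, Measure.map_apply measurable_real_toNNReal (measurableSet_singleton t),
    Measure.restrict_apply (measurable_real_toNNReal (measurableSet_singleton t))]
  refine measure_mono_null (t := {(t : ℝ)}) ?_ (by simp)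
  rintro x ⟨h1, h2⟩
  have h1 : x.toNNReal = t := h1
  rw [Set.mem_singleton_iff, ← h1, Real.coe_toNNReal _ h2]⟩

lemma lintegral_disc_shift (β : ℝ≥0) {φ : ℝ≥0 → ℝ≥0∞} (hφ : Measurable φ) (t : ℝ≥0) :
    ∫⁻ s, disc β s * φ (t + s) ∂halfLine =
      (disc β t)⁻¹ * ∫⁻ u in Set.Ici t, disc β u * φ u ∂halfLine := by
  have hm : Measurable fun u => disc β u * φ u := (measurable_disc β).mul hφ
  rw [← lintegral_indicator measurableSet_Ici,
    lintegral_halfLine_split (hm.indicator measurableSet_Ici) t,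
    setLIntegral_congr_fun (f := (Set.Ici t).indicator fun u => disc β u * φ u)
      (g := fun _ => 0) measurableSet_Iio
      (fun u hu => Set.indicator_of_notMem (fun h => absurd hu (not_lt.2 h)) _), lintegral_zero,
    zero_add, ← lintegral_const_mul]
  · refine lintegral_congr fun s => ?_
    rw [Set.indicator_of_mem (by simp), disc_add_right, ← mul_assoc, ← mul_assoc,
      ENNReal.inv_mul_cancel (disc_ne_zero _ _) (disc_ne_top _ _), one_mul]
  · exact (hm.indicator measurableSet_Ici).comp (measurable_const_add t)

lemma lintegral_conv {w φ : ℝ≥0 → ℝ≥0∞} (hw : Measurable w) (hφ : Measurable φ) (β : ℝ≥0) :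
    ∫⁻ t, w t * ∫⁻ s, disc β s * φ (t + s) ∂halfLine ∂halfLine =
      ∫⁻ u, disc β u * φ u * ∫⁻ t in Set.Iic u, w t * (disc β t)⁻¹ ∂halfLine ∂halfLine := by
  simp only [lintegral_disc_shift β hφ, ← lintegral_indicator measurableSet_Ici,
    ← lintegral_indicator measurableSet_Iic]
  have hm : Measurable fun u => disc β u * φ u := (measurable_disc β).mul hφ
  have hm2 : Measurable fun t => w t * (disc β t)⁻¹ := hw.mul (measurable_disc β).inv
  have e1 : ∀ t, w t * ((disc β t)⁻¹ *
      ∫⁻ u, (Set.Ici t).indicator (fun u => disc β u * φ u) u ∂halfLine) =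
      ∫⁻ u, (w t * (disc β t)⁻¹) * (Set.Ici t).indicator (fun u => disc β u * φ u) u
        ∂halfLine := fun t => by
    rw [← mul_assoc, ← lintegral_const_mul _ (hm.indicator measurableSet_Ici)]
  have e2 : ∀ u, disc β u * φ u *
      ∫⁻ t, (Set.Iic u).indicator (fun t => w t * (disc β t)⁻¹) t ∂halfLine =
      ∫⁻ t, disc β u * φ u * (Set.Iic u).indicator (fun t => w t * (disc β t)⁻¹) t
        ∂halfLine := fun u => by
    rw [← lintegral_const_mul _ (hm2.indicator measurableSet_Iic)]
  simp only [e1, e2]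
  rw [lintegral_lintegral_swap]
  · refine lintegral_congr fun u => lintegral_congr fun t => ?_
    by_cases h : t ≤ u
    · rw [Set.indicator_of_mem (s := Set.Ici t) (by exact h),
        Set.indicator_of_mem (s := Set.Iic u) (by exact h), mul_comm]
    · rw [Set.indicator_of_notMem (s := Set.Ici t) (by exact h),
        Set.indicator_of_notMem (s := Set.Iic u) (by exact h), mul_zero, mul_zero]
  · have : MeasurableSet {p : ℝ≥0 × ℝ≥0 | p.1 ≤ p.2} :=
      measurableSet_le measurable_fst measurable_snd
    have h3 : Measurable fun p : ℝ≥0 × ℝ≥0 => (w p.1 * (disc β p.1)⁻¹) *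
        {p : ℝ≥0 × ℝ≥0 | p.1 ≤ p.2}.indicator (fun p => disc β p.2 * φ p.2) p :=
      (hm2.comp measurable_fst).mul ((hm.comp measurable_snd).indicator this)
    exact h3.aemeasurable

lemma lintegral_resolvent {φ : ℝ≥0 → ℝ≥0∞} (hφ : Measurable φ) (α γ : ℝ≥0) :
    γ * ∫⁻ t, disc α t * ∫⁻ s, disc (α + γ) s * φ (t + s) ∂halfLine ∂halfLine +
      ∫⁻ t, disc (α + γ) t * φ t ∂halfLine = ∫⁻ t, disc α t * φ t ∂halfLine := by
  have hm : Measurable fun u => disc (α + γ) u * φ u := (measurable_disc _).mul hφ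
  have e1 : ∀ t, disc α t * (disc (α + γ) t)⁻¹ = (disc γ t)⁻¹ := fun t => by
    rw [disc_add_left, ENNReal.mul_inv (Or.inl (disc_ne_zero _ _)) (Or.inl (disc_ne_top _ _)),
      ← mul_assoc, ENNReal.mul_inv_cancel (disc_ne_zero _ _) (disc_ne_top _ _), one_mul]
  rw [lintegral_conv (measurable_disc α) hφ, ← lintegral_const_mul', ← lintegral_add_right _ hm]
  · refine lintegral_congr fun u => ?_
    simp only [e1]
    rw [setLIntegral_congr Iio_ae_eq_Iic.symm]
    calc _ = disc (α + γ) u * φ u * (γ * ∫⁻ t in Set.Iio u, (disc γ t)⁻¹ ∂halfLine + 1) := by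
            ring
      _ = disc α u * φ u := by
            rw [lintegral_disc_inv, disc_add_left]
            calc _ = disc α u * φ u * (disc γ u * (disc γ u)⁻¹) := by ring
              _ = _ := by
                rw [ENNReal.mul_inv_cancel (disc_ne_zero _ _) (disc_ne_top _ _), mul_one]
  · exact ENNReal.coe_ne_top

lemma lintegral_stopped_resolvent {φ : ℝ≥0 → ℝ≥0∞} (hφ : Measurable φ) (T : ℝ≥0) :
    ∫⁻ t in Set.Iio T, ∫⁻ s, disc 1 s * φ (t + s) ∂halfLine ∂halfLine +
      ∫⁻ t, disc 1 t * φ t ∂halfLine =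
    ∫⁻ t in Set.Iio T, φ t ∂halfLine + ∫⁻ s, disc 1 s * φ (T + s) ∂halfLine := by
  have hm : Measurable fun u => disc 1 u * φ u := (measurable_disc _).mul hφ
  have h0 : ∫⁻ t in Set.Iio T, ∫⁻ s, disc 1 s * φ (t + s) ∂halfLine ∂halfLine =
      ∫⁻ t, (Set.Iio T).indicator 1 t * ∫⁻ s, disc 1 s * φ (t + s) ∂halfLine ∂halfLine := by
    rw [← lintegral_indicator measurableSet_Iio]
    refine lintegral_congr fun t => ?_
    by_cases h : t ∈ Set.Iio T <;> simp [h]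
  have h1 : ∀ u, ∫⁻ t in Set.Iic u, (Set.Iio T).indicator 1 t * (disc 1 t)⁻¹ ∂halfLine + 1 =
      (disc 1 (min u T))⁻¹ := by
    intro u
    rw [← lintegral_disc_inv, ENNReal.coe_one, one_mul,
      setLIntegral_congr Iio_ae_eq_Iic.symm, ← Set.Iio_inter_Iio, Set.inter_comm,
      ← Measure.restrict_restrict measurableSet_Iio,
      ← lintegral_indicator (μ := halfLine.restrict (Set.Iio u)) measurableSet_Iio]
    congr 1
    refine lintegral_congr fun t => ?_
    by_cases h : t ∈ Set.Iio T <;> simp [h]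
  rw [h0, lintegral_conv (measurable_one.indicator measurableSet_Iio) hφ,
    ← lintegral_add_right _ hm]
  have h2 : ∀ u, disc 1 u * φ u *
      ∫⁻ t in Set.Iic u, (Set.Iio T).indicator 1 t * (disc 1 t)⁻¹ ∂halfLine + disc 1 u * φ u =
      disc 1 u * φ u * (disc 1 (min u T))⁻¹ := fun u => by
    rw [← h1]; ring
  simp only [h2]
  rw [lintegral_halfLine_split _ T]
  · congr 1
    · refine setLIntegral_congr_fun measurableSet_Iio fun u hu => ?_
      have hu : u < T := hu
      simp only [min_eq_left hu.le]
      rw [mul_comm (disc 1 u), mul_assoc,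
        ENNReal.mul_inv_cancel (disc_ne_zero _ _) (disc_ne_top _ _), mul_one]
    · refine lintegral_congr fun s => ?_
      rw [min_eq_right (by simp), disc_add_right]
      calc _ = disc 1 s * φ (T + s) * (disc 1 T * (disc 1 T)⁻¹) := by ring
        _ = _ := by rw [ENNReal.mul_inv_cancel (disc_ne_zero _ _) (disc_ne_top _ _), mul_one]
  · exact hm.mul ((measurable_disc 1).comp (measurable_id.min measurable_const)).inv

/-! ### Occupation functionals and Green measures -/

/-- The value `f (X t)` as long as `X` has not visited `F` by time `t`, and `0` afterwards. -/
def alive (F : Set ℂ) (f : ℂ → ℝ≥0∞) (X : PathSp) (t : ℝ≥0) : ℝ≥0∞ :=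
  (hitBy F t)ᶜ.indicator (fun X => f (X t)) X

/-- The discounted occupation functional of a path up to its first visit to `F`. -/
def occ (α : ℝ≥0) (F : Set ℂ) (f : ℂ → ℝ≥0∞) (X : PathSp) : ℝ≥0∞ :=
  ∫⁻ t, disc α t * alive F f X t ∂halfLine

/-- The discounted Green measure of `P` started at `x` and killed at the first visit to `F`. -/
def green (P : ℂ → ProbabilityMeasure PathSp) (α : ℝ≥0) (F : Set ℂ) (x : ℂ) : Measure ℂ :=
  (((halfLine.withDensity (disc α)).prod (P x : Measure PathSp)).restrict
    {p : ℝ≥0 × PathSp | p.2 ∈ hitBy F p.1}ᶜ).map fun p => p.2 p.1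

lemma alive_of_mem {F : Set ℂ} {f : ℂ → ℝ≥0∞} {X : PathSp} {t : ℝ≥0} (h : X ∈ hitBy F t) :
    alive F f X t = 0 := Set.indicator_of_notMem (Set.notMem_compl_iff.2 h) _

lemma alive_of_notMem {F : Set ℂ} {f : ℂ → ℝ≥0∞} {X : PathSp} {t : ℝ≥0} (h : X ∉ hitBy F t) :
    alive F f X t = f (X t) := Set.indicator_of_mem (s := (hitBy F t)ᶜ) h _

@[simp] lemma alive_empty (f : ℂ → ℝ≥0∞) (X : PathSp) (t : ℝ≥0) : alive ∅ f X t = f (X t) :=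
  alive_of_notMem (by simp)

lemma measurable_alive_uncurry {F : Set ℂ} (hF : IsClosed F) {f : ℂ → ℝ≥0∞} (hf : Measurable f) :
    Measurable fun p : ℝ≥0 × PathSp => alive F f p.2 p.1 :=
  (hf.comp measurable_eval_uncurry).indicator (measurableSet_hitBy_uncurry hF).compl

lemma measurable_alive {F : Set ℂ} (hF : IsClosed F) {f : ℂ → ℝ≥0∞} (hf : Measurable f)
    (X : PathSp) : Measurable (alive F f X) :=
  (measurable_alive_uncurry hF hf).comp measurable_prodMk_right

lemma measurable_occ (α : ℝ≥0) {F : Set ℂ} (hF : IsClosed F) {f : ℂ → ℝ≥0∞} (hf : Measurable f) :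
    Measurable (occ α F f) :=
  Measurable.lintegral_prod_left' (f := fun p : ℝ≥0 × PathSp => disc α p.1 * alive F f p.2 p.1)
    (((measurable_disc α).comp measurable_fst).mul (measurable_alive_uncurry hF hf))

lemma lintegral_green (P : ℂ → ProbabilityMeasure PathSp) (α : ℝ≥0) {F : Set ℂ}
    (hF : IsClosed F) (x : ℂ) {f : ℂ → ℝ≥0∞} (hf : Measurable f) :
    ∫⁻ y, f y ∂green P α F x = ∫⁻ X, occ α F f X ∂(P x : Measure PathSp) := by
  have hm := measurable_alive_uncurry hF hf
  have hs : SFinite (halfLine.withDensity (disc α)) := by infer_instance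
  rw [green, lintegral_map hf measurable_eval_uncurry,
    ← lintegral_indicator (measurableSet_hitBy_uncurry hF).compl]
  change ∫⁻ p : ℝ≥0 × PathSp, alive F f p.2 p.1 ∂_ = _
  rw [lintegral_prod _ hm.aemeasurable, lintegral_withDensity_eq_lintegral_mul _
    (measurable_disc α) hm.lintegral_prod_right']
  simp only [Pi.mul_apply, occ]
  have hm2 : Measurable fun p : ℝ≥0 × PathSp => disc α p.1 * alive F f p.2 p.1 :=
    ((measurable_disc α).comp measurable_fst).mul hm
  rw [← lintegral_lintegral_swap (f := fun t X => disc α t * alive F f X t) hm2.aemeasurable]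
  refine lintegral_congr fun t => ?_
  rw [lintegral_const_mul]
  exact hm.comp measurable_prodMk_left

lemma measurable_green {P : ℂ → ProbabilityMeasure PathSp} (hP : Continuous P) (α : ℝ≥0)
    {F : Set ℂ} (hF : IsClosed F) : Measurable (green P α F) := by
  refine Measure.measurable_of_measurable_coe _ fun s hs => ?_
  have h : ∀ x, green P α F x s =
      ∫⁻ X, occ α F (s.indicator 1) X ∂(P x : Measure PathSp) := fun x => by
    rw [← lintegral_green P α hF x (measurable_one.indicator hs), lintegral_indicator_one hs]
  simp only [h]
  exact measurable_lintegral_law hP (measurable_occ α hF (measurable_one.indicator hs))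

lemma mem_hitBy_add {F : Set ℂ} {X : PathSp} {t : ℝ≥0} (h : ∀ u < t, X u ∉ F) (s : ℝ≥0) :
    X ∈ hitBy F (t + s) ↔ pathShift t X ∈ hitBy F s := by
  constructor
  · rintro ⟨u, hu, hX⟩
    have htu : t ≤ u := not_lt.1 fun h' => h u h' hX
    exact ⟨u - t, tsub_le_iff_left.2 hu, by simpa [add_tsub_cancel_of_le htu] using hX⟩
  · rintro ⟨u, hu, hX⟩
    exact ⟨t + u, by gcongr, hX⟩

lemma alive_shift {F : Set ℂ} {X : PathSp} {t : ℝ≥0} (h : ∀ u < t, X u ∉ F) (f : ℂ → ℝ≥0∞)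
    (s : ℝ≥0) : alive F f X (t + s) = alive F f (pathShift t X) s := by
  by_cases hX : X ∈ hitBy F (t + s)
  · rw [alive_of_mem hX, alive_of_mem ((mem_hitBy_add h s).1 hX)]
  · rw [alive_of_notMem hX, alive_of_notMem fun h' => hX ((mem_hitBy_add h s).2 h')]
    rfl

lemma occ_shift (α : ℝ≥0) {F : Set ℂ} {X : PathSp} {t : ℝ≥0} (h : ∀ u < t, X u ∉ F)
    (f : ℂ → ℝ≥0∞) :
    occ α F f (pathShift t X) = ∫⁻ s, disc α s * alive F f X (t + s) ∂halfLine :=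
  lintegral_congr fun s => by rw [alive_shift h]

lemma notMem_of_lt_hitTime {F : Set ℂ} {X : PathSp} {u : ℝ≥0} (hu : u < hitTime F X) : X u ∉ F :=
  fun h => absurd hu (not_lt.2 (hitTime_le h))

lemma setLIntegral_alive {F F' : Set ℂ} (hF : IsClosed F) (h : F' ⊆ F)
    (f : ℂ → ℝ≥0∞) {X : PathSp} (hX : X ∈ hits F) (α : ℝ≥0) :
    ∫⁻ t in Set.Iio (hitTime F X), disc α t * alive F' f X t ∂halfLine = occ α F f X := by
  rw [← lintegral_indicator measurableSet_Iio]
  refine lintegral_congr fun t => ?_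
  by_cases ht : t < hitTime F X
  · have h1 : X ∉ hitBy F t := fun h' => absurd ht (not_lt.2 ((hitTime_le_iff hF hX).2 h'))
    rw [Set.indicator_of_mem (by exact ht), alive_of_notMem h1,
      alive_of_notMem fun h' => h1 (hitBy_subset h t h')]
  · rw [Set.indicator_of_notMem (by exact ht),
      alive_of_mem ((hitTime_le_iff hF hX).1 (not_lt.1 ht)), mul_zero]

lemma occ_split (α : ℝ≥0) {F F' : Set ℂ} (hF : IsClosed F) (hF' : IsClosed F') (h : F' ⊆ F)
    {f : ℂ → ℝ≥0∞} (hf : Measurable f) {X : PathSp} (hX : X ∈ hits F) :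
    occ α F' f X = occ α F f X +
      disc α (hitTime F X) * occ α F' f (pathShift (hitTime F X) X) := by
  have hm : Measurable fun t => disc α t * alive F' f X t :=
    (measurable_disc α).mul (measurable_alive hF' hf X)
  rw [occ, lintegral_halfLine_split hm (hitTime F X), setLIntegral_alive hF h f hX,
    occ_shift α (fun u hu h' => notMem_of_lt_hitTime hu (h h')),
    ← lintegral_const_mul]
  · congr 1
    refine lintegral_congr fun s => ?_
    rw [disc_add_right, mul_assoc]
  · exact (measurable_disc α).mul ((measurable_alive hF' hf X).comp (measurable_const_add _))

lemma green_split {P : ℂ → ProbabilityMeasure PathSp} (hP : ContMTCBM P) {F F' : Set ℂ}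
    (hF : IsClosed F) (hF' : IsClosed F') (h : F' ⊆ F) {x : ℂ}
    (hx : ∀ᵐ X ∂(P x : Measure PathSp), X ∈ hits F) {f : ℂ → ℝ≥0∞} (hf : Measurable f) :
    ∫⁻ y, f y ∂green P 0 F' x = ∫⁻ y, f y ∂green P 0 F x +
      ∫⁻ y, ∫⁻ w, f w ∂green P 0 F' y ∂hitLaw P F x := by
  simp only [lintegral_green P 0 hF' _ hf, lintegral_green P 0 hF _ hf]
  rw [← strong_markov hP hF x hx (measurable_occ 0 hF' hf),
    ← lintegral_add_left (measurable_occ 0 hF hf)]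
  refine lintegral_congr_ae ?_
  filter_upwards [hx] with X hX
  rw [occ_split 0 hF hF' h hf hX, disc_zero_left, one_mul]

/-- Integrating a conditional expectation of the future along the path. -/
lemma lintegral_green_future {P : ℂ → ProbabilityMeasure PathSp} (hP : ContMTCBM P) (α : ℝ≥0)
    {F : Set ℂ} (hF : IsClosed F) (x : ℂ) {g : PathSp → ℝ≥0∞} (hg : Measurable g) :
    ∫⁻ y, ∫⁻ Y, g Y ∂(P y : Measure PathSp) ∂green P α F x =
      ∫⁻ X, ∫⁻ t, disc α t * (hitBy F t)ᶜ.indicator (fun X => g (pathShift t X)) X ∂halfLine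
        ∂(P x : Measure PathSp) := by
  have hΦ := measurable_lintegral_law hP.cont hg
  have hm1 : Measurable fun p : ℝ≥0 × PathSp => disc α p.1 *
      alive F (fun y => ∫⁻ Y, g Y ∂(P y : Measure PathSp)) p.2 p.1 :=
    ((measurable_disc α).comp measurable_fst).mul (measurable_alive_uncurry hF hΦ)
  have hg2 : Measurable fun p : ℝ≥0 × PathSp => g (pathShift p.1 p.2) :=
    hg.comp measurable_pathShift_uncurry
  have hm3 : Measurable fun p : ℝ≥0 × PathSp =>
      (hitBy F p.1)ᶜ.indicator (fun X => g (pathShift p.1 X)) p.2 :=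
    hg2.indicator (measurableSet_hitBy_uncurry hF).compl
  have hm2 : Measurable fun p : ℝ≥0 × PathSp => disc α p.1 *
      (hitBy F p.1)ᶜ.indicator (fun X => g (pathShift p.1 X)) p.2 :=
    ((measurable_disc α).comp measurable_fst).mul hm3
  rw [lintegral_green P α hF x hΦ]
  simp only [occ]
  rw [← lintegral_lintegral_swap (f := fun t X => disc α t *
      alive F (fun y => ∫⁻ Y, g Y ∂(P y : Measure PathSp)) X t) hm1.aemeasurable,
    ← lintegral_lintegral_swap (f := fun t X => disc α t *
      (hitBy F t)ᶜ.indicator (fun X => g (pathShift t X)) X) hm2.aemeasurable]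
  refine lintegral_congr fun t => ?_
  rw [lintegral_const_mul' _ _ (disc_ne_top _ _), lintegral_const_mul' _ _ (disc_ne_top _ _)]
  congr 1
  have hc : MeasurableSet (hitBy F t)ᶜ := (measurableSet_hitBy hF t).compl
  unfold alive
  rw [lintegral_indicator hc, lintegral_indicator hc,
    markov_lintegral hP.cont hP.markov x t (measurableSet_pastAlg_hitBy hF t).compl hg]

/-- The resolvent equation. -/
lemma green_resolvent {P : ℂ → ProbabilityMeasure PathSp} (hP : ContMTCBM P) (α γ : ℝ≥0)
    {F : Set ℂ} (hF : IsClosed F) (x : ℂ) {f : ℂ → ℝ≥0∞} (hf : Measurable f) :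
    ∫⁻ y, f y ∂green P α F x = ∫⁻ y, f y ∂green P (α + γ) F x +
      γ * ∫⁻ y, ∫⁻ w, f w ∂green P (α + γ) F y ∂green P α F x := by
  have ho := measurable_occ (α + γ) hF hf
  simp only [lintegral_green P (α + γ) hF _ hf]
  rw [lintegral_green_future hP α hF x ho, lintegral_green P α hF _ hf,
    ← lintegral_const_mul' _ _ ENNReal.coe_ne_top, ← lintegral_add_left ho]
  refine lintegral_congr fun X => ?_
  rw [occ, ← lintegral_resolvent (measurable_alive hF hf X) α γ, add_comm, occ]
  congr 2
  refine lintegral_congr fun t => ?_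
  congr 1
  by_cases hX : X ∈ hitBy F t
  · rw [Set.indicator_of_notMem (Set.notMem_compl_iff.2 hX)]
    simp only [alive_of_mem (hitBy_mono F (le_add_of_nonneg_right zero_le) hX), mul_zero,
      lintegral_zero]
  · rw [Set.indicator_of_mem (by exact hX), occ_shift]
    exact fun u hu h' => hX ⟨u, hu.le, h'⟩

lemma green_resolvent_stopped {P : ℂ → ProbabilityMeasure PathSp} (hP : ContMTCBM P)
    {F : Set ℂ} (hF : IsClosed F) {x : ℂ} (hx : ∀ᵐ X ∂(P x : Measure PathSp), X ∈ hits F)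
    {f : ℂ → ℝ≥0∞} (hf : Measurable f) :
    ∫⁻ y, ∫⁻ w, f w ∂green P 1 ∅ y ∂green P 0 F x + ∫⁻ y, f y ∂green P 1 ∅ x =
      ∫⁻ y, f y ∂green P 0 F x + ∫⁻ y, ∫⁻ w, f w ∂green P 1 ∅ y ∂hitLaw P F x := by
  have ho := measurable_occ 1 isClosed_empty hf
  have ho2 := measurable_occ 0 hF hf
  simp only [lintegral_green P 1 isClosed_empty _ hf]
  rw [lintegral_green_future hP 0 hF x ho, lintegral_green P 0 hF _ hf,
    ← strong_markov hP hF x hx ho, ← lintegral_add_left ho2, ← lintegral_add_right _ ho]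
  refine lintegral_congr_ae ?_
  filter_upwards [hx] with X hX
  have hφ : Measurable fun t => f (X t) := hf.comp X.continuous.measurable
  have e := lintegral_stopped_resolvent hφ (hitTime F X)
  have h0 := setLIntegral_alive hF (Set.empty_subset F) f hX 0
  simp only [disc_zero_left, one_mul, alive_empty] at h0
  simp only [occ, alive_empty, pathShift_apply]
  rw [h0] at e
  simp only [occ, disc_zero_left, one_mul] at e ⊢
  rw [← e, ← lintegral_indicator measurableSet_Iio]
  congr 1
  refine lintegral_congr fun t => ?_
  by_cases ht : t < hitTime F X
  · have h1 : X ∈ (hitBy F t)ᶜ :=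
      fun h' => absurd ht (not_lt.2 ((hitTime_le_iff hF hX).2 h'))
    rw [Set.indicator_of_mem h1, Set.indicator_of_mem (by exact ht)]
  · have h1 : X ∉ (hitBy F t)ᶜ :=
      Set.notMem_compl_iff.2 ((hitTime_le_iff hF hX).1 (not_lt.1 ht))
    rw [Set.indicator_of_notMem h1, Set.indicator_of_notMem (by exact ht)]

/-! ### A Markov law is determined by its transition kernels -/

lemma lintegral_mul_eq_of_setLIntegral_eq {Ω : Type*} {m m0 : MeasurableSpace Ω} (hm : m ≤ m0)
    {ν : Measure Ω} {φ ψ : Ω → ℝ≥0∞} (hφ : Measurable φ) (hψ : Measurable ψ)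
    (h : ∀ A, MeasurableSet[m] A → ∫⁻ x in A, φ x ∂ν = ∫⁻ x in A, ψ x ∂ν)
    {H : Ω → ℝ≥0∞} (hH : Measurable[m] H) :
    ∫⁻ x, H x * φ x ∂ν = ∫⁻ x, H x * ψ x ∂ν := by
  refine @Measurable.ennreal_induction Ω m
    (fun H => ∫⁻ x, H x * φ x ∂ν = ∫⁻ x, H x * ψ x ∂ν) ?_ ?_ ?_ H hH
  · intro c A hA
    have key : ∀ θ : Ω → ℝ≥0∞, Measurable θ →
        ∫⁻ x, A.indicator (fun _ => c) x * θ x ∂ν = c * ∫⁻ x in A, θ x ∂ν := fun θ hθ => by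
      rw [← lintegral_const_mul _ hθ, ← lintegral_indicator (hm _ hA)]
      refine lintegral_congr fun x => ?_
      by_cases hx : x ∈ A <;> simp [hx]
    rw [key φ hφ, key ψ hψ, h A hA]
  · intro f g _ hf hg hf' hg'
    have key : ∀ θ : Ω → ℝ≥0∞, Measurable θ → ∫⁻ x, (f + g) x * θ x ∂ν =
        ∫⁻ x, f x * θ x ∂ν + ∫⁻ x, g x * θ x ∂ν := fun θ hθ => by
      have hfθ : Measurable fun x => f x * θ x := (hf.mono hm le_rfl).mul hθ
      rw [← lintegral_add_left hfθ]
      exact lintegral_congr fun x => by simp [add_mul]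
    rw [key φ hφ, key ψ hψ, hf', hg']
  · intro f hf hmono hf'
    have key : ∀ θ : Ω → ℝ≥0∞, Measurable θ → ∫⁻ x, (⨆ n, f n x) * θ x ∂ν =
        ⨆ n, ∫⁻ x, f n x * θ x ∂ν := fun θ hθ => by
      have hfθ : ∀ n, Measurable fun x => f n x * θ x := fun n => ((hf n).mono hm le_rfl).mul hθ
      rw [← lintegral_iSup hfθ fun i j hij x => mul_le_mul_left (hmono hij x) _]
      exact lintegral_congr fun x => by rw [ENNReal.iSup_mul]
    simp only at hf' ⊢
    rw [key φ hφ, key ψ hψ]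
    exact iSup_congr fun n => hf' n

/-- The law `ν` on path space is Markov with transition kernels `K`. -/
def HasKernel (ν : Measure PathSp) (K : ℝ≥0 → ℂ → Measure ℂ) : Prop :=
  ∀ (s t : ℝ≥0) (A : Set PathSp), MeasurableSet[pastAlg s] A →
    ∀ f : ℂ → ℝ≥0∞, Measurable f →
      ∫⁻ X in A, f (X (s + t)) ∂ν = ∫⁻ X in A, ∫⁻ y, f y ∂K t (X s) ∂ν

lemma measurable_eval_pastAlg {u s : ℝ≥0} (h : u ≤ s) :
    Measurable[pastAlg s] fun X : PathSp => X u := by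
  refine Measurable.of_comap_le ?_
  exact le_iSup₂_of_le u h le_rfl

lemma lintegral_prod_eq_of_hasKernel {ν₁ ν₂ : Measure PathSp} {K : ℝ≥0 → ℂ → Measure ℂ}
    (hK : ∀ t, Measurable (K t))
    (h0 : ν₁.map (fun X : PathSp => X 0) = ν₂.map fun X : PathSp => X 0)
    (h1 : HasKernel ν₁ K) (h2 : HasKernel ν₂ K) (I : Finset ℝ≥0) :
    I.Nonempty → ∀ f : ℝ≥0 → ℂ → ℝ≥0∞, (∀ i, Measurable (f i)) →
      ∫⁻ X : PathSp, ∏ i ∈ I, f i (X i) ∂ν₁ = ∫⁻ X : PathSp, ∏ i ∈ I, f i (X i) ∂ν₂ := by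
  induction I using Finset.induction_on_max with
  | empty => exact fun h => absurd h (by simp)
  | insert a s ha ih =>
    intro _ f hf
    have has : a ∉ s := fun h => lt_irrefl _ (ha a h)
    simp only [Finset.prod_insert has]
    have hΦ : ∀ t, Measurable fun x => ∫⁻ y, f a y ∂K t x := fun t =>
      (Measure.measurable_lintegral (hf a)).comp (hK t)
    rcases s.eq_empty_or_nonempty with rfl | hs
    · have key : ∀ ν : Measure PathSp, HasKernel ν K → ∫⁻ X : PathSp, f a (X a) ∂ν =
          ∫⁻ x, ∫⁻ y, f a y ∂K a x ∂(ν.map fun X : PathSp => X 0) := fun ν hν => by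
        rw [lintegral_map (hΦ a) (measurable_eval 0)]
        simpa using hν 0 a Set.univ MeasurableSet.univ (f a) (hf a)
      simp only [Finset.prod_empty, mul_one]
      rw [key _ h1, key _ h2, h0]
    · set b := s.max' hs with hb
      have hbs : b ∈ s := s.max'_mem hs
      obtain ⟨t, rfl⟩ : ∃ t, a = b + t := ⟨a - b, (add_tsub_cancel_of_le (ha b hbs).le).symm⟩
      have hH : Measurable[pastAlg b] fun X : PathSp => ∏ i ∈ s, f i (X i) :=
        Finset.measurable_fun_prod _ fun i hi =>
          (hf i).comp (measurable_eval_pastAlg (s.le_max' i hi))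
      have key : ∀ ν : Measure PathSp, HasKernel ν K →
          ∫⁻ X : PathSp, f (b + t) (X (b + t)) * ∏ i ∈ s, f i (X i) ∂ν =
          ∫⁻ X : PathSp, ∏ i ∈ s, Function.update f b
            (fun x => f b x * ∫⁻ y, f (b + t) y ∂K t x) i (X i) ∂ν := fun ν hν => by
        have := lintegral_mul_eq_of_setLIntegral_eq (pastAlg_le b) (ν := ν)
          ((hf (b + t)).comp (measurable_eval (b + t))) ((hΦ t).comp (measurable_eval b))
          (fun A hA => hν b t A hA _ (hf _)) hH
        rw [lintegral_congr fun X => mul_comm _ _]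
        refine this.trans (lintegral_congr fun X => ?_)
        set g := Function.update f b fun x => f b x * ∫⁻ y, f (b + t) y ∂K t x with hg
        have hprod : ∏ i ∈ s.erase b, g i (X i) = ∏ i ∈ s.erase b, f i (X i) :=
          Finset.prod_congr rfl fun i hi => by
            rw [hg, Function.update_of_ne (Finset.ne_of_mem_erase hi)]
        have hgb : g b (X b) = f b (X b) * ∫⁻ y, f (b + t) y ∂K t (X b) := by
          rw [hg, Function.update_self]
        rw [← Finset.mul_prod_erase s (fun i => f i (X i)) hbs,
          ← Finset.mul_prod_erase s (fun i => g i (X i)) hbs, hprod, hgb]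
        simp only [Function.comp_apply]
        ring
      rw [key _ h1, key _ h2]
      refine ih hs _ fun i => ?_
      by_cases hi : i = b
      · subst hi
        rw [Function.update_self]
        exact (hf _).mul (hΦ t)
      · rw [Function.update_of_ne hi]
        exact hf i

lemma eq_of_hasKernel {ν₁ ν₂ : Measure PathSp} [IsProbabilityMeasure ν₁] [IsProbabilityMeasure ν₂]
    {K : ℝ≥0 → ℂ → Measure ℂ} (hK : ∀ t, Measurable (K t))
    (h0 : ν₁.map (fun X : PathSp => X 0) = ν₂.map fun X : PathSp => X 0)
    (h1 : HasKernel ν₁ K) (h2 : HasKernel ν₂ K) : ν₁ = ν₂ := by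
  let m : ℝ≥0 → MeasurableSpace PathSp := fun u =>
    MeasurableSpace.comap (fun X : PathSp => X u) inferInstance
  let π : ℝ≥0 → Set (Set PathSp) := fun u => {s | MeasurableSet[m u] s}
  refine ext_of_generate_finite (piiUnionInter π Set.univ) ?_
    (isPiSystem_piiUnionInter π (fun u => (@MeasurableSpace.isPiSystem_measurableSet _ (m u))) _)
    ?_ (by simp)
  · have := generateFrom_piiUnionInter_measurableSet m Set.univ
    refine Eq.trans ?_ this.symm
    simp only [Set.mem_univ, iSup_pos]
    exact borel_pathSp
  · rintro _ ⟨I, -, S, hS, rfl⟩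
    rcases I.eq_empty_or_nonempty with rfl | hI
    · simp
    choose! B hB hBS using hS
    have hBmeas : ∀ i, MeasurableSet (if i ∈ I then B i else ∅) := fun i => by
      by_cases hi : i ∈ I
      · simpa [hi] using hB i hi
      · simp [hi]
    have hset : ⋂ x ∈ I, S x = ⋂ x ∈ I, (fun X : PathSp => X x) ⁻¹' (if x ∈ I then B x else ∅) :=
      Set.iInter₂_congr fun x hx => by rw [if_pos hx, hBS x hx]
    have hms : MeasurableSet (⋂ x ∈ I, S x) := by
      rw [hset]
      exact Finset.measurableSet_biInter _ fun i _ => measurable_eval i (hBmeas i)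
    have key : ∀ ν : Measure PathSp, ν (⋂ x ∈ I, S x) = ∫⁻ X : PathSp, ∏ i ∈ I,
        (if i ∈ I then B i else ∅).indicator (fun _ => (1 : ℝ≥0∞)) (X i) ∂ν := fun ν => by
      rw [← lintegral_indicator_one hms]
      refine lintegral_congr fun X => ?_
      rw [hset]
      by_cases hX : X ∈ ⋂ x ∈ I, (fun X : PathSp => X x) ⁻¹' (if x ∈ I then B x else ∅)
      · rw [Set.indicator_of_mem hX, Pi.one_apply]
        rw [Set.mem_iInter₂] at hX
        exact (Finset.prod_eq_one fun i hi =>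
          Set.indicator_of_mem (s := if i ∈ I then B i else ∅) (hX i hi) _).symm
      · rw [Set.indicator_of_notMem hX]
        simp only [Set.mem_iInter₂, not_forall] at hX
        obtain ⟨i, hi, hX⟩ := hX
        exact (Finset.prod_eq_zero hi (Set.indicator_of_notMem (by exact hX) _)).symm
    rw [key, key]
    exact lintegral_prod_eq_of_hasKernel hK h0 h1 h2 I hI _ fun i =>
      measurable_const.indicator (hBmeas i)

/-! ### Planar Brownian motion: transition kernel, uniqueness in law, rotation invariance -/

lemma measurable_equivRealProd_symm :
    Measurable fun p : ℝ × ℝ => Complex.equivRealProd.symm p :=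
  Complex.measurableEquivRealProd.symm.measurable

instance (v : ℝ≥0) : IsProbabilityMeasure (planarGaussian v) :=
  Measure.isProbabilityMeasure_map measurable_equivRealProd_symm.aemeasurable

lemma planarGaussian_rotate (v : ℝ≥0) (θ : ℝ) :
    (planarGaussian v).map (fun y => Complex.exp (θ * Complex.I) * y) = planarGaussian v := by
  have h := IsGaussian.map_rotation_eq_self (μ := gaussianReal 0 v) (by simp) (-θ)
  have hm := measurable_equivRealProd_symm
  rw [planarGaussian, Measure.map_map (by fun_prop) hm]
  conv_rhs => rw [← h, Measure.map_map hm (by fun_prop)]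
  congr 1
  ext p
  simp only [Function.comp_apply, ContinuousLinearMap.rotation_apply,
    Complex.equivRealProd_symm_apply, Complex.exp_mul_I]
  apply Complex.ext <;>
  simp [Complex.cos_ofReal_re, Complex.sin_ofReal_re, Complex.cos_ofReal_im,
    Complex.sin_ofReal_im] <;> ring

/-- The transition kernel of planar Brownian motion. -/
def bmKernel (t : ℝ≥0) (x : ℂ) : Measure ℂ := (planarGaussian t).map fun y => x + y

lemma lintegral_bmKernel (t : ℝ≥0) (x : ℂ) {f : ℂ → ℝ≥0∞} (hf : Measurable f) :
    ∫⁻ y, f y ∂bmKernel t x = ∫⁻ y, f (x + y) ∂planarGaussian t :=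
  lintegral_map hf (by fun_prop)

lemma measurable_bmKernel (t : ℝ≥0) : Measurable (bmKernel t) := by
  refine Measure.measurable_of_measurable_coe _ fun s hs => ?_
  have h : ∀ x, bmKernel t x s = ∫⁻ y, s.indicator 1 (x + y) ∂planarGaussian t := fun x => by
    rw [← lintegral_bmKernel t x (measurable_one.indicator hs), lintegral_indicator_one hs]
  simp only [h]
  exact Measurable.lintegral_prod_right' (f := fun p : ℂ × ℂ => s.indicator 1 (p.1 + p.2))
    ((measurable_one.indicator hs).comp (by fun_prop))

/-- The law of planar Brownian motion started from `z`. -/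
structure IsBMLaw (ν : Measure PathSp) (z : ℂ) : Prop where
  prob : IsProbabilityMeasure ν
  start : ∀ᵐ X ∂ν, X 0 = z
  kernel : HasKernel ν bmKernel

lemma map_eval_zero {ν : Measure PathSp} [IsProbabilityMeasure ν] {z : ℂ}
    (h : ∀ᵐ X ∂ν, X 0 = z) : ν.map (fun X : PathSp => X 0) = Measure.dirac z := by
  rw [Measure.map_congr (g := fun _ => z) h, Measure.map_const, measure_univ, one_smul]

lemma IsBMLaw.unique {ν₁ ν₂ : Measure PathSp} {z : ℂ} (h₁ : IsBMLaw ν₁ z) (h₂ : IsBMLaw ν₂ z) :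
    ν₁ = ν₂ := by
  have := h₁.prob
  have := h₂.prob
  exact eq_of_hasKernel measurable_bmKernel
    ((map_eval_zero h₁.start).trans (map_eval_zero h₂.start).symm) h₁.kernel h₂.kernel

lemma hasKernel_of_indep {ν : Measure PathSp} [IsProbabilityMeasure ν]
    (hind : ∀ s t : ℝ≥0, Indep
      (MeasurableSpace.comap (fun X : PathSp => X (s + t) - X s) inferInstance) (pastAlg s) ν)
    (hincr : ∀ s t : ℝ≥0, ν.map (fun X : PathSp => X (s + t) - X s) = planarGaussian t) :
    HasKernel ν bmKernel := by
  intro s t A hA f hf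
  have hA' := pastAlg_le s _ hA
  have hU : Measurable[pastAlg s] fun X : PathSp => (A.indicator (1 : PathSp → ℝ≥0∞) X, X s) :=
    (Measurable.indicator (@measurable_one _ _ _ (pastAlg s) _) hA).prodMk
      (measurable_eval_pastAlg le_rfl)
  have hU' : Measurable fun X : PathSp => (A.indicator (1 : PathSp → ℝ≥0∞) X, X s) :=
    hU.mono (pastAlg_le s) le_rfl
  have hD : Measurable fun X : PathSp => X (s + t) - X s :=
    (measurable_eval _).sub (measurable_eval _)
  have hi : IndepFun (fun X : PathSp => (A.indicator (1 : PathSp → ℝ≥0∞) X, X s))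
      (fun X : PathSp => X (s + t) - X s) ν := by
    rw [IndepFun_iff_Indep]
    exact (indep_of_indep_of_le_right (hind s t) hU.comap_le).symm
  have hp := (indepFun_iff_map_prod_eq_prod_map_map hU'.aemeasurable hD.aemeasurable).1 hi
  rw [hincr] at hp
  have hg : Measurable fun q : (ℝ≥0∞ × ℂ) × ℂ => q.1.1 * f (q.1.2 + q.2) := by fun_prop
  have h1 := lintegral_map (μ := ν) hg (hU'.prodMk hD)
  rw [hp, lintegral_prod _ hg.aemeasurable, lintegral_map (hg.lintegral_prod_right') hU'] at h1
  rw [← lintegral_indicator hA', ← lintegral_indicator hA']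
  simp only [add_sub_cancel] at h1
  calc ∫⁻ X, A.indicator (fun X : PathSp => f (X (s + t))) X ∂ν
      = ∫⁻ X : PathSp, A.indicator 1 X * f (X (s + t)) ∂ν :=
        lintegral_congr fun X => by by_cases hX : X ∈ A <;> simp [hX]
    _ = _ := h1.symm
    _ = _ := lintegral_congr fun X => by
        by_cases hX : X ∈ A <;> simp [hX, lintegral_bmKernel t _ hf]

lemma exists_isBMLaw {Ω : Type*} [MeasurableSpace Ω] {μ : Measure Ω} [IsProbabilityMeasure μ]
    {B : ℝ≥0 → Ω → ℂ} {z : ℂ} (hB : IsPlanarBM μ B z) :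
    ∃ W : Ω → PathSp, Measurable W ∧ (∀ᵐ ω ∂μ, ∀ t, W ω t = B t ω) ∧ IsBMLaw (μ.map W) z := by
  classical
  set N := toMeasurable μ {ω | ¬ Continuous fun t => B t ω} with hN
  have hNm : MeasurableSet N := measurableSet_toMeasurable _ _
  have hN0 : μ N = 0 := by rw [hN, measure_toMeasurable]; exact hB.cont
  have hc : ∀ ω, ω ∉ N → Continuous fun t => B t ω := fun ω h => by
    by_contra h'
    exact h (subset_toMeasurable _ _ h')
  let W : Ω → PathSp := fun ω => if h : ω ∉ N then ⟨fun t => B t ω, hc ω h⟩ else 0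
  have hWB : ∀ ω, ω ∉ N → ∀ t, W ω t = B t ω := fun ω h t => by
    simp only [W, dif_pos h]; rfl
  have hW : Measurable W := by
    rw [measurable_path_iff]
    intro t
    have : (fun ω => W ω t) = Nᶜ.indicator (B t) := by
      ext ω
      by_cases h : ω ∈ N
      · simp [W, h]
      · rw [hWB ω h, Set.indicator_of_mem (by exact h)]
    rw [this]
    exact (hB.meas t).indicator hNm.compl
  have hae : ∀ᵐ ω ∂μ, ω ∉ N := measure_eq_zero_iff_ae_notMem.1 hN0
  have hWae : ∀ᵐ ω ∂μ, ∀ t, W ω t = B t ω := hae.mono hWB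
  have hpr : IsProbabilityMeasure (μ.map W) := Measure.isProbabilityMeasure_map hW.aemeasurable
  have hD : ∀ s t : ℝ≥0, Measurable fun X : PathSp => X (s + t) - X s := fun s t =>
    (measurable_eval _).sub (measurable_eval _)
  refine ⟨W, hW, hWae, hpr, ?_, hasKernel_of_indep ?_ ?_⟩
  · rw [ae_map_iff hW.aemeasurable (measurableSet_eq_fun (measurable_eval 0) measurable_const)]
    filter_upwards [hWae, hB.start] with ω h h'
    rw [h, h']
  · intro s t
    rw [Indep_iff]
    rintro _ A ⟨C, hC, rfl⟩ hA
    have hA' := pastAlg_le s _ hA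
    obtain ⟨A', hA'm, hAA'⟩ : EventuallyMeasurableSet
        (⨆ u ∈ Set.Iic s, MeasurableSpace.comap (B u) inferInstance) (ae μ) (W ⁻¹' A) := by
      have : MeasurableSpace.comap W (pastAlg s) ≤ eventuallyMeasurableSpace
          (⨆ u ∈ Set.Iic s, MeasurableSpace.comap (B u) inferInstance) (ae μ) := by
        rw [pastAlg, MeasurableSpace.comap_iSup]
        refine iSup_le fun u => ?_
        rw [MeasurableSpace.comap_iSup]
        refine iSup_le fun hu => ?_
        rw [MeasurableSpace.comap_comp]
        rintro _ ⟨D, hD, rfl⟩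
        refine ⟨B u ⁻¹' D, ?_, ?_⟩
        · exact (le_iSup₂_of_le (f := fun u (_ : u ∈ Set.Iic s) =>
            MeasurableSpace.comap (B u) inferInstance) u hu le_rfl) _ ⟨D, hD, rfl⟩
        · filter_upwards [hWae] with ω h
          exact propext (by change W ω u ∈ D ↔ B u ω ∈ D; rw [h])
      exact this _ ⟨A, hA, rfl⟩
    have hE : W ⁻¹' ((fun X : PathSp => X (s + t) - X s) ⁻¹' C) =ᵐ[μ]
        (fun ω => B (s + t) ω - B s ω) ⁻¹' C := by
      filter_upwards [hWae] with ω h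
      exact propext (by
        change W ω (s + t) - W ω s ∈ C ↔ B (s + t) ω - B s ω ∈ C; rw [h, h])
    rw [Measure.map_apply hW ((hD s t hC).inter hA'), Measure.map_apply hW (hD s t hC),
      Measure.map_apply hW hA', Set.preimage_inter, measure_congr (hE.inter hAA'),
      measure_congr hE, measure_congr hAA']
    exact Indep_iff _ _ _ |>.1 (hB.indep s (s + t) le_self_add) _ _ ⟨C, hC, rfl⟩ hA'm
  · intro s t
    rw [Measure.map_map (hD s t) hW]
    have := hB.incr s (s + t) le_self_add
    rw [add_tsub_cancel_left] at this
    rw [← this]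
    refine Measure.map_congr ?_
    filter_upwards [hWae] with ω h
    simp [h]

/-- Rotation of the plane about `z` by the angle `θ`. -/
def rotAbout (z : ℂ) (θ : ℝ) (w : ℂ) : ℂ := z + Complex.exp (θ * Complex.I) * (w - z)

@[fun_prop] lemma continuous_rotAbout (z : ℂ) (θ : ℝ) : Continuous (rotAbout z θ) := by
  unfold rotAbout; fun_prop

lemma measurable_rotAbout (z : ℂ) (θ : ℝ) : Measurable (rotAbout z θ) :=
  (continuous_rotAbout z θ).measurable

/-- The path obtained by rotating about `z`. -/
def rotPath (z : ℂ) (θ : ℝ) (X : PathSp) : PathSp :=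
  (⟨rotAbout z θ, continuous_rotAbout z θ⟩ : C(ℂ, ℂ)).comp X

@[simp] lemma rotPath_apply (z : ℂ) (θ : ℝ) (X : PathSp) (t : ℝ≥0) :
    rotPath z θ X t = rotAbout z θ (X t) := rfl

lemma measurable_rotPath (z : ℂ) (θ : ℝ) : Measurable (rotPath z θ) := by
  rw [measurable_path_iff]
  exact fun t => (measurable_rotAbout z θ).comp (measurable_eval t)

lemma IsBMLaw.rotate {ν : Measure PathSp} {x : ℂ} (h : IsBMLaw ν x) (z : ℂ) (θ : ℝ) :
    IsBMLaw (ν.map (rotPath z θ)) (rotAbout z θ x) := by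
  have := h.prob
  have hr := measurable_rotPath z θ
  refine ⟨Measure.isProbabilityMeasure_map hr.aemeasurable, ?_, ?_⟩
  · rw [ae_map_iff hr.aemeasurable (measurableSet_eq_fun (measurable_eval 0) measurable_const)]
    filter_upwards [h.start] with X hX
    simp [hX]
  · intro s t A hA f hf
    have hA' := pastAlg_le s _ hA
    have hA2 : MeasurableSet[pastAlg s] (rotPath z θ ⁻¹' A) := by
      have : MeasurableSpace.comap (rotPath z θ) (pastAlg s) ≤ pastAlg s := by
        conv_lhs => rw [pastAlg]
        rw [MeasurableSpace.comap_iSup]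
        refine iSup_le fun u => ?_
        rw [MeasurableSpace.comap_iSup]
        refine iSup_le fun hu => ?_
        rw [MeasurableSpace.comap_comp]
        exact ((measurable_rotAbout z θ).comp (measurable_eval_pastAlg hu)).comap_le
      exact this _ ⟨A, hA, rfl⟩
    have hK : Measurable fun x => ∫⁻ y, f y ∂bmKernel t x :=
      (Measure.measurable_lintegral hf).comp (measurable_bmKernel t)
    have e1 := setLIntegral_map (μ := ν) hA' (hf.comp (measurable_eval (s + t))) hr
    have e2 := setLIntegral_map (μ := ν) hA' (hK.comp (measurable_eval s)) hr
    simp only [Function.comp_def] at e1 e2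
    rw [e1, e2]
    refine (h.kernel s t _ hA2 _ (hf.comp (measurable_rotAbout z θ))).trans ?_
    refine lintegral_congr fun X => ?_
    rw [lintegral_bmKernel t _ (hf.comp (measurable_rotAbout z θ)), rotPath_apply,
      lintegral_bmKernel t _ hf]
    conv_rhs => rw [← planarGaussian_rotate t θ]
    rw [lintegral_map (by fun_prop) (by fun_prop)]
    refine lintegral_congr fun y => ?_
    simp only [Function.comp_apply, rotAbout]
    congr 1
    ring

/-! ### Hitting laws do not depend on the time change -/

lemma mem_hits_timeChange {F : Set ℂ} {X B : PathSp} {τ : ℝ≥0 → ℝ≥0} (h0 : τ 0 = 0)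
    (hc : Continuous τ) (ht : Tendsto τ atTop atTop) (hX : ∀ u, X u = B (τ u)) :
    X ∈ hits F ↔ B ∈ hits F := by
  constructor
  · rintro ⟨u, hu⟩
    exact ⟨τ u, hX u ▸ hu⟩
  · rintro ⟨u, hu⟩
    obtain ⟨v, hv⟩ := ht.eventually_ge_atTop u |>.exists
    obtain ⟨w, -, rfl⟩ := intermediate_value_Icc (zero_le : 0 ≤ v) hc.continuousOn
      (show u ∈ Set.Icc (τ 0) (τ v) from ⟨h0.le.trans zero_le, hv⟩)
    exact ⟨w, by rw [hX]; exact hu⟩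

lemma hitPt_timeChange {F : Set ℂ} (hF : IsClosed F) {X B : PathSp} {τ : ℝ≥0 → ℝ≥0}
    (h0 : τ 0 = 0) (hm : StrictMono τ) (hc : Continuous τ) (ht : Tendsto τ atTop atTop)
    (hX : ∀ u, X u = B (τ u)) : hitPt F X = hitPt F B := by
  by_cases h : X ∈ hits F
  · have hB := (mem_hits_timeChange h0 hc ht hX).1 h
    rw [hitPt, hX, hitPt]
    congr 1
    apply le_antisymm
    · obtain ⟨v, hv⟩ := ht.eventually_ge_atTop (hitTime F B) |>.exists
      obtain ⟨w, -, hw⟩ := intermediate_value_Icc (zero_le : 0 ≤ v) hc.continuousOn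
        (show hitTime F B ∈ Set.Icc (τ 0) (τ v) from ⟨h0.le.trans zero_le, hv⟩)
      rw [← hw]
      refine hm.monotone (hitTime_le ?_)
      rw [hX, hw]
      exact hitPt_mem hF hB
    · refine hitTime_le ?_
      rw [← hX]
      exact hitPt_mem hF h
  · have hB := fun h' => h ((mem_hits_timeChange h0 hc ht hX).2 h')
    rw [hitPt, hitPt, hitTime_of_notMem h, hitTime_of_notMem hB, hX, h0]

lemma ContMTCBM.exists_isBMLaw {P : ℂ → ProbabilityMeasure PathSp} (hP : ContMTCBM P) (z : ℂ) :
    ∃ ν, IsBMLaw ν z ∧ ∀ F, IsClosed F → hitLaw P F z = ν.map (hitPt F) ∧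
      ((∀ᵐ X ∂(P z : Measure PathSp), X ∈ hits F) ↔ ∀ᵐ X ∂ν, X ∈ hits F) := by
  obtain ⟨Ω, mΩ, μ, B, τ, Y, hμ, hB, hτ, hY, hYB, hPz⟩ := hP.timeChange z
  obtain ⟨W, hW, hWB, hν⟩ := _root_.exists_isBMLaw hB
  refine ⟨_, hν, fun F hF => ⟨?_, ?_⟩⟩
  · rw [hitLaw, ← hPz, Measure.map_map (measurable_hitPt hF) hY,
      Measure.map_map (measurable_hitPt hF) hW]
    refine Measure.map_congr ?_
    filter_upwards [hτ, hYB, hWB] with ω h1 h2 h3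
    exact hitPt_timeChange hF h1.1 h1.2.1 h1.2.2.1 h1.2.2.2 fun u => by rw [h2, h3]
  · rw [← hPz, ae_map_iff (p := (· ∈ hits F)) hY.aemeasurable (measurableSet_hits hF),
      ae_map_iff (p := (· ∈ hits F)) hW.aemeasurable (measurableSet_hits hF)]
    refine eventually_congr ?_
    filter_upwards [hτ, hYB, hWB] with ω h1 h2 h3
    exact mem_hits_timeChange h1.1 h1.2.2.1 h1.2.2.2 fun u => by rw [h2, h3]

lemma hitLaw_congr {P Q : ℂ → ProbabilityMeasure PathSp} (hP : ContMTCBM P) (hQ : ContMTCBM Q)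
    {F : Set ℂ} (hF : IsClosed F) (z : ℂ) : hitLaw P F z = hitLaw Q F z := by
  obtain ⟨ν, hν, h⟩ := hP.exists_isBMLaw z
  obtain ⟨ν', hν', h'⟩ := hQ.exists_isBMLaw z
  rw [(h F hF).1, (h' F hF).1, hν.unique hν']

lemma hitPt_rotPath {F : Set ℂ} {z : ℂ} {θ : ℝ} (hrot : ∀ w, rotAbout z θ w ∈ F ↔ w ∈ F)
    (X : PathSp) : hitPt F (rotPath z θ X) = rotAbout z θ (hitPt F X) := by
  have : hitTime F (rotPath z θ X) = hitTime F X := by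
    simp only [hitTime, rotPath_apply, hrot]
  rw [hitPt, this, rotPath_apply, hitPt]

lemma hitLaw_rotate {P : ℂ → ProbabilityMeasure PathSp} (hP : ContMTCBM P)
    {F : Set ℂ} (hF : IsClosed F) {z : ℂ} {θ : ℝ} (hrot : ∀ w, rotAbout z θ w ∈ F ↔ w ∈ F) (x : ℂ) :
    hitLaw P F (rotAbout z θ x) = (hitLaw P F x).map (rotAbout z θ) := by
  obtain ⟨ν, hν, h⟩ := hP.exists_isBMLaw x
  obtain ⟨ν', hν', h'⟩ := hP.exists_isBMLaw (rotAbout z θ x)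
  rw [(h F hF).1, (h' F hF).1, Measure.map_map (measurable_rotAbout z θ) (measurable_hitPt hF),
    hν'.unique (hν.rotate z θ), Measure.map_map (measurable_hitPt hF) (measurable_rotPath z θ)]
  congr 1
  ext X
  exact hitPt_rotPath hrot X

/-! ### Neighbourhood recurrence of planar Brownian motion -/

lemma sum_measure_le_of_hasKernel {ν : Measure PathSp}
    {K : ℝ≥0 → ℂ → Measure ℂ} (hν : HasKernel ν K) {S : Set ℂ} (hS : MeasurableSet S)
    {b : ℕ → ℝ≥0∞} (hb : ∀ (m : ℕ) x, K m x S ≤ b m) (N : ℕ) :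
    ∑ n ∈ Finset.range N, ν {X : PathSp | X n ∈ S} ≤
      ν (hits S) * ∑ m ∈ Finset.range N, b m := by
  let A : ℕ → Set PathSp := fun k => {X | X k ∈ S ∧ ∀ j < k, X (j : ℕ) ∉ S}
  have hA : ∀ k : ℕ, MeasurableSet[pastAlg k] (A k) := fun k => by
    have : A k = (fun X : PathSp => X k) ⁻¹' S ∩
        ⋂ j ∈ Finset.range k, (fun X : PathSp => X (j : ℕ)) ⁻¹' Sᶜ := by
      ext X; simp [A]
    rw [this]
    refine MeasurableSet.inter (measurable_eval_pastAlg le_rfl hS) ?_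
    refine Finset.measurableSet_biInter _ fun j hj => ?_
    exact measurable_eval_pastAlg (by exact_mod_cast (Finset.mem_range.1 hj).le) hS.compl
  have hA' : ∀ k, MeasurableSet (A k) := fun k => pastAlg_le _ _ (hA k)
  have hdisj : ∀ i j, i < j → Disjoint (A i) (A j) := fun i j hij => by
    rw [Set.disjoint_left]
    exact fun X h1 h2 => h2.2 i hij h1.1
  have hle : ∀ k m : ℕ, ν (A k ∩ {X : PathSp | X ((k + m : ℕ) : ℝ≥0) ∈ S}) ≤ ν (A k) * b m := by
    intro k m
    have h1 := hν k m (A k) (hA k) _ (measurable_one.indicator hS)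
    have h2 : ∫⁻ X in A k, S.indicator 1 (X ((k : ℝ≥0) + m)) ∂ν =
        ν (A k ∩ {X : PathSp | X ((k + m : ℕ) : ℝ≥0) ∈ S}) := by
      have hms : MeasurableSet {X : PathSp | X ((k + m : ℕ) : ℝ≥0) ∈ S} := measurable_eval _ hS
      rw [Set.inter_comm, ← Measure.restrict_apply hms, ← lintegral_indicator_one hms]
      refine lintegral_congr fun X => ?_
      push_cast
      rfl
    rw [← h2, h1]
    calc ∫⁻ X in A k, ∫⁻ y, S.indicator 1 y ∂K m (X k) ∂ν
        ≤ ∫⁻ X in A k, b m ∂ν := by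
          refine lintegral_mono fun X => ?_
          rw [lintegral_indicator_one hS]
          exact hb m _
      _ = ν (A k) * b m := by simp [mul_comm]
  have hn : ∀ n : ℕ, ν {X : PathSp | X n ∈ S} ≤
      ∑ k ∈ Finset.range (n + 1), ν (A k) * b (n - k) := by
    intro n
    calc ν {X : PathSp | X n ∈ S}
        ≤ ν (⋃ k ∈ Finset.range (n + 1), A k ∩ {X : PathSp | X n ∈ S}) := by
          refine measure_mono fun X hX => ?_
          classical
          have hex : ∃ k : ℕ, X k ∈ S := ⟨n, hX⟩
          simp only [Set.mem_iUnion]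
          refine ⟨Nat.find hex, Finset.mem_range.2 (Nat.lt_succ_of_le (Nat.find_min' hex hX)),
            ⟨Nat.find_spec hex, fun j hj => Nat.find_min hex hj⟩, hX⟩
      _ ≤ ∑ k ∈ Finset.range (n + 1), ν (A k ∩ {X : PathSp | X n ∈ S}) :=
          measure_biUnion_finset_le _ _
      _ ≤ _ := Finset.sum_le_sum fun k hk => by
          have hkn : k ≤ n := Nat.lt_succ_iff.1 (Finset.mem_range.1 hk)
          have := hle k (n - k)
          rwa [Nat.add_sub_cancel' hkn] at this
  calc ∑ n ∈ Finset.range N, ν {X : PathSp | X n ∈ S}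
      ≤ ∑ n ∈ Finset.range N, ∑ k ∈ Finset.range (n + 1), ν (A k) * b (n - k) :=
        Finset.sum_le_sum fun n _ => hn n
    _ = ∑ k ∈ Finset.range N, ∑ n ∈ Finset.Ico k N, ν (A k) * b (n - k) :=
        Finset.sum_comm' fun n k => by simp only [Finset.mem_range, Finset.mem_Ico]; omega
    _ ≤ ∑ k ∈ Finset.range N, ν (A k) * ∑ m ∈ Finset.range N, b m := by
        refine Finset.sum_le_sum fun k _ => ?_
        rw [← Finset.mul_sum, Finset.sum_Ico_eq_sum_range]
        gcongr ν (A k) * ?_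
        simp only [add_tsub_cancel_left]
        exact Finset.sum_le_sum_of_subset (Finset.range_mono (Nat.sub_le _ _))
    _ = (∑ k ∈ Finset.range N, ν (A k)) * ∑ m ∈ Finset.range N, b m :=
        (Finset.sum_mul _ _ _).symm
    _ ≤ _ := by
        gcongr
        rw [← measure_biUnion_finset (fun i _ j _ hij => ?_) fun k _ => hA' k]
        · refine measure_mono (Set.iUnion₂_subset fun k _ X hX => ⟨k, hX.1⟩)
        · rcases lt_or_gt_of_ne hij with h | h
          · exact hdisj i j h
          · exact (hdisj j i h).symm

/-- The closed square with centre `w` and side `2 r`. -/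
def box (w : ℂ) (r : ℝ) : Set ℂ := {y | y.re ∈ Set.Icc (w.re - r) (w.re + r) ∧
  y.im ∈ Set.Icc (w.im - r) (w.im + r)}

lemma isClosed_box (w : ℂ) (r : ℝ) : IsClosed (box w r) :=
  (isClosed_Icc.preimage Complex.continuous_re).inter (isClosed_Icc.preimage Complex.continuous_im)

lemma bmKernel_box (t : ℝ≥0) (x w : ℂ) (r : ℝ) : bmKernel t x (box w r) =
    gaussianReal 0 t (Set.Icc (w.re - x.re - r) (w.re - x.re + r)) *
      gaussianReal 0 t (Set.Icc (w.im - x.im - r) (w.im - x.im + r)) := by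
  have hm : Measurable fun y : ℂ => x + y := by fun_prop
  rw [bmKernel, Measure.map_apply hm (isClosed_box w r).measurableSet, planarGaussian,
    Measure.map_apply measurable_equivRealProd_symm (hm (isClosed_box w r).measurableSet),
    ← Measure.prod_prod]
  congr 1
  ext p
  simp only [box, Set.mem_preimage, Set.mem_ofPred_eq, Complex.add_re, Complex.add_im,
    Complex.equivRealProd_symm_apply, Set.mem_prod, Set.mem_Icc]
  simp only [Complex.ofReal_re, Complex.ofReal_im, Complex.mul_re, Complex.mul_im,
    Complex.I_re, Complex.I_im]
  constructor <;> rintro ⟨⟨_, _⟩, _, _⟩ <;> refine ⟨⟨?_, ?_⟩, ?_, ?_⟩ <;> linarith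

lemma gaussianReal_Icc_le {n : ℕ} (hn : 0 < n) (a : ℝ) {r : ℝ} :
    gaussianReal 0 n (Set.Icc (a - r) (a + r)) ≤
      ENNReal.ofReal ((√(2 * Real.pi * n))⁻¹ * (2 * r)) := by
  rw [gaussianReal_apply _ (by positivity)]
  calc ∫⁻ x in Set.Icc (a - r) (a + r), gaussianPDF 0 n x
      ≤ ∫⁻ x in Set.Icc (a - r) (a + r), ENNReal.ofReal (√(2 * Real.pi * n))⁻¹ := by
        refine lintegral_mono fun x => ENNReal.ofReal_le_ofReal ?_
        rw [gaussianPDFReal]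
        refine mul_le_of_le_one_right (by positivity) (Real.exp_le_one_iff.2 ?_)
        simp only [sub_zero, NNReal.coe_natCast]
        rw [neg_div]
        exact neg_nonpos.2 (by positivity)
    _ = _ := by
        rw [setLIntegral_const, Real.volume_Icc, ← ENNReal.ofReal_mul (by positivity)]
        congr 2
        ring

lemma le_gaussianReal_Icc {n : ℕ} (hn : 0 < n) {a r M : ℝ}
    (hM : ∀ x ∈ Set.Icc (a - r) (a + r), x ^ 2 ≤ M) :
    ENNReal.ofReal ((√(2 * Real.pi * n))⁻¹ * Real.exp (-M / (2 * n)) * (2 * r)) ≤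
      gaussianReal 0 n (Set.Icc (a - r) (a + r)) := by
  rw [gaussianReal_apply _ (by positivity)]
  calc _ = ∫⁻ x in Set.Icc (a - r) (a + r),
        ENNReal.ofReal ((√(2 * Real.pi * n))⁻¹ * Real.exp (-M / (2 * n))) := by
        rw [setLIntegral_const, Real.volume_Icc, ← ENNReal.ofReal_mul (by positivity)]
        congr 2
        ring
    _ ≤ _ := by
        refine setLIntegral_mono (measurable_gaussianPDF _ _) fun x hx => ?_
        refine ENNReal.ofReal_le_ofReal ?_
        rw [gaussianPDFReal]
        simp only [sub_zero, NNReal.coe_natCast]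
        gcongr
        exact hM x hx

lemma bmKernel_box_le {n : ℕ} (hn : 0 < n) (x w : ℂ) {r : ℝ} (hr : 0 ≤ r) :
    bmKernel n x (box w r) ≤ ENNReal.ofReal (2 * r ^ 2 / Real.pi / n) := by
  have hπ := Real.pi_pos
  rw [bmKernel_box]
  refine (mul_le_mul' (gaussianReal_Icc_le hn _) (gaussianReal_Icc_le hn _)).trans_eq ?_
  rw [← ENNReal.ofReal_mul (by positivity)]
  congr 1
  have h : √(2 * Real.pi * n) ^ 2 = 2 * Real.pi * n := Real.sq_sqrt (by positivity)
  have h' : √(2 * Real.pi * n) ≠ 0 := by positivity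
  have hn' : (n : ℝ) ≠ 0 := by positivity
  field_simp
  rw [h]

lemma le_bmKernel_box {n : ℕ} (hn : 0 < n) (x w : ℂ) {r : ℝ} (hr : 0 ≤ r) :
    ENNReal.ofReal (2 * r ^ 2 / Real.pi / n * (1 - (‖w - x‖ + r) ^ 2 / n)) ≤
      bmKernel n x (box w r) := by
  have hπ := Real.pi_pos
  set M := (‖w - x‖ + r) ^ 2 with hMdef
  have hM : ∀ a : ℝ, |a| ≤ ‖w - x‖ → ∀ y ∈ Set.Icc (a - r) (a + r), y ^ 2 ≤ M := by
    intro a ha y hy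
    rw [hMdef]
    refine sq_le_sq' ?_ ?_ <;> linarith [(abs_le.1 ha).1, (abs_le.1 ha).2, hy.1, hy.2]
  have h1 : |w.re - x.re| ≤ ‖w - x‖ := by simpa using Complex.abs_re_le_norm (w - x)
  have h2 : |w.im - x.im| ≤ ‖w - x‖ := by simpa using Complex.abs_im_le_norm (w - x)
  rw [bmKernel_box]
  refine le_trans ?_ (mul_le_mul' (le_gaussianReal_Icc hn (hM _ h1))
    (le_gaussianReal_Icc hn (hM _ h2)))
  rw [← ENNReal.ofReal_mul (by positivity)]
  refine ENNReal.ofReal_le_ofReal ?_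
  have h : √(2 * Real.pi * n) ^ 2 = 2 * Real.pi * n := Real.sq_sqrt (by positivity)
  have hn' : (n : ℝ) ≠ 0 := by positivity
  have he : Real.exp (-M / (2 * n)) * Real.exp (-M / (2 * n)) = Real.exp (-(M / n)) := by
    rw [← Real.exp_add]
    congr 1
    field_simp
    ring
  have e : (√(2 * Real.pi * n))⁻¹ * Real.exp (-M / (2 * n)) * (2 * r) *
      ((√(2 * Real.pi * n))⁻¹ * Real.exp (-M / (2 * n)) * (2 * r)) =
      2 * r ^ 2 / Real.pi / n * Real.exp (-(M / n)) := by
    rw [← he]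
    generalize Real.exp (-M / (2 * n)) = e
    have h' : √(2 * Real.pi * n) ≠ 0 := by positivity
    field_simp
    rw [h]
  rw [e]
  have := Real.add_one_le_exp (-(M / n))
  gcongr
  linarith

lemma IsBMLaw.measure_eval {ν : Measure PathSp} {z : ℂ} (h : IsBMLaw ν z) (t : ℝ≥0)
    {S : Set ℂ} (hS : MeasurableSet S) : ν {X : PathSp | X t ∈ S} = bmKernel t z S := by
  have := h.prob
  have h1 := h.kernel 0 t Set.univ MeasurableSet.univ _ (measurable_one.indicator hS)
  simp only [Measure.restrict_univ, zero_add, lintegral_indicator_one hS] at h1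
  rw [← lintegral_indicator_one (show MeasurableSet {X : PathSp | X t ∈ S} from
    measurable_eval t hS)]
  refine Eq.trans (lintegral_congr fun X => rfl) (h1.trans ?_)
  rw [lintegral_congr_ae (g := fun _ => bmKernel t z S) (h.start.mono fun X hX => by
    simp only [hX])]
  simp

lemma ofReal_sum_le {ι : Type*} (s : Finset ι) (f : ι → ℝ) :
    ENNReal.ofReal (∑ i ∈ s, f i) ≤ ∑ i ∈ s, ENNReal.ofReal (f i) :=
  Finset.le_sum_of_subadditive _ ENNReal.ofReal_zero.le (fun _ _ => ENNReal.ofReal_add_le) _ _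

lemma IsBMLaw.ae_hits_box {ν : Measure PathSp} {z : ℂ} (h : IsBMLaw ν z) (w : ℂ) {r : ℝ}
    (hr : 0 < r) : ∀ᵐ X ∂ν, X ∈ hits (box w r) := by
  have := h.prob
  have hπ := Real.pi_pos
  have hS := (isClosed_box w r).measurableSet
  set c : ℝ := 2 * r ^ 2 / Real.pi with hc
  have hc0 : 0 < c := by positivity
  set M : ℝ := (‖w - z‖ + r) ^ 2 with hM
  have hM0 : 0 ≤ M := by positivity
  let b : ℕ → ℝ≥0∞ := fun m => if m = 0 then 1 else ENNReal.ofReal (c / m)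
  have hb : ∀ (m : ℕ) x, bmKernel m x (box w r) ≤ b m := by
    intro m x
    rcases Nat.eq_zero_or_pos m with rfl | hm
    · have : IsProbabilityMeasure (bmKernel ((0 : ℕ) : ℝ≥0) x) :=
        Measure.isProbabilityMeasure_map (by fun_prop)
      exact prob_le_one
    · simpa [b, hm.ne'] using bmKernel_box_le hm x w hr.le
  set p : ℝ := ν.real (hits (box w r)) with hp
  have hp1 : p ≤ 1 := measureReal_le_one
  have hp0 : 0 ≤ p := measureReal_nonneg
  let H : ℕ → ℝ := fun N => ∑ n ∈ Finset.range N, 1 / ((n : ℝ) + 1)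
  have hH : Tendsto H atTop atTop := Real.tendsto_sum_range_one_div_nat_succ_atTop
  have hsq : Summable fun n : ℕ => 1 / ((n : ℝ) + 1) ^ 2 := by
    have := (summable_nat_add_iff 1).2 (Real.summable_one_div_nat_pow.2 (one_lt_two))
    simpa using this
  set C : ℝ := ∑' n : ℕ, 1 / ((n : ℝ) + 1) ^ 2 with hC
  have key : ∀ N, c * H N - c * M * C ≤ p * (1 + c * H N) := by
    intro N
    have hH0 : 0 ≤ H N := Finset.sum_nonneg fun n _ => by positivity
    have h1 := sum_measure_le_of_hasKernel h.kernel hS hb (N + 1)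
    have h2 : ∑ m ∈ Finset.range (N + 1), b m = ENNReal.ofReal (1 + c * H N) := by
      rw [Finset.sum_range_succ', ENNReal.ofReal_add zero_le_one (by positivity), add_comm,
        Finset.mul_sum, ENNReal.ofReal_sum_of_nonneg fun n _ => by positivity]
      simp [b]
      simp [div_eq_mul_inv]
    have h3 : ENNReal.ofReal (c * H N - c * M * C) ≤
        ∑ n ∈ Finset.range (N + 1), ν {X : PathSp | X n ∈ box w r} := by
      calc ENNReal.ofReal (c * H N - c * M * C)
          ≤ ENNReal.ofReal (∑ n ∈ Finset.range N,
              c / ((n : ℝ) + 1) * (1 - M / ((n : ℝ) + 1))) := by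
            refine ENNReal.ofReal_le_ofReal ?_
            have e : ∑ n ∈ Finset.range N, c / ((n : ℝ) + 1) * (1 - M / ((n : ℝ) + 1)) =
                c * H N - c * M * ∑ n ∈ Finset.range N, 1 / ((n : ℝ) + 1) ^ 2 := by
              rw [Finset.mul_sum, Finset.mul_sum, ← Finset.sum_sub_distrib]
              refine Finset.sum_congr rfl fun n _ => ?_
              field_simp
            rw [e]
            gcongr
            exact hsq.sum_le_tsum _ fun n _ => by positivity
        _ ≤ ∑ n ∈ Finset.range N, ENNReal.ofReal
              (c / ((n : ℝ) + 1) * (1 - M / ((n : ℝ) + 1))) := by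
            exact ofReal_sum_le _ _
        _ ≤ ∑ n ∈ Finset.range N, ν {X : PathSp | X ((n + 1 : ℕ) : ℝ≥0) ∈ box w r} := by
            refine Finset.sum_le_sum fun n _ => ?_
            rw [h.measure_eval _ hS]
            simpa using le_bmKernel_box n.succ_pos z w hr.le
        _ ≤ _ := by
            rw [Finset.sum_range_succ' _ N]
            exact le_self_add
    rw [h2] at h1
    have h4 := h3.trans h1
    rw [← ENNReal.ofReal_toReal (measure_ne_top ν (hits (box w r))),
      ← ENNReal.ofReal_mul ENNReal.toReal_nonneg] at h4
    exact (ENNReal.ofReal_le_ofReal_iff (by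
      positivity)).1 h4
  have hp2 : p = 1 := by
    by_contra hne
    have hlt : p < 1 := lt_of_le_of_ne hp1 hne
    obtain ⟨N, hN⟩ := (hH.eventually_gt_atTop ((c * M * C + p) / ((1 - p) * c))).exists
    rw [div_lt_iff₀ (mul_pos (by linarith) hc0)] at hN
    nlinarith [key N]
  have : ν (hits (box w r)) = 1 := by
    rw [← ENNReal.ofReal_toReal (measure_ne_top ν (hits (box w r)))]
    change ENNReal.ofReal p = 1
    rw [hp2, ENNReal.ofReal_one]
  exact (prob_compl_eq_zero_iff (measurableSet_hits (isClosed_box w r))).2 this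

lemma box_subset_closedBall (w : ℂ) (r : ℝ) : box w (r / 2) ⊆ Metric.closedBall w r := by
  rintro y ⟨⟨h1, h2⟩, h3, h4⟩
  rw [Metric.mem_closedBall, dist_eq_norm]
  have := Complex.norm_le_abs_re_add_abs_im (y - w)
  have e1 : |(y - w).re| ≤ r / 2 := abs_le.2
      (by simp only [Complex.sub_re]; constructor <;> linarith)
  have e2 : |(y - w).im| ≤ r / 2 := abs_le.2
      (by simp only [Complex.sub_im]; constructor <;> linarith)
  linarith

lemma closedBall_subset_box (w : ℂ) (r : ℝ) : Metric.closedBall w r ⊆ box w r := by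
  intro y hy
  rw [Metric.mem_closedBall, dist_eq_norm] at hy
  have e1 := abs_le.1 ((Complex.abs_re_le_norm (y - w)).trans hy)
  have e2 := abs_le.1 ((Complex.abs_im_le_norm (y - w)).trans hy)
  simp only [Complex.sub_re, Complex.sub_im] at e1 e2
  refine ⟨⟨?_, ?_⟩, ?_, ?_⟩ <;> linarith

lemma ContMTCBM.ae_hits_closedBall {P : ℂ → ProbabilityMeasure PathSp} (hP : ContMTCBM P)
    (x w : ℂ) {r : ℝ} (hr : 0 < r) :
    ∀ᵐ X ∂(P x : Measure PathSp), X ∈ hits (Metric.closedBall w r) := by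
  obtain ⟨ν, hν, h⟩ := hP.exists_isBMLaw x
  refine (h _ Metric.isClosed_closedBall).2.2 ?_
  filter_upwards [hν.ae_hits_box w (half_pos hr)] with X hX
  exact hits_subset (box_subset_closedBall w r) hX

/-- The complement of an open disc. -/
def outside (z : ℂ) (R : ℝ) : Set ℂ := {w | R ≤ dist w z}

lemma isClosed_outside (z : ℂ) (R : ℝ) : IsClosed (outside z R) :=
  isClosed_le continuous_const (by fun_prop)

lemma ContMTCBM.ae_hits_outside {P : ℂ → ProbabilityMeasure PathSp} (hP : ContMTCBM P)
    (x z : ℂ) (R : ℝ) : ∀ᵐ X ∂(P x : Measure PathSp), X ∈ hits (outside z R) := by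
  obtain ⟨ν, hν, h⟩ := hP.exists_isBMLaw x
  refine (h _ (isClosed_outside z R)).2.2 ?_
  have hle : ∀ n : ℕ, ν (hits (outside z R))ᶜ ≤
      ENNReal.ofReal (2 * |R| ^ 2 / Real.pi / ((n : ℝ) + 1)) := fun n => by
    calc ν (hits (outside z R))ᶜ ≤ ν {X : PathSp | X ((n + 1 : ℕ) : ℝ≥0) ∈ box z |R|} := by
          refine measure_mono fun X hX => closedBall_subset_box z |R| ?_
          have : X ((n + 1 : ℕ) : ℝ≥0) ∉ outside z R := fun h' => hX ⟨_, h'⟩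
          exact (not_le.1 this).le.trans (le_abs_self R)
      _ ≤ _ := by
          rw [hν.measure_eval _ (isClosed_box z |R|).measurableSet]
          simpa using bmKernel_box_le n.succ_pos x z (abs_nonneg R)
  refine nonpos_iff_eq_zero.1 (ge_of_tendsto' (x := atTop) ?_ hle)
  rw [← ENNReal.ofReal_zero]
  refine ENNReal.tendsto_ofReal ?_
  have := (tendsto_one_div_add_atTop_nhds_zero_nat (𝕜 := ℝ)).const_mul (2 * |R| ^ 2 / Real.pi)
  simpa [mul_one_div, div_eq_mul_inv] using this

/-! ### Uniform measures on circles -/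

instance factTwoPiPos : Fact (0 < 2 * Real.pi) := ⟨Real.two_pi_pos⟩

/-- The uniform probability measure on the circle group of angles modulo `2 π`. -/
abbrev angle : Measure (AddCircle (2 * Real.pi)) := AddCircle.haarAddCircle

/-- The point of the circle with center `z` through `w`, at angle `θ` from `w`. -/
def turn (z w : ℂ) (θ : AddCircle (2 * Real.pi)) : ℂ := z + AddCircle.toCircle θ * (w - z)

lemma continuous_turn (z : ℂ) :
    Continuous fun p : ℂ × AddCircle (2 * Real.pi) => turn z p.1 p.2 := by
  have := AddCircle.continuous_toCircle (T := 2 * Real.pi)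
  unfold turn
  fun_prop

lemma measurable_turn (z w : ℂ) : Measurable (turn z w) :=
  ((continuous_turn z).comp (Continuous.prodMk_right w)).measurable

lemma turn_coe (z w : ℂ) (θ : ℝ) : turn z w θ = rotAbout z θ w := by
  rw [turn, AddCircle.toCircle_apply_mk, rotAbout]
  simp [Real.pi_ne_zero]

lemma turn_turn (z w : ℂ) (θ φ : AddCircle (2 * Real.pi)) :
    turn z (turn z w θ) φ = turn z w (φ + θ) := by
  simp only [turn, AddCircle.toCircle_add, Circle.coe_mul]
  ring

lemma dist_turn (z w : ℂ) (θ : AddCircle (2 * Real.pi)) : dist (turn z w θ) z = dist w z := by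
  simp [turn, dist_eq_norm, Circle.norm_coe]

lemma dist_rotAbout (z w : ℂ) (θ : ℝ) : dist (rotAbout z θ w) z = dist w z := by
  rw [← turn_coe, dist_turn]

/-- The uniform probability measure on the circle with center `z` and radius `r`. -/
def circ (z : ℂ) (r : ℝ) : Measure ℂ := angle.map (turn z (z + r))

instance (z : ℂ) (r : ℝ) : IsProbabilityMeasure (circ z r) :=
  Measure.isProbabilityMeasure_map (measurable_turn _ _).aemeasurable

lemma lintegral_circ (z : ℂ) (r : ℝ) {f : ℂ → ℝ≥0∞} (hf : Measurable f) :
    ∫⁻ y, f y ∂circ z r = ∫⁻ θ, f (turn z (z + r) θ) ∂angle :=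
  lintegral_map hf (measurable_turn _ _)

lemma circ_zero (z : ℂ) : circ z 0 = Measure.dirac z := by
  have : turn z (z + (0 : ℝ)) = fun _ => z := by ext θ; simp [turn]
  rw [circ, this, Measure.map_const]
  simp

lemma ae_circ (z : ℂ) {r : ℝ} (hr : 0 ≤ r) : ∀ᵐ y ∂circ z r, dist y z = r := by
  rw [circ, ae_map_iff (measurable_turn _ _).aemeasurable
    (measurableSet_eq_fun (by fun_prop) measurable_const)]
  refine ae_of_all _ fun θ => ?_
  rw [dist_turn]
  simp [hr]

lemma exists_turn_eq (z w : ℂ) : ∃ ψ, turn z (z + dist w z) ψ = w := by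
  refine ⟨((w - z).arg : ℝ), ?_⟩
  rw [turn_coe, rotAbout]
  have := Complex.norm_mul_exp_arg_mul_I (w - z)
  rw [dist_eq_norm, add_sub_cancel_left, mul_comm, this]
  ring

lemma lintegral_turn (z w : ℂ) {f : ℂ → ℝ≥0∞} (hf : Measurable f) :
    ∫⁻ θ, f (turn z w θ) ∂angle = ∫⁻ y, f y ∂circ z (dist w z) := by
  rw [lintegral_circ z _ hf]
  obtain ⟨ψ, hψ⟩ := exists_turn_eq z w
  conv_lhs => rw [← hψ]
  simp only [turn_turn]
  exact lintegral_add_right_eq_self (fun θ => f (turn z (z + (dist w z : ℝ)) θ)) ψ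

/-- A rotation invariant measure is a mixture of uniform measures on circles. -/
lemma lintegral_of_rotate {Λ : Measure ℂ} [SFinite Λ] {z : ℂ}
    (h : ∀ θ : ℝ, Λ.map (rotAbout z θ) = Λ) {f : ℂ → ℝ≥0∞} (hf : Measurable f) :
    ∫⁻ y, f y ∂Λ = ∫⁻ y, ∫⁻ w, f w ∂circ z (dist y z) ∂Λ := by
  have h1 : ∀ θ, ∫⁻ y, f (turn z y θ) ∂Λ = ∫⁻ y, f y ∂Λ := fun θ => by
    induction θ using QuotientAddGroup.induction_on with
    | H θ =>
      conv_rhs => rw [← h θ, lintegral_map hf (measurable_rotAbout z θ)]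
      exact lintegral_congr fun y => by rw [turn_coe]
  simp only [← lintegral_turn z _ hf]
  rw [lintegral_lintegral_swap (f := fun y θ => f (turn z y θ))
    (hf.comp (continuous_turn z).measurable).aemeasurable]
  simp [h1]

lemma eq_circ_of_rotate {Λ : Measure ℂ} [IsProbabilityMeasure Λ] {z : ℂ} {r : ℝ}
    (h : ∀ θ : ℝ, Λ.map (rotAbout z θ) = Λ) (hr : ∀ᵐ y ∂Λ, dist y z = r) : Λ = circ z r := by
  refine Measure.ext_of_lintegral _ fun f hf => ?_
  rw [lintegral_of_rotate h hf, lintegral_congr_ae (g := fun _ => ∫⁻ w, f w ∂circ z r)]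
  · simp
  · filter_upwards [hr] with y hy
    rw [hy]

lemma circ_rotate (z : ℂ) (r : ℝ) (θ : ℝ) : (circ z r).map (rotAbout z θ) = circ z r := by
  refine Measure.ext_of_lintegral _ fun f hf => ?_
  rw [lintegral_map hf (measurable_rotAbout z θ), lintegral_circ z r hf,
    lintegral_circ z r (f := fun y => f (rotAbout z θ y)) (hf.comp (measurable_rotAbout z θ))]
  simp only [← turn_coe, turn_turn]
  exact lintegral_add_left_eq_self (fun φ => f (turn z (z + r) φ)) _

lemma volume_rotate (z : ℂ) (θ : ℝ) : (volume : Measure ℂ).map (rotAbout z θ) = volume := by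
  have h1 : MeasurePreserving (rotation (Circle.exp θ)) (volume : Measure ℂ) volume :=
    (rotation (Circle.exp θ)).measurePreserving
  have h2 := (measurePreserving_add_left (volume : Measure ℂ) z).comp
    (h1.comp (measurePreserving_sub_right (volume : Measure ℂ) z))
  convert h2.map_eq using 2
  · rfl
  · ext w
    simp [rotAbout, rotation_apply, Circle.coe_exp]

/-! ### Hitting circles -/

lemma hitPt_eq_of_mem {F : Set ℂ} {X : PathSp} (h : X 0 ∈ F) : hitPt F X = X 0 := by
  rw [hitPt, le_antisymm (hitTime_le h) zero_le]

lemma hitPt_mem_closure {F : Set ℂ} {X : PathSp} (h0 : X 0 ∉ F) : hitPt F X ∈ closure Fᶜ := by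
  rw [hitPt]
  by_cases hT : hitTime F X = 0
  · rw [hT]
    exact subset_closure h0
  · have h1 : hitTime F X ∈ closure (Set.Iio (hitTime F X)) := by
      rw [closure_Iio' ⟨0, pos_iff_ne_zero.2 hT⟩]
      exact Set.self_mem_Iic
    exact map_mem_closure X.continuous h1 fun u hu => notMem_of_lt_hitTime hu

lemma ContMTCBM.ae_start {P : ℂ → ProbabilityMeasure PathSp} (hP : ContMTCBM P) (x : ℂ) :
    ∀ᵐ X ∂(P x : Measure PathSp), X 0 = x :=
  (prob_compl_eq_zero_iff (measurableSet_eq_fun (measurable_eval 0) measurable_const)).2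
    (hP.start x)

/-- The law of the first point of `F` visited from a random starting point. -/
def balayage (P : ℂ → ProbabilityMeasure PathSp) (F : Set ℂ) (Λ : Measure ℂ) : Measure ℂ :=
  Λ.bind (hitLaw P F)

section

variable {P : ℂ → ProbabilityMeasure PathSp} (hP : ContMTCBM P)

include hP

lemma lintegral_balayage {F : Set ℂ} (hF : IsClosed F) (Λ : Measure ℂ) {f : ℂ → ℝ≥0∞}
    (hf : Measurable f) :
    ∫⁻ y, f y ∂balayage P F Λ = ∫⁻ x, ∫⁻ y, f y ∂hitLaw P F x ∂Λ :=
  Measure.lintegral_bind (measurable_hitLaw hP.cont hF).aemeasurable hf.aemeasurable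

end

/-! ### Hitting laws of discs and their complements -/

lemma dist_le_of_mem_closure_compl_outside {z w : ℂ} {R : ℝ} (h : w ∈ closure (outside z R)ᶜ) :
    dist w z ≤ R := by
  have h1 : (outside z R)ᶜ ⊆ Metric.closedBall z R := fun w hw =>
    (not_le (α := ℝ).1 hw).le
  exact closure_minimal h1 Metric.isClosed_closedBall h

lemma le_dist_of_mem_closure_compl_closedBall {z w : ℂ} {r : ℝ}
    (h : w ∈ closure (Metric.closedBall z r)ᶜ) : r ≤ dist w z := by
  have h1 : (Metric.closedBall z r)ᶜ ⊆ outside z r := fun w hw =>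
    (not_le (α := ℝ).1 hw).le
  exact closure_minimal h1 (isClosed_outside z r) h

/-- The complement of the open annulus with center `z` and radii `r`, `R`. -/
def offRing (z : ℂ) (r R : ℝ) : Set ℂ := Metric.closedBall z r ∪ outside z R

lemma isClosed_offRing (z : ℂ) (r R : ℝ) : IsClosed (offRing z r R) :=
  Metric.isClosed_closedBall.union (isClosed_outside z R)

lemma mem_outside_rotAbout (z : ℂ) (R θ : ℝ) (w : ℂ) :
    rotAbout z θ w ∈ outside z R ↔ w ∈ outside z R := by
  simp only [outside, Set.mem_ofPred_eq, dist_rotAbout]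

lemma mem_closedBall_rotAbout (z : ℂ) (r θ : ℝ) (w : ℂ) :
    rotAbout z θ w ∈ Metric.closedBall z r ↔ w ∈ Metric.closedBall z r := by
  simp only [Metric.mem_closedBall, dist_rotAbout]

lemma mem_offRing_rotAbout (z : ℂ) (r R θ : ℝ) (w : ℂ) :
    rotAbout z θ w ∈ offRing z r R ↔ w ∈ offRing z r R := by
  simp only [offRing, Set.mem_union, mem_outside_rotAbout, mem_closedBall_rotAbout]

section

variable {P : ℂ → ProbabilityMeasure PathSp} (hP : ContMTCBM P)

include hP

lemma ContMTCBM.ae_hits_offRing (x z : ℂ) (r R : ℝ) :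
    ∀ᵐ X ∂(P x : Measure PathSp), X ∈ hits (offRing z r R) := by
  filter_upwards [hP.ae_hits_outside x z R] with X hX
  exact hits_subset Set.subset_union_right hX

lemma hitLaw_of_mem {F : Set ℂ} {x : ℂ} (hx : x ∈ F) : hitLaw P F x = Measure.dirac x := by
  have h : hitPt F =ᵐ[(P x : Measure PathSp)] fun _ => x := by
    filter_upwards [hP.ae_start x] with X hX
    rw [hitPt_eq_of_mem (by rwa [hX]), hX]
  rw [hitLaw, Measure.map_congr h, Measure.map_const]
  simp

omit hP in
lemma ae_hitLaw_mem {F : Set ℂ} (hF : IsClosed F) {x : ℂ}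
    (hx : ∀ᵐ X ∂(P x : Measure PathSp), X ∈ hits F) : ∀ᵐ y ∂hitLaw P F x, y ∈ F := by
  rw [hitLaw, ae_map_iff (p := (· ∈ F)) (measurable_hitPt hF).aemeasurable hF.measurableSet]
  filter_upwards [hx] with X hX using hitPt_mem hF hX

lemma ae_hitLaw_closure {F : Set ℂ} (hF : IsClosed F) {x : ℂ} (hx : x ∉ F) :
    ∀ᵐ y ∂hitLaw P F x, y ∈ closure Fᶜ := by
  rw [hitLaw, ae_map_iff (p := (· ∈ closure Fᶜ)) (measurable_hitPt hF).aemeasurable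
    isClosed_closure.measurableSet]
  filter_upwards [hP.ae_start x] with X hX
  exact hitPt_mem_closure (by rwa [hX])

lemma ae_hitLaw_outside {x z : ℂ} {R : ℝ} (hx : dist x z ≤ R) :
    ∀ᵐ y ∂hitLaw P (outside z R) x, dist y z = R := by
  rcases hx.lt_or_eq with h | h
  · filter_upwards [ae_hitLaw_mem (isClosed_outside z R) (hP.ae_hits_outside x z R),
      ae_hitLaw_closure hP (isClosed_outside z R) (not_le.2 h)] with y h1 h2
    exact le_antisymm (dist_le_of_mem_closure_compl_outside h2) h1
  · rw [hitLaw_of_mem hP h.ge, ae_dirac_iff (measurableSet_eq_fun (by fun_prop) measurable_const)]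
    exact h

lemma ae_hitLaw_closedBall {x z : ℂ} {r : ℝ} (hr : 0 < r) (hx : r ≤ dist x z) :
    ∀ᵐ y ∂hitLaw P (Metric.closedBall z r) x, dist y z = r := by
  rcases hx.lt_or_eq with h | h
  · filter_upwards [ae_hitLaw_mem Metric.isClosed_closedBall (hP.ae_hits_closedBall x z hr),
      ae_hitLaw_closure hP Metric.isClosed_closedBall (not_le.2 h)] with y h1 h2
    exact le_antisymm h1 (le_dist_of_mem_closure_compl_closedBall h2)
  · rw [hitLaw_of_mem hP h.ge, ae_dirac_iff (measurableSet_eq_fun (by fun_prop) measurable_const)]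
    exact h.symm

lemma ae_hitLaw_offRing {x z : ℂ} {r R : ℝ} (hr : r < dist x z) (hR : dist x z < R) :
    ∀ᵐ y ∂hitLaw P (offRing z r R) x, dist y z = r ∨ dist y z = R := by
  filter_upwards [ae_hitLaw_mem (isClosed_offRing z r R) (hP.ae_hits_offRing x z r R),
    ae_hitLaw_closure hP (isClosed_offRing z r R) (x := x) (by
      rintro (h | h)
      · exact absurd hr (not_lt.2 h)
      · exact absurd hR (not_lt.2 h))] with y h1 h2
  rcases h1 with h1 | h1
  · left
    refine le_antisymm h1 (le_dist_of_mem_closure_compl_closedBall (closure_mono ?_ h2))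
    exact Set.compl_subset_compl.2 Set.subset_union_left
  · right
    refine le_antisymm (dist_le_of_mem_closure_compl_outside (closure_mono ?_ h2)) h1
    exact Set.compl_subset_compl.2 Set.subset_union_right

lemma isProbabilityMeasure_balayage {F : Set ℂ} (hF : IsClosed F) (Λ : Measure ℂ)
    [IsProbabilityMeasure Λ] : IsProbabilityMeasure (balayage P F Λ) := by
  constructor
  have := fun x => isProbabilityMeasure_hitLaw P hF x
  rw [balayage, Measure.bind_apply .univ (measurable_hitLaw hP.cont hF).aemeasurable]
  simp

lemma balayage_rotate {F : Set ℂ} (hF : IsClosed F) {z : ℂ}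
    (hrot : ∀ θ w, rotAbout z θ w ∈ F ↔ w ∈ F) (r θ : ℝ) :
    (balayage P F (circ z r)).map (rotAbout z θ) = balayage P F (circ z r) := by
  have hθ := measurable_rotAbout z θ
  refine Measure.ext_of_lintegral _ fun f hf => ?_
  have hm : Measurable fun x => ∫⁻ y, f y ∂hitLaw P F x :=
    (Measure.measurable_lintegral hf).comp (measurable_hitLaw hP.cont hF)
  rw [lintegral_map hf hθ, lintegral_balayage hP hF _ hf,
    lintegral_balayage hP hF _ (f := fun y => f (rotAbout z θ y)) (hf.comp hθ)]
  conv_rhs => rw [← circ_rotate z r θ, lintegral_map hm hθ]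
  refine lintegral_congr fun x => ?_
  rw [hitLaw_rotate hP hF (hrot θ), lintegral_map hf hθ]

lemma ae_balayage {F : Set ℂ} (hF : IsClosed F) {Λ : Measure ℂ} {p : ℂ → Prop}
    (hp : MeasurableSet {y | p y}) (h : ∀ᵐ x ∂Λ, ∀ᵐ y ∂hitLaw P F x, p y) :
    ∀ᵐ y ∂balayage P F Λ, p y := by
  change balayage P F Λ {y | p y}ᶜ = 0
  rw [balayage, Measure.bind_apply hp.compl (measurable_hitLaw hP.cont hF).aemeasurable,
    lintegral_eq_zero_iff]
  · exact h
  · exact (Measure.measurable_coe hp.compl).comp (measurable_hitLaw hP.cont hF)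

lemma balayage_outside (z : ℂ) {r R : ℝ} (hr : 0 ≤ r) (hR : r ≤ R) :
    balayage P (outside z R) (circ z r) = circ z R := by
  have := isProbabilityMeasure_balayage hP (isClosed_outside z R) (circ z r)
  refine eq_circ_of_rotate
    (balayage_rotate hP (isClosed_outside z R) (fun θ => mem_outside_rotAbout z R θ) r) ?_
  refine ae_balayage hP (isClosed_outside z R)
    (measurableSet_eq_fun (by fun_prop) measurable_const) ?_
  filter_upwards [ae_circ z hr] with x hx
  exact ae_hitLaw_outside hP (hx.le.trans hR)

lemma balayage_closedBall (z : ℂ) {r R : ℝ} (hr : 0 < r) (hR : r ≤ R) :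
    balayage P (Metric.closedBall z r) (circ z R) = circ z r := by
  have := isProbabilityMeasure_balayage hP (F := Metric.closedBall z r) Metric.isClosed_closedBall
    (circ z R)
  refine eq_circ_of_rotate
    (balayage_rotate hP Metric.isClosed_closedBall (fun θ => mem_closedBall_rotAbout z r θ) R) ?_
  refine ae_balayage hP Metric.isClosed_closedBall
    (measurableSet_eq_fun (by fun_prop) measurable_const) ?_
  filter_upwards [ae_circ z (hr.le.trans hR)] with x hx
  exact ae_hitLaw_closedBall hP hr (hR.trans hx.ge)

end

/-- The probability to reach the circle of radius `r₁` before that of radius `r₃`, starting from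
a point at distance `r₂` from the center. -/
def exitProb (P : ℂ → ProbabilityMeasure PathSp) (z : ℂ) (r₁ r₂ r₃ : ℝ) : ℝ≥0∞ :=
  balayage P (offRing z r₁ r₃) (circ z r₂) (Metric.closedBall z r₁)

lemma exitProb_congr {P Q : ℂ → ProbabilityMeasure PathSp} (hP : ContMTCBM P) (hQ : ContMTCBM Q)
    (z : ℂ) (r₁ r₂ r₃ : ℝ) : exitProb P z r₁ r₂ r₃ = exitProb Q z r₁ r₂ r₃ := by
  have : hitLaw P (offRing z r₁ r₃) = hitLaw Q (offRing z r₁ r₃) :=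
    funext fun x => hitLaw_congr hP hQ (isClosed_offRing _ _ _) x
  rw [exitProb, exitProb, balayage, balayage, this]

section

variable {P : ℂ → ProbabilityMeasure PathSp} (hP : ContMTCBM P)

include hP

lemma lintegral_balayage_offRing (z : ℂ) {r₁ r₂ r₃ : ℝ} (h1 : 0 ≤ r₁) (h12 : r₁ < r₂)
    (h23 : r₂ < r₃) {f : ℂ → ℝ≥0∞} (hf : Measurable f) :
    ∫⁻ y, f y ∂balayage P (offRing z r₁ r₃) (circ z r₂) =
      exitProb P z r₁ r₂ r₃ * ∫⁻ y, f y ∂circ z r₁ +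
        balayage P (offRing z r₁ r₃) (circ z r₂) (Metric.closedBall z r₁)ᶜ *
          ∫⁻ y, f y ∂circ z r₃ := by
  have hF := isClosed_offRing z r₁ r₃
  have := isProbabilityMeasure_balayage hP hF (circ z r₂)
  have hae : ∀ᵐ y ∂balayage P (offRing z r₁ r₃) (circ z r₂), dist y z = r₁ ∨ dist y z = r₃ := by
    refine ae_balayage hP hF ((measurableSet_eq_fun (by fun_prop) measurable_const).union
      (measurableSet_eq_fun (by fun_prop) measurable_const)) ?_
    filter_upwards [ae_circ z (h1.trans h12.le)] with x hx
    exact ae_hitLaw_offRing hP (by rwa [hx]) (by rwa [hx])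
  rw [lintegral_of_rotate (balayage_rotate hP hF (fun θ => mem_offRing_rotAbout z r₁ r₃ θ) r₂) hf,
    ← lintegral_add_compl _ (measurableSet_closedBall (x := z) (ε := r₁)), exitProb]
  congr 1
  · rw [setLIntegral_congr_fun_ae (g := fun _ => ∫⁻ y, f y ∂circ z r₁) measurableSet_closedBall]
    · rw [setLIntegral_const, mul_comm]
    · filter_upwards [hae] with y hy hy'
      rcases hy with hy | hy
      · rw [hy]
      · exact absurd (Metric.mem_closedBall.1 hy') (by rw [hy]; linarith)
  · rw [setLIntegral_congr_fun_ae (g := fun _ => ∫⁻ y, f y ∂circ z r₃)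
      measurableSet_closedBall.compl]
    · rw [setLIntegral_const, mul_comm]
    · filter_upwards [hae] with y hy hy'
      rcases hy with hy | hy
      · exact absurd (Metric.mem_closedBall.2 hy.le) hy'
      · rw [hy]

lemma hitLaw_offRing_closedBall (z x : ℂ) (r₁ r₃ : ℝ) :
    hitLaw P (offRing z r₁ r₃) x (Metric.closedBall z r₁) = exitProb P z r₁ (dist x z) r₃ := by
  have hF := isClosed_offRing z r₁ r₃
  have hm : Measurable fun x => hitLaw P (offRing z r₁ r₃) x (Metric.closedBall z r₁) :=
    (Measure.measurable_coe measurableSet_closedBall).comp (measurable_hitLaw hP.cont hF)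
  rw [exitProb, balayage, Measure.bind_apply measurableSet_closedBall
    (measurable_hitLaw hP.cont hF).aemeasurable, ← lintegral_turn z x hm]
  have : ∀ θ, hitLaw P (offRing z r₁ r₃) (turn z x θ) (Metric.closedBall z r₁) =
      hitLaw P (offRing z r₁ r₃) x (Metric.closedBall z r₁) := fun θ => by
    induction θ using QuotientAddGroup.induction_on with
    | H θ =>
      have : rotAbout z θ ⁻¹' Metric.closedBall z r₁ = Metric.closedBall z r₁ :=
        Set.ext fun w => mem_closedBall_rotAbout z r₁ θ w
      erw [turn_coe]
      rw [hitLaw_rotate hP hF (mem_offRing_rotAbout z r₁ r₃ θ),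
        Measure.map_apply (measurable_rotAbout z θ) measurableSet_closedBall, this]
  simp [this]

end

/-! ### Occupation measures between circles -/

lemma lintegral_green_eq_zero (P : ℂ → ProbabilityMeasure PathSp) (α : ℝ≥0) {F : Set ℂ}
    (hF : IsClosed F) (x : ℂ) {f : ℂ → ℝ≥0∞} (hf : Measurable f) (h : ∀ y ∉ F, f y = 0) :
    ∫⁻ y, f y ∂green P α F x = 0 := by
  rw [lintegral_green P α hF x hf]
  have : ∀ X, occ α F f X = 0 := fun X => by
    have : ∀ t, alive F f X t = 0 := fun t => by
      by_cases ht : X ∈ hitBy F t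
      · exact alive_of_mem ht
      · rw [alive_of_notMem ht]
        exact h _ fun h' => ht ⟨t, le_rfl, h'⟩
    simp [occ, this]
  simp [this]

/-- The occupation measure until the first visit to `F`, starting uniformly from a circle. -/
def circGreen (P : ℂ → ProbabilityMeasure PathSp) (z : ℂ) (r : ℝ) (F : Set ℂ) : Measure ℂ :=
  (circ z r).bind (green P 0 F)

/-- The occupation measure of a cycle between the circles of radii `r` and `R`. -/
def cycle (P : ℂ → ProbabilityMeasure PathSp) (z : ℂ) (r R : ℝ) : Measure ℂ :=
  circGreen P z r (outside z R) + circGreen P z R (Metric.closedBall z r)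

/-- The probability kernel giving the position at an independent exponential time. -/
def expKernel (P : ℂ → ProbabilityMeasure PathSp) : ℂ → Measure ℂ := green P 1 ∅

lemma lintegral_disc (α : ℝ≥0) (hα : α ≠ 0) : ∫⁻ t, disc α t ∂halfLine = (α : ℝ≥0∞)⁻¹ := by
  rw [lintegral_halfLine (measurable_disc α)]
  have h0 : (0 : ℝ) < α := by positivity
  have : ∀ x ∈ Set.Ici (0 : ℝ), disc α x.toNNReal = ENNReal.ofReal (Real.exp (-α * x)) :=
    fun x hx => by simp [disc, Real.coe_toNNReal x hx]
  rw [setLIntegral_congr_fun measurableSet_Ici this, setLIntegral_congr Ioi_ae_eq_Ici.symm,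
    ← ofReal_integral_eq_lintegral_ofReal (integrableOn_exp_mul_Ioi (by simpa using h0) 0)
      (.of_forall fun x => (Real.exp_pos _).le), integral_exp_mul_Ioi (by simpa using h0) 0]
  simp [ENNReal.ofReal_inv_of_pos h0]

section

variable {P : ℂ → ProbabilityMeasure PathSp} (hP : ContMTCBM P)

include hP

lemma lintegral_green_of_mem (α : ℝ≥0) {F : Set ℂ} (hF : IsClosed F) {x : ℂ} (hx : x ∈ F)
    {f : ℂ → ℝ≥0∞} (hf : Measurable f) : ∫⁻ y, f y ∂green P α F x = 0 := by
  rw [lintegral_green P α hF x hf, lintegral_eq_zero_iff (measurable_occ α hF hf)]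
  filter_upwards [hP.ae_start x] with X hX
  have : ∀ t, alive F f X t = 0 := fun t => alive_of_mem ⟨0, zero_le, by rwa [hX]⟩
  simp [occ, this]

lemma lintegral_circGreen (z : ℂ) (r : ℝ) {F : Set ℂ} (hF : IsClosed F) {f : ℂ → ℝ≥0∞}
    (hf : Measurable f) :
    ∫⁻ y, f y ∂circGreen P z r F = ∫⁻ x, ∫⁻ y, f y ∂green P 0 F x ∂circ z r :=
  Measure.lintegral_bind (measurable_green hP.cont 0 hF).aemeasurable hf.aemeasurable

lemma measurable_lintegral_green (α : ℝ≥0) {F : Set ℂ} (hF : IsClosed F) {f : ℂ → ℝ≥0∞}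
    (hf : Measurable f) : Measurable fun x => ∫⁻ y, f y ∂green P α F x :=
  (Measure.measurable_lintegral hf).comp (measurable_green hP.cont α hF)

lemma circGreen_split (z : ℂ) (r : ℝ) {F F' : Set ℂ} (hF : IsClosed F) (hF' : IsClosed F')
    (h : F' ⊆ F) (hx : ∀ x, ∀ᵐ X ∂(P x : Measure PathSp), X ∈ hits F)
    {f : ℂ → ℝ≥0∞} (hf : Measurable f) :
    ∫⁻ y, f y ∂circGreen P z r F' = ∫⁻ y, f y ∂circGreen P z r F +
      ∫⁻ x, ∫⁻ y, f y ∂green P 0 F' x ∂balayage P F (circ z r) := by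
  have hm := measurable_lintegral_green hP 0 hF' hf
  rw [lintegral_circGreen hP z r hF' hf, lintegral_circGreen hP z r hF hf,
    lintegral_balayage hP hF _ hm, ← lintegral_add_left (measurable_lintegral_green hP 0 hF hf)]
  exact lintegral_congr fun x => green_split hP hF hF' h (hx x) hf

lemma circGreen_outside_split (z : ℂ) {r s R : ℝ} (hr : 0 ≤ r) (hs : r ≤ s) (hR : s ≤ R)
    {f : ℂ → ℝ≥0∞} (hf : Measurable f) :
    ∫⁻ y, f y ∂circGreen P z r (outside z R) = ∫⁻ y, f y ∂circGreen P z r (outside z s) +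
      ∫⁻ y, f y ∂circGreen P z s (outside z R) := by
  rw [circGreen_split hP z r (isClosed_outside z s) (isClosed_outside z R)
    (fun w hw => hR.trans hw) (fun x => hP.ae_hits_outside x z s) hf,
    balayage_outside hP z hr hs, lintegral_circGreen hP z s (isClosed_outside z R) hf]

lemma lintegral_circGreen_eq_zero (z : ℂ) (r : ℝ) {F : Set ℂ} (hF : IsClosed F)
    {f : ℂ → ℝ≥0∞} (hf : Measurable f) (h : ∀ y ∉ F, f y = 0) :
    ∫⁻ y, f y ∂circGreen P z r F = 0 := by
  rw [lintegral_circGreen hP z r hF hf]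
  simp [lintegral_green_eq_zero P 0 hF _ hf h]

lemma lintegral_circGreen_outside_self (z : ℂ) {R : ℝ} (hR : 0 ≤ R) {f : ℂ → ℝ≥0∞}
    (hf : Measurable f) : ∫⁻ y, f y ∂circGreen P z R (outside z R) = 0 := by
  rw [lintegral_circGreen hP z R (isClosed_outside z R) hf,
    lintegral_eq_zero_iff (measurable_lintegral_green hP 0 (isClosed_outside z R) hf)]
  filter_upwards [ae_circ z hR] with x hx
  exact lintegral_green_of_mem hP 0 (isClosed_outside z R) hx.ge hf

lemma circGreen_exitProb (z : ℂ) {r₁ r₂ r₃ : ℝ} (h1 : 0 ≤ r₁) (h12 : r₁ < r₂) (h23 : r₂ < r₃)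
    {f : ℂ → ℝ≥0∞} (hf : Measurable f) (h : ∀ y ∉ Metric.closedBall z r₁, f y = 0) :
    ∫⁻ y, f y ∂circGreen P z r₂ (outside z r₃) =
      exitProb P z r₁ r₂ r₃ * ∫⁻ y, f y ∂circGreen P z r₁ (outside z r₃) := by
  have hF := isClosed_offRing z r₁ r₃
  have hG := isClosed_outside z r₃
  rw [circGreen_split hP z r₂ hF hG Set.subset_union_right
    (fun x => hP.ae_hits_offRing x z r₁ r₃) hf,
    lintegral_circGreen_eq_zero hP z r₂ hF hf (fun y hy => h y fun h' => hy (Or.inl h')), zero_add,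
    lintegral_balayage_offRing hP z h1 h12 h23 (measurable_lintegral_green hP 0 hG hf),
    ← lintegral_circGreen hP z r₃ hG hf,
    lintegral_circGreen_outside_self hP z (by linarith) hf, mul_zero, add_zero,
    lintegral_circGreen hP z r₁ hG hf]

lemma cycle_apply (z : ℂ) {r R : ℝ} {f : ℂ → ℝ≥0∞} (hf : Measurable f)
    (h : ∀ y ∉ Metric.closedBall z r, f y = 0) :
    ∫⁻ y, f y ∂cycle P z r R = ∫⁻ y, f y ∂circGreen P z r (outside z R) := by
  rw [cycle, lintegral_add_measure, lintegral_circGreen_eq_zero hP z R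
    Metric.isClosed_closedBall hf h, add_zero]

end

/-! ### Cycle measures are σ-finite and invariant -/

lemma sigmaFinite_of_lintegral_ne_top {E : Type*} [MeasurableSpace E] {ν : Measure E}
    {h : E → ℝ≥0∞} (hm : Measurable h) (hpos : ∀ x, 0 < h x) (hfin : ∫⁻ x, h x ∂ν ≠ ∞) :
    SigmaFinite ν := by
  refine ⟨⟨⟨fun n : ℕ => {x | ((n : ℝ≥0∞) + 1)⁻¹ ≤ h x}, fun _ => trivial, fun n => ?_, ?_⟩⟩⟩
  · exact (meas_ge_le_lintegral_div hm.aemeasurable (by simp) (by simp)).trans_lt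
      (ENNReal.div_lt_top hfin (by simp))
  · refine Set.eq_univ_of_forall fun x => Set.mem_iUnion.2 ?_
    obtain ⟨n, hn⟩ := ENNReal.exists_inv_nat_lt (hpos x).ne'
    refine ⟨n, le_trans ?_ hn.le⟩
    exact ENNReal.inv_le_inv.2 le_self_add

section

variable {P : ℂ → ProbabilityMeasure PathSp} (hP : ContMTCBM P)

include hP

lemma lintegral_green_pos (α : ℝ≥0) {F : Set ℂ} (hF : IsClosed F) {x : ℂ} (hx : x ∉ F)
    {f : ℂ → ℝ≥0∞} (hf : Measurable f) (hpos : ∀ y, 0 < f y) :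
    0 < ∫⁻ y, f y ∂green P α F x := by
  rw [lintegral_green P α hF x hf, pos_iff_ne_zero, ne_eq,
    lintegral_eq_zero_iff (measurable_occ α hF hf)]
  intro h
  have : ∀ᵐ X ∂(P x : Measure PathSp), occ α F f X ≠ 0 := by
    filter_upwards [hP.ae_start x] with X hX
    have h0 : X ∉ hitBy F 0 := by
      rintro ⟨u, hu, hu'⟩
      rw [le_antisymm hu zero_le, hX] at hu'
      exact hx hu'
    have hc : IsClosed {t : ℝ≥0 | X ∈ hitBy F t} :=
      (isClosed_hitBy_uncurry hF).preimage (by fun_prop : Continuous fun t : ℝ≥0 => (t, X))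
    rw [occ, ← pos_iff_ne_zero, lintegral_pos_iff_support (by
      exact (measurable_disc α).mul (measurable_alive hF hf X))]
    refine halfLine_pos_of_mem_nhds (t := 0) (mem_of_superset (hc.isOpen_compl.mem_nhds h0) ?_)
    intro t ht
    have ht' : X ∉ hitBy F t := ht
    rw [Function.mem_support, alive_of_notMem ht']
    exact mul_ne_zero (disc_ne_zero _ _) (hpos _).ne'
  obtain ⟨X, h1, h2⟩ := (this.and h).exists
  exact h1 h2

lemma lintegral_disc_hitTime_le {F : Set ℂ} (hF : IsClosed F) {x : ℂ}
    (hx : ∀ᵐ X ∂(P x : Measure PathSp), X ∈ hits F) :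
    ∫⁻ y, ∫⁻ Y, disc 1 (hitTime F Y) ∂(P y : Measure PathSp) ∂green P 0 F x ≤ 1 := by
  rw [lintegral_green_future hP 0 hF x (g := fun Y => disc 1 (hitTime F Y))
    ((measurable_disc 1).comp (measurable_hitTime hF))]
  refine (lintegral_mono_ae ?_).trans_eq
    (lintegral_one.trans (measure_univ (μ := (P x : Measure PathSp))))
  filter_upwards [hx] with X hX
  set T := hitTime F X
  have h1 : ∀ t, disc 0 t * (hitBy F t)ᶜ.indicator (fun X => disc 1 (hitTime F (pathShift t X))) X
      ≤ disc 1 T * (Set.Iio T).indicator (fun t => (disc 1 t)⁻¹) t := fun t => by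
    by_cases ht : X ∈ hitBy F t
    · rw [Set.indicator_of_notMem (Set.notMem_compl_iff.2 ht), mul_zero]
      exact zero_le
    · have htT : t < T := not_le.1 fun h' => ht ((hitTime_le_iff hF hX).1 h')
      rw [Set.indicator_of_mem (s := (hitBy F t)ᶜ) (by exact ht),
        Set.indicator_of_mem (by exact htT), disc_zero_left, one_mul, ← div_eq_mul_inv,
        ENNReal.le_div_iff_mul_le (.inl (disc_ne_zero _ _)) (.inl (disc_ne_top _ _)),
        ← disc_add_right]
      have hm : pathShift t X ∈ hits F := by
        refine ⟨T - t, ?_⟩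
        rw [pathShift_apply, add_tsub_cancel_of_le htT.le]
        exact hitPt_mem hF hX
      have := hitTime_le (F := F) (X := X) (u := t + hitTime F (pathShift t X))
        (hitPt_mem hF hm)
      exact ENNReal.ofReal_le_ofReal (Real.exp_le_exp.2 (by
        simp only [NNReal.coe_one, one_mul, neg_le_neg_iff]; rw [add_comm]; exact_mod_cast this))
  refine (lintegral_mono h1).trans ?_
  rw [lintegral_const_mul' _ _ (disc_ne_top _ _), lintegral_indicator measurableSet_Iio]
  have := lintegral_disc_inv 1 T
  rw [ENNReal.coe_one, one_mul] at this
  calc _ ≤ disc 1 T * (disc 1 T)⁻¹ := by gcongr; rw [← this]; exact le_self_add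
    _ = 1 := ENNReal.mul_inv_cancel (disc_ne_zero _ _) (disc_ne_top _ _)

lemma sigmaFinite_circGreen (z : ℂ) (r : ℝ) {F : Set ℂ} (hF : IsClosed F)
    (hx : ∀ x, ∀ᵐ X ∂(P x : Measure PathSp), X ∈ hits F) : SigmaFinite (circGreen P z r F) := by
  have hm := measurable_lintegral_law hP.cont ((measurable_disc 1).comp (measurable_hitTime hF))
  refine sigmaFinite_of_lintegral_ne_top hm (fun y => ?_) (ne_of_lt ?_)
  · rw [lintegral_pos_iff_support ((measurable_disc 1).comp (measurable_hitTime hF))]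
    have : Function.support (fun X => (disc 1 ∘ hitTime F) X) = Set.univ :=
      Set.eq_univ_of_forall fun X => disc_ne_zero _ _
    rw [this]; simp
  · rw [lintegral_circGreen hP z r hF hm]
    refine lt_of_le_of_lt (lintegral_mono fun x => lintegral_disc_hitTime_le hP hF (hx x)) ?_
    simp

lemma sigmaFinite_cycle (z : ℂ) {r : ℝ} (hr : 0 < r) (R : ℝ) : SigmaFinite (cycle P z r R) := by
  have := sigmaFinite_circGreen hP z r (isClosed_outside z R)
    (fun x => hP.ae_hits_outside x z R)
  have := sigmaFinite_circGreen hP z R (Metric.isClosed_closedBall (x := z) (ε := r))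
    (fun x => hP.ae_hits_closedBall x z hr)
  unfold cycle
  infer_instance

omit hP in
lemma isProbabilityMeasure_expKernel (x : ℂ) : IsProbabilityMeasure (expKernel P x) := by
  constructor
  rw [← lintegral_one, expKernel, lintegral_green P 1 isClosed_empty x measurable_const]
  have : ∀ X, occ 1 ∅ (fun _ => 1) X = 1 := fun X => by
    simp [occ, lintegral_disc 1 one_ne_zero]
  simp [this]

lemma measurable_expKernel : Measurable (expKernel P) := measurable_green hP.cont 1 isClosed_empty

lemma circGreen_expKernel (z : ℂ) (r : ℝ) {F : Set ℂ} (hF : IsClosed F)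
    (hx : ∀ x, ∀ᵐ X ∂(P x : Measure PathSp), X ∈ hits F) {f : ℂ → ℝ≥0∞} (hf : Measurable f) :
    ∫⁻ y, ∫⁻ w, f w ∂expKernel P y ∂circGreen P z r F +
        ∫⁻ x, ∫⁻ w, f w ∂expKernel P x ∂circ z r =
      ∫⁻ y, f y ∂circGreen P z r F +
        ∫⁻ y, ∫⁻ w, f w ∂expKernel P y ∂balayage P F (circ z r) := by
  have hm := measurable_lintegral_green hP 1 isClosed_empty hf
  unfold expKernel
  rw [lintegral_circGreen hP z r hF hf, lintegral_circGreen hP z r hF hm,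
    lintegral_balayage hP hF _ hm, ← lintegral_add_right _ hm,
    ← lintegral_add_left (measurable_lintegral_green hP 0 hF hf)]
  exact lintegral_congr fun x => green_resolvent_stopped hP hF (hx x) hf

lemma cycle_bind_expKernel (z : ℂ) {r R : ℝ} (hr : 0 < r) (hrR : r ≤ R) :
    (cycle P z r R).bind (expKernel P) = cycle P z r R := by
  have hK := fun x => isProbabilityMeasure_expKernel (P := P) x
  ext s hs
  have hf : Measurable (s.indicator (1 : ℂ → ℝ≥0∞)) := measurable_one.indicator hs
  have h1 := circGreen_expKernel hP z r (isClosed_outside z R)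
    (fun x => hP.ae_hits_outside x z R) hf
  have h2 := circGreen_expKernel hP z R (Metric.isClosed_closedBall (x := z) (ε := r))
    (fun x => hP.ae_hits_closedBall x z hr) hf
  rw [balayage_outside hP z hr.le hrR] at h1
  rw [balayage_closedBall hP z hr hrR] at h2
  have hfin : ∀ ρ, ∫⁻ x, ∫⁻ w, s.indicator 1 w ∂expKernel P x ∂circ z ρ ≠ ∞ := fun ρ => by
    refine ne_of_lt (lt_of_le_of_lt (lintegral_mono (g := fun _ => 1) fun x => ?_) (by simp))
    simp only [lintegral_indicator_one hs]
    exact prob_le_one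
  rw [Measure.bind_apply hs (measurable_expKernel hP).aemeasurable]
  simp only [← lintegral_indicator_one hs]
  rw [cycle, lintegral_add_measure, lintegral_add_measure,
    ← ENNReal.add_left_inj (ENNReal.add_ne_top.2 ⟨hfin r, hfin R⟩), add_add_add_comm, h1, h2]
  ring

lemma cycle_ne_zero (z : ℂ) {r R : ℝ} (hr : 0 ≤ r) (hrR : r < R) {f : ℂ → ℝ≥0∞}
    (hf : Measurable f) (hpos : ∀ y, 0 < f y) : 0 < ∫⁻ y, f y ∂cycle P z r R := by
  refine lt_of_lt_of_le ?_ (lintegral_mono' (Measure.le_add_right le_rfl) le_rfl)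
  rw [lintegral_circGreen hP z r (isClosed_outside z R) hf, pos_iff_ne_zero, ne_eq,
    lintegral_eq_zero_iff (measurable_lintegral_green hP 0 (isClosed_outside z R) hf)]
  intro h
  have : ∀ᵐ x ∂circ z r, False := by
    filter_upwards [h, ae_circ z hr] with x hx hx2
    refine (lintegral_green_pos hP 0 (isClosed_outside z R) (x := x) ?_ hf hpos).ne' hx
    exact fun h' => absurd (show R ≤ dist x z from h') (by rw [hx2]; exact not_le.2 hrR)
  simpa using this.exists.choose_spec

/-- Recurrence: strictly positive functions have infinite potential. -/
lemma lintegral_green_empty_eq_top (x : ℂ) {f : ℂ → ℝ≥0∞} (hf : Measurable f)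
    (hpos : ∀ y, 0 < f y) : ∫⁻ y, f y ∂green P 0 ∅ x = ∞ := by
  have h1 := circGreen_split hP x 1 (isClosed_outside x 2) isClosed_empty (Set.empty_subset _)
    (fun y => hP.ae_hits_outside y x 2) hf
  have h2 := circGreen_split hP x 2 (Metric.isClosed_closedBall (x := x) (ε := 1)) isClosed_empty
    (Set.empty_subset _) (fun y => hP.ae_hits_closedBall y x one_pos) hf
  rw [balayage_outside hP x zero_le_one one_le_two, ← lintegral_circGreen hP x 2 isClosed_empty hf]
    at h1
  rw [balayage_closedBall hP x one_pos one_le_two, ← lintegral_circGreen hP x 1 isClosed_empty hf]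
    at h2
  rw [h2, ← add_assoc, ← lintegral_add_measure, ← cycle] at h1
  have h3 := cycle_ne_zero hP x zero_le_one one_lt_two hf hpos
  have h4 : ∫⁻ y, f y ∂circGreen P x 1 ∅ = ∞ := by
    by_contra h
    exact (ENNReal.lt_add_right h h3.ne').ne (by rw [add_comm]; exact h1)
  have h5 := circGreen_split hP x 0 (isClosed_outside x 1) isClosed_empty (Set.empty_subset _)
    (fun y => hP.ae_hits_outside y x 1) hf
  rw [balayage_outside hP x le_rfl zero_le_one, ← lintegral_circGreen hP x 1 isClosed_empty hf, h4,
    lintegral_circGreen hP x 0 isClosed_empty hf, circ_zero,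
    lintegral_dirac' _ (measurable_lintegral_green hP 0 isClosed_empty hf)] at h5
  simpa using h5

end

/-! ### Invariant measures of conservative kernels -/

section

variable {E : Type*} [MeasurableSpace E]

/-- The iterates of the operator `f ↦ (x ↦ ∫ f dK x)`. -/
def kernelIter (K : E → Measure E) (h : E → ℝ≥0∞) (n : ℕ) : E → ℝ≥0∞ :=
  (fun f x => ∫⁻ y, f y ∂K x)^[n] h

lemma kernelIter_succ (K : E → Measure E) (h : E → ℝ≥0∞) (n : ℕ) (x : E) :
    kernelIter K h (n + 1) x = ∫⁻ y, kernelIter K h n y ∂K x := by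
  rw [kernelIter, Function.iterate_succ_apply']; rfl

lemma measurable_kernelIter {K : E → Measure E} (hK : Measurable K) {h : E → ℝ≥0∞}
    (hh : Measurable h) : ∀ n, Measurable (kernelIter K h n)
  | 0 => hh
  | n + 1 => by
    simp_rw [funext fun x => kernelIter_succ K h n x]
    exact (Measure.measurable_lintegral (measurable_kernelIter hK hh n)).comp hK

lemma bind_mono {μ ν : Measure E} (h : μ ≤ ν) {K : E → Measure E} (hK : Measurable K) :
    μ.bind K ≤ ν.bind K := by
  refine Measure.le_iff.2 fun s hs => ?_
  rw [Measure.bind_apply hs hK.aemeasurable, Measure.bind_apply hs hK.aemeasurable]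
  exact lintegral_mono' h le_rfl

lemma add_bind (μ ν : Measure E) {K : E → Measure E} (hK : Measurable K) :
    (μ + ν).bind K = μ.bind K + ν.bind K := by
  ext s hs
  rw [Measure.add_apply, Measure.bind_apply hs hK.aemeasurable,
    Measure.bind_apply hs hK.aemeasurable, Measure.bind_apply hs hK.aemeasurable,
    lintegral_add_measure]

/-- A subinvariant measure of a conservative kernel is invariant. -/
lemma bind_eq_of_bind_le {K : E → Measure E} (hK : Measurable K) {h : E → ℝ≥0∞}
    (hh : Measurable h) (hpos : ∀ x, 0 < h x) (hrec : ∀ x, ∑' n, kernelIter K h n x = ∞)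
    {μ : Measure E} (hfin : ∫⁻ x, h x ∂μ ≠ ∞) (hle : μ.bind K ≤ μ) : μ.bind K = μ := by
  have hs := sigmaFinite_of_lintegral_ne_top hh hpos hfin
  have hs2 : SigmaFinite (μ.bind K) := sigmaFinite_of_lintegral_ne_top hh hpos
    (ne_top_of_le_ne_top hfin (lintegral_mono' hle le_rfl))
  set g := (μ.bind K).rnDeriv μ
  have hg : Measurable g := Measure.measurable_rnDeriv _ _
  have hg1 : g ≤ᵐ[μ] 1 := Measure.rnDeriv_le_one_of_le hle
  have hd : μ.withDensity g = μ.bind K :=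
    Measure.withDensity_rnDeriv_eq _ _ (Measure.absolutelyContinuous_of_le hle)
  have hm := measurable_kernelIter hK hh
  have hstep : ∀ n, ∫⁻ x, (1 - g x) * kernelIter K h n x ∂μ + ∫⁻ x, kernelIter K h (n + 1) x ∂μ =
      ∫⁻ x, kernelIter K h n x ∂μ := fun n => by
    have h1 : ∫⁻ x, kernelIter K h (n + 1) x ∂μ = ∫⁻ x, g x * kernelIter K h n x ∂μ := by
      simp_rw [kernelIter_succ]
      rw [← Measure.lintegral_bind hK.aemeasurable (hm n).aemeasurable, ← hd,
        lintegral_withDensity_eq_lintegral_mul _ hg (hm n)]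
      rfl
    rw [h1, ← lintegral_add_right _ (by exact hg.mul (hm n))]
    refine lintegral_congr_ae ?_
    filter_upwards [hg1] with x hx
    rw [← add_mul, tsub_add_cancel_of_le (show g x ≤ 1 from hx), one_mul]
  have hsum : ∀ n, ∑ k ∈ Finset.range n, ∫⁻ x, (1 - g x) * kernelIter K h k x ∂μ +
      ∫⁻ x, kernelIter K h n x ∂μ = ∫⁻ x, h x ∂μ := fun n => by
    induction n with
    | zero => simp [kernelIter]
    | succ n ih => rw [Finset.sum_range_succ, add_assoc, hstep, ih]
  have hle2 : ∑' k, ∫⁻ x, (1 - g x) * kernelIter K h k x ∂μ ≤ ∫⁻ x, h x ∂μ :=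
    ENNReal.tsum_le_of_sum_range_le fun n => by rw [← hsum n]; exact le_self_add
  rw [← lintegral_tsum fun k => by
    exact ((measurable_const.sub hg).mul (hm k)).aemeasurable] at hle2
  simp_rw [ENNReal.tsum_mul_left, hrec] at hle2
  have hae : ∀ᵐ x ∂μ, g x = 1 := by
    have hm' : Measurable fun x => (1 - g x) * ∞ := (measurable_const.sub hg).mul_const _
    filter_upwards [ae_lt_top hm' (ne_top_of_le_ne_top hfin hle2), hg1] with x hx hx1
    refine le_antisymm hx1 (tsub_eq_zero_iff_le.1 ?_)
    by_contra h0
    rw [ENNReal.mul_top h0] at hx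
    exact lt_irrefl _ hx
  rw [← hd, withDensity_congr_ae (g := 1) hae, withDensity_one]

lemma exists_add_of_le {μ ν : Measure E} [SigmaFinite μ] [SigmaFinite ν] (h : ν ≤ μ) :
    ∃ ρ, μ = ν + ρ := by
  have hg : Measurable (ν.rnDeriv μ) := Measure.measurable_rnDeriv _ _
  have hd : μ.withDensity (ν.rnDeriv μ) = ν :=
    Measure.withDensity_rnDeriv_eq _ _ (Measure.absolutelyContinuous_of_le h)
  refine ⟨μ.withDensity fun x => 1 - ν.rnDeriv μ x, ?_⟩
  have hadd := withDensity_add_left (μ := μ) hg fun x => 1 - ν.rnDeriv μ x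
  rw [hd] at hadd
  rw [← hadd]
  conv_lhs => rw [← withDensity_one (μ := μ)]
  refine withDensity_congr_ae ?_
  filter_upwards [Measure.rnDeriv_le_one_of_le h] with x hx
  exact (add_tsub_cancel_of_le hx).symm

/-- The parts by which two invariant measures of a conservative kernel exceed their infimum are
invariant and mutually singular. -/
lemma exists_invariant_excess {K : E → Measure E} (hK : Measurable K) {h : E → ℝ≥0∞}
    (hh : Measurable h) (hpos : ∀ x, 0 < h x) (hrec : ∀ x, ∑' n, kernelIter K h n x = ∞)
    {μ ν : Measure E} (hμ : ∫⁻ x, h x ∂μ ≠ ∞) (hν : ∫⁻ x, h x ∂ν ≠ ∞)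
    (hμK : μ.bind K = μ) (hνK : ν.bind K = ν) :
    ∃ ρ₁ ρ₂ : Measure E, μ = μ ⊓ ν + ρ₁ ∧ ν = μ ⊓ ν + ρ₂ ∧ ρ₁.bind K = ρ₁ ∧ ρ₂.bind K = ρ₂ ∧
      ρ₁ ⟂ₘ ρ₂ := by
  have h1 := sigmaFinite_of_lintegral_ne_top hh hpos hμ
  have h2 := sigmaFinite_of_lintegral_ne_top hh hpos hν
  have hfin : ∫⁻ x, h x ∂(μ ⊓ ν) ≠ ∞ :=
    ne_top_of_le_ne_top hμ (lintegral_mono' inf_le_left le_rfl)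
  have h3 := sigmaFinite_of_lintegral_ne_top hh hpos hfin
  have hinv : (μ ⊓ ν).bind K = μ ⊓ ν := bind_eq_of_bind_le hK hh hpos hrec hfin
    (le_inf ((bind_mono inf_le_left hK).trans_eq hμK) ((bind_mono inf_le_right hK).trans_eq hνK))
  obtain ⟨ρ₁, hρ₁⟩ := exists_add_of_le (inf_le_left : μ ⊓ ν ≤ μ)
  obtain ⟨ρ₂, hρ₂⟩ := exists_add_of_le (inf_le_right : μ ⊓ ν ≤ ν)
  refine ⟨ρ₁, ρ₂, hρ₁, hρ₂, ?_, ?_, ?_⟩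
  · rw [← Measure.add_right_inj (μ ⊓ ν)]
    conv_lhs => rw [← hinv]
    rw [← add_bind _ _ hK, ← hρ₁, hμK]
  · rw [← Measure.add_right_inj (μ ⊓ ν)]
    conv_lhs => rw [← hinv]
    rw [← add_bind _ _ hK, ← hρ₂, hνK]
  · refine Measure.mutuallySingular_iff_disjoint.2 (disjoint_iff_inf_le.2 ?_)
    have : μ ⊓ ν + ρ₁ ⊓ ρ₂ ≤ μ ⊓ ν := le_inf
      ((add_le_add_right inf_le_left _).trans_eq hρ₁.symm)
      ((add_le_add_right inf_le_right _).trans_eq hρ₂.symm)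
    have h4 : μ ⊓ ν + ρ₁ ⊓ ρ₂ = μ ⊓ ν + 0 := by
      rw [add_zero]
      exact le_antisymm this (Measure.le_add_right le_rfl)
    rw [Measure.add_right_inj] at h4
    rw [h4]
    exact bot_le

/-- Pairwise comparability implies proportionality. -/
lemma exists_eq_smul_of_comparable {μ ν : Measure E} [SigmaFinite μ] {h : E → ℝ≥0∞}
    (hpos : ∀ x, 0 < h x) (hh : Measurable h) (hμ : ∫⁻ x, h x ∂μ ≠ ∞) (hν : ∫⁻ x, h x ∂ν ≠ ∞)
    (hμ0 : μ ≠ 0) (hν0 : ν ≠ 0)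
    (hcomp : ∀ a : ℝ≥0, a • ν ≤ μ ∨ μ ≤ a • ν) : ∃ b : ℝ≥0, b ≠ 0 ∧ μ = b • ν := by
  have hνpos : ∫⁻ x, h x ∂ν ≠ 0 := fun h0 => by
    rw [lintegral_eq_zero_iff hh] at h0
    refine hν0 (ae_eq_bot.1 (eventually_false_iff_eq_bot.1 ?_))
    filter_upwards [h0] with x hx using (hpos x).ne' hx
  have hμpos : ∫⁻ x, h x ∂μ ≠ 0 := fun h0 => by
    rw [lintegral_eq_zero_iff hh] at h0
    refine hμ0 (ae_eq_bot.1 (eventually_false_iff_eq_bot.1 ?_))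
    filter_upwards [h0] with x hx using (hpos x).ne' hx
  set b := ((∫⁻ x, h x ∂μ) / ∫⁻ x, h x ∂ν).toNNReal with hb
  have hbc : (b : ℝ≥0∞) = (∫⁻ x, h x ∂μ) / ∫⁻ x, h x ∂ν :=
    ENNReal.coe_toNNReal (ENNReal.div_ne_top hμ hνpos)
  have hbh : ∫⁻ x, h x ∂(b • ν) = ∫⁻ x, h x ∂μ := by
    rw [lintegral_smul_measure, ENNReal.smul_def, smul_eq_mul, hbc,
      ENNReal.div_mul_cancel hνpos hν]
  have hs2 : SigmaFinite (b • ν) := sigmaFinite_of_lintegral_ne_top hh hpos (by rwa [hbh])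
  have key : ∀ {ρ τ : Measure E} [SigmaFinite ρ] [SigmaFinite τ], ρ ≤ τ →
      ∫⁻ x, h x ∂ρ = ∫⁻ x, h x ∂τ → ∫⁻ x, h x ∂ρ ≠ ∞ → ρ = τ := fun {ρ τ} _ _ hle heq hf => by
    obtain ⟨σ, hσ⟩ := exists_add_of_le hle
    rw [hσ, lintegral_add_measure] at heq
    have : ∫⁻ x, h x ∂σ = 0 := by
      rw [← add_zero (∫⁻ x, h x ∂ρ), add_assoc, zero_add] at heq
      exact ((ENNReal.add_right_inj hf).1 heq).symm
    rw [lintegral_eq_zero_iff hh] at this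
    have hσ0 : σ = 0 := ae_eq_bot.1 (eventually_false_iff_eq_bot.1 (by
      filter_upwards [this] with x hx using (hpos x).ne' hx))
    rw [hσ, hσ0, add_zero]
  refine ⟨b, ?_, ?_⟩
  · intro h0
    rw [h0, ENNReal.coe_zero] at hbc
    exact (ENNReal.div_ne_zero.2 ⟨hμpos, hν⟩) hbc.symm
  · rcases hcomp b with hc | hc
    · exact (key hc hbh (by rwa [hbh])).symm
    · exact key hc hbh.symm hμ

end

/-! ### Uniqueness of the invariant measure -/

lemma disc_antitone_left (t : ℝ≥0) : Antitone fun α => disc α t := fun α β h =>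
  ENNReal.ofReal_le_ofReal (Real.exp_le_exp.2 (neg_le_neg (by exact_mod_cast mul_le_mul_left h t)))

lemma antitone_invNat : Antitone fun n : ℕ => ((n : ℝ≥0) + 1)⁻¹ := fun m n h => by
  have : (m : ℝ≥0) ≤ n := by exact_mod_cast h
  dsimp only
  gcongr

lemma tendsto_disc_zero (t : ℝ≥0) :
    Tendsto (fun n : ℕ => disc ((n : ℝ≥0) + 1)⁻¹ t) atTop (𝓝 1) := by
  have h1 : Tendsto (fun n : ℕ => (((n : ℝ≥0) + 1)⁻¹ : ℝ≥0)) atTop (𝓝 0) := by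
    have := tendsto_one_div_add_atTop_nhds_zero_nat (𝕜 := ℝ)
    rw [← NNReal.tendsto_coe]
    simpa using this
  have h2 : Continuous fun α : ℝ≥0 => disc α t := by
    unfold disc
    exact ENNReal.continuous_ofReal.comp (by fun_prop)
  have h3 := (h2.tendsto 0).comp h1
  rwa [disc_zero_left] at h3

lemma tendsto_lintegral_green (P : ℂ → ProbabilityMeasure PathSp) {F : Set ℂ} (hF : IsClosed F)
    (x : ℂ) {f : ℂ → ℝ≥0∞} (hf : Measurable f) :
    Tendsto (fun n : ℕ => ∫⁻ y, f y ∂green P ((n : ℝ≥0) + 1)⁻¹ F x) atTop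
      (𝓝 (∫⁻ y, f y ∂green P 0 F x)) := by
  simp only [lintegral_green P _ hF x hf]
  have hmono : ∀ X, Monotone fun n : ℕ => occ ((n : ℝ≥0) + 1)⁻¹ F f X := fun X m n h =>
    lintegral_mono fun t => by
      have := disc_antitone_left t (antitone_invNat h)
      dsimp only at this ⊢
      gcongr
  refine lintegral_tendsto_of_tendsto_of_monotone (fun n => (measurable_occ _ hF hf).aemeasurable)
    (.of_forall hmono) (.of_forall fun X => ?_)
  refine lintegral_tendsto_of_tendsto_of_monotone
    (fun n => ((measurable_disc _).mul (measurable_alive hF hf X)).aemeasurable)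
    (.of_forall fun t m n h => ?_) (.of_forall fun t => ?_)
  · have := disc_antitone_left t (antitone_invNat h)
    dsimp only at this ⊢
    gcongr
  · rw [disc_zero_left]
    exact ENNReal.Tendsto.mul_const (tendsto_disc_zero t) (.inl one_ne_zero)

lemma green_empty_eq_zero_iff (P : ℂ → ProbabilityMeasure PathSp) (α : ℝ≥0) (x : ℂ) {s : Set ℂ}
    (hs : MeasurableSet s) : green P α ∅ x s = 0 ↔ green P 0 ∅ x s = 0 := by
  have hf : Measurable (s.indicator (1 : ℂ → ℝ≥0∞)) := measurable_one.indicator hs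
  have key : ∀ β X, occ β ∅ (s.indicator 1) X = 0 ↔ occ 0 ∅ (s.indicator 1) X = 0 := fun β X => by
    have hm := fun β => (measurable_disc β).mul (measurable_alive isClosed_empty hf X)
    rw [occ, occ, lintegral_eq_zero_iff (by exact hm β), lintegral_eq_zero_iff (by exact hm 0)]
    refine eventually_congr (.of_forall fun t => ?_)
    simp only [Pi.zero_apply, mul_eq_zero, disc_ne_zero, false_or]
  rw [← lintegral_indicator_one hs, ← lintegral_indicator_one hs,
    lintegral_green P _ isClosed_empty x hf, lintegral_green P _ isClosed_empty x hf,
    lintegral_eq_zero_iff (measurable_occ _ isClosed_empty hf),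
    lintegral_eq_zero_iff (measurable_occ _ isClosed_empty hf)]
  exact eventually_congr (.of_forall fun X => key α X)

lemma lintegral_green_empty_one (P : ℂ → ProbabilityMeasure PathSp) {α : ℝ≥0} (hα : α ≠ 0) (x : ℂ) :
    ∫⁻ _, 1 ∂green P α ∅ x = (α : ℝ≥0∞)⁻¹ := by
  rw [lintegral_green P α isClosed_empty x measurable_const]
  have : ∀ X, occ α ∅ (fun _ => 1) X = (α : ℝ≥0∞)⁻¹ := fun X => by
    simp [occ, lintegral_disc α hα]
  simp [this]

section

variable {P : ℂ → ProbabilityMeasure PathSp} (hP : ContMTCBM P)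

include hP

lemma lintegral_green_le_tsum {α γ : ℝ≥0} (hα : α ≠ 0) (hγ : α + γ = 1) (x : ℂ) {f : ℂ → ℝ≥0∞}
    (hf : Measurable f) (hf1 : ∀ y, f y ≤ 1) :
    ∫⁻ y, f y ∂green P α ∅ x ≤ ∑' n, kernelIter (expKernel P) f n x := by
  have hm := measurable_kernelIter (measurable_expKernel hP) hf
  have hle : ∀ n y, kernelIter (expKernel P) f n y ≤ 1 := fun n => by
    induction n with
    | zero => exact hf1
    | succ n ih =>
      intro y
      have := isProbabilityMeasure_expKernel (P := P) y
      rw [kernelIter_succ]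
      exact (lintegral_mono ih).trans (by simp)
  have hγ1 : γ ≤ 1 := by rw [← hγ]; exact le_add_self
  have hstep : ∀ n, ∫⁻ y, f y ∂green P α ∅ x ≤ ∑ k ∈ Finset.range n,
      kernelIter (expKernel P) f (k + 1) x +
      (γ : ℝ≥0∞) ^ n * ∫⁻ y, kernelIter (expKernel P) f n y ∂green P α ∅ x := fun n => by
    induction n with
    | zero => simp [kernelIter]
    | succ n ih =>
      refine ih.trans ?_
      rw [green_resolvent hP α γ isClosed_empty x (hm n), hγ, Finset.sum_range_succ, mul_add,
        ← mul_assoc, ← pow_succ, add_assoc, ← expKernel, ← kernelIter_succ]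
      simp_rw [← kernelIter_succ]
      gcongr
      have : (γ : ℝ≥0∞) ^ n ≤ 1 := pow_le_one₀ zero_le (by exact_mod_cast hγ1)
      calc _ ≤ 1 * kernelIter (expKernel P) f (n + 1) x := by gcongr
        _ = _ := one_mul _
  have hγ2 : γ < 1 := by
    rw [← hγ]
    exact lt_add_of_pos_left _ (pos_iff_ne_zero.2 hα)
  have hlim : Tendsto (fun n : ℕ => ∑' k, kernelIter (expKernel P) f k x +
      (γ : ℝ≥0∞) ^ n * (α : ℝ≥0∞)⁻¹) atTop
      (𝓝 (∑' k, kernelIter (expKernel P) f k x + 0 * (α : ℝ≥0∞)⁻¹)) :=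
    tendsto_const_nhds.add (ENNReal.Tendsto.mul_const
      (ENNReal.tendsto_pow_atTop_nhds_zero_of_lt_one (by exact_mod_cast hγ2))
      (.inr (ENNReal.inv_ne_top.2 (by exact_mod_cast hα))))
  rw [zero_mul, add_zero] at hlim
  refine ge_of_tendsto' hlim fun n => (hstep n).trans ?_
  gcongr
  · calc _ ≤ ∑ k ∈ Finset.range (n + 1), kernelIter (expKernel P) f k x := by
          rw [Finset.sum_range_succ']; exact le_self_add
      _ ≤ _ := ENNReal.sum_le_tsum _
  · rw [← lintegral_green_empty_one P hα x]
    exact lintegral_mono (hle n)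

lemma tsum_kernelIter_expKernel (x : ℂ) {f : ℂ → ℝ≥0∞} (hf : Measurable f) (hf1 : ∀ y, f y ≤ 1)
    (hpos : ∀ y, 0 < f y) : ∑' n, kernelIter (expKernel P) f n x = ∞ := by
  have h1 := tendsto_lintegral_green P isClosed_empty x hf
  rw [lintegral_green_empty_eq_top hP x hf hpos] at h1
  refine top_le_iff.1 (le_of_tendsto' h1 fun n => ?_)
  refine lintegral_green_le_tsum hP (γ := 1 - ((n : ℝ≥0) + 1)⁻¹) (by positivity) ?_ x hf hf1
  exact add_tsub_cancel_of_le (inv_le_one_of_one_le₀ le_add_self)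

lemma bind_expKernel_of_invariant {μ : Measure ℂ} [SigmaFinite μ] (hinv : InvariantFor P μ) :
    μ.bind (expKernel P) = μ := by
  ext s hs
  have hf : Measurable (s.indicator (1 : ℂ → ℝ≥0∞)) := measurable_one.indicator hs
  rw [Measure.bind_apply hs (measurable_expKernel hP).aemeasurable]
  have h1 : ∀ x, expKernel P x s =
      ∫⁻ t, disc 1 t * ∫⁻ X, s.indicator 1 (X t) ∂(P x : Measure PathSp) ∂halfLine := fun x => by
    rw [← lintegral_indicator_one hs, expKernel, lintegral_green P 1 isClosed_empty x hf]
    simp only [occ, alive_empty]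
    rw [← lintegral_lintegral_swap (μ := halfLine) (ν := (P x : Measure PathSp))
      (f := fun t X => disc 1 t * s.indicator 1 (X t))
      (((measurable_disc 1).comp measurable_fst).mul
        (hf.comp measurable_eval_uncurry)).aemeasurable]
    exact lintegral_congr fun t => lintegral_const_mul' _ _ (disc_ne_top _ _)
  simp only [h1]
  let κ : Kernel ℂ PathSp := ⟨fun x => (P x : Measure PathSp), measurable_law hP.cont⟩
  have hκ : IsMarkovKernel κ := ⟨fun x => by
    change IsProbabilityMeasure (P x : Measure PathSp)
    infer_instance⟩
  have hm0 : Measurable fun p : ℂ × ℝ≥0 => ∫⁻ X, s.indicator 1 (X p.2) ∂(P p.1 : Measure PathSp) :=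
    Measurable.lintegral_kernel_prod_right' (κ := κ.comap Prod.fst measurable_fst)
      (f := fun q : (ℂ × ℝ≥0) × PathSp => s.indicator 1 (q.2 q.1.2))
      (hf.comp (measurable_eval_uncurry.comp
        ((measurable_snd.comp measurable_fst).prodMk measurable_snd)))
  have hm : Measurable fun p : ℂ × ℝ≥0 =>
      disc 1 p.2 * ∫⁻ X, s.indicator 1 (X p.2) ∂(P p.1 : Measure PathSp) :=
    ((measurable_disc 1).comp measurable_snd).mul hm0
  rw [lintegral_lintegral_swap (f := fun x t => disc 1 t *
    ∫⁻ X, s.indicator 1 (X t) ∂(P x : Measure PathSp)) hm.aemeasurable]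
  have h2 : ∀ t : ℝ≥0,
      ∫⁻ x, ∫⁻ X, s.indicator 1 (X t) ∂(P x : Measure PathSp) ∂μ = μ s := fun t => by
    rw [← hinv t s hs]
    refine lintegral_congr fun x => ?_
    exact lintegral_indicator_one (measurable_eval t hs)
  simp_rw [lintegral_const_mul' _ _ (disc_ne_top _ _), h2]
  rw [lintegral_mul_const _ (measurable_disc 1), lintegral_disc 1 one_ne_zero]
  simp

lemma ae_volume_green_eq_zero {x : ℂ} {s : Set ℂ} (hs : MeasurableSet s)
    (h : expKernel P x s = 0) : ∀ᵐ y, expKernel P y s = 0 := by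
  have hf : Measurable (s.indicator (1 : ℂ → ℝ≥0∞)) := measurable_one.indicator hs
  rw [expKernel, green_empty_eq_zero_iff P 1 x hs] at h
  simp only [expKernel, green_empty_eq_zero_iff P 1 _ hs]
  have hm := measurable_lintegral_green hP 0 isClosed_empty hf
  have h1 : ∀ r, 0 ≤ r → ∫⁻ y, ∫⁻ w, s.indicator 1 w ∂green P 0 ∅ y ∂circ x r = 0 := fun r hr => by
    have := circGreen_split hP x 0 (isClosed_outside x r) isClosed_empty (Set.empty_subset _)
      (fun y => hP.ae_hits_outside y x r) hf
    rw [balayage_outside hP x le_rfl hr, lintegral_circGreen hP x 0 isClosed_empty hf, circ_zero,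
      lintegral_dirac' _ hm, lintegral_indicator_one hs, h] at this
    exact (add_eq_zero.1 this.symm).2
  have h2 : ∫⁻ y, ∫⁻ w, s.indicator 1 w ∂green P 0 ∅ y = 0 := by
    rw [lintegral_of_rotate (volume_rotate x) hm]
    simp [h1 _ dist_nonneg]
  rw [lintegral_eq_zero_iff hm] at h2
  filter_upwards [h2] with y hy
  rwa [← lintegral_indicator_one hs]

lemma eq_zero_or_eq_zero_of_mutuallySingular {ρ₁ ρ₂ : Measure ℂ}
    (h₁ : ρ₁.bind (expKernel P) = ρ₁) (h₂ : ρ₂.bind (expKernel P) = ρ₂) (h : ρ₁ ⟂ₘ ρ₂) :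
    ρ₁ = 0 ∨ ρ₂ = 0 := by
  obtain ⟨s, hs, hs1, hs2⟩ := h
  by_contra! hne
  have hK := measurable_expKernel hP
  have key : ∀ {ρ : Measure ℂ} {t : Set ℂ}, MeasurableSet t → ρ.bind (expKernel P) = ρ → ρ ≠ 0 →
      ρ t = 0 → ∃ x, expKernel P x t = 0 := fun {ρ t} ht hinv h0 hz => by
    rw [← hinv, Measure.bind_apply ht hK.aemeasurable,
      lintegral_eq_zero_iff (by exact (Measure.measurable_coe ht).comp hK)] at hz
    have : (ae ρ).NeBot := ae_neBot.2 h0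
    exact hz.exists
  obtain ⟨x, hx⟩ := key hs h₁ hne.1 hs1
  obtain ⟨y, hy⟩ := key hs.compl h₂ hne.2 hs2
  obtain ⟨w, hw1, hw2⟩ := ((ae_volume_green_eq_zero hP hs hx).and
    (ae_volume_green_eq_zero hP hs.compl hy)).exists
  have := isProbabilityMeasure_expKernel (P := P) w
  have h3 := measure_add_measure_compl (μ := expKernel P w) hs
  rw [hw1, hw2, measure_univ] at h3
  simp at h3

lemma exists_eq_smul_of_bind_expKernel {μ ν : Measure ℂ} [SigmaFinite μ] [SigmaFinite ν]
    (hμ : μ.bind (expKernel P) = μ) (hν : ν.bind (expKernel P) = ν) (hμ0 : μ ≠ 0) (hν0 : ν ≠ 0) :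
    ∃ b : ℝ≥0, b ≠ 0 ∧ μ = b • ν := by
  have hK := measurable_expKernel hP
  obtain ⟨g, hgpos, hg, hgfin⟩ := exists_pos_lintegral_lt_of_sigmaFinite (μ + ν) one_ne_zero
  set h : ℂ → ℝ≥0∞ := fun x => min (g x) 1
  have hh : Measurable h := (measurable_coe_nnreal_ennreal.comp hg).min measurable_const
  have hpos : ∀ x, 0 < h x := fun x => lt_min (by exact_mod_cast hgpos x) one_pos
  have hfin : ∫⁻ x, h x ∂(μ + ν) ≠ ∞ :=
    ((lintegral_mono fun x => min_le_left _ _).trans_lt (hgfin.trans ENNReal.one_lt_top)).ne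
  rw [lintegral_add_measure, ENNReal.add_ne_top] at hfin
  have hrec := fun x => tsum_kernelIter_expKernel hP x hh (fun y => min_le_right _ _) hpos
  refine exists_eq_smul_of_comparable hpos hh hfin.1 hfin.2 hμ0 hν0 fun a => ?_
  have ha : ∫⁻ x, h x ∂(a • ν) ≠ ∞ := by
    rw [lintegral_smul_measure, ENNReal.smul_def, smul_eq_mul]
    exact ENNReal.mul_ne_top ENNReal.coe_ne_top hfin.2
  have haK : (a • ν).bind (expKernel P) = a • ν := by
    ext s hs
    conv_rhs => rw [← hν]
    rw [Measure.bind_apply hs hK.aemeasurable, lintegral_smul_measure, Measure.smul_apply,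
      Measure.bind_apply hs hK.aemeasurable]
  obtain ⟨ρ₁, ρ₂, e1, e2, i1, i2, hs⟩ :=
    exists_invariant_excess hK hh hpos hrec hfin.1 ha hμ haK
  rcases eq_zero_or_eq_zero_of_mutuallySingular hP i1 i2 hs with h0 | h0
  · right
    rw [h0, add_zero] at e1
    rw [e1]
    exact inf_le_right
  · left
    rw [h0, add_zero] at e2
    rw [e2]
    exact inf_le_left

end

/-! ### The ratio of the speeds seen from a point -/

lemma lintegral_green_mono (P : ℂ → ProbabilityMeasure PathSp) (α : ℝ≥0) {F F' : Set ℂ}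
    (hF : IsClosed F) (hF' : IsClosed F') (h : F' ⊆ F) (x : ℂ) {f : ℂ → ℝ≥0∞}
    (hf : Measurable f) : ∫⁻ y, f y ∂green P α F x ≤ ∫⁻ y, f y ∂green P α F' x := by
  rw [lintegral_green P α hF x hf, lintegral_green P α hF' x hf]
  refine lintegral_mono fun X => lintegral_mono fun t => ?_
  gcongr
  by_cases ht : X ∈ hitBy F t
  · rw [alive_of_mem ht]; exact zero_le
  · rw [alive_of_notMem ht, alive_of_notMem fun h' => ht (hitBy_subset h t h')]

lemma lintegral_green_indicator (P : ℂ → ProbabilityMeasure PathSp) (α : ℝ≥0) {F : Set ℂ}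
    (hF : IsClosed F) (x : ℂ) {f : ℂ → ℝ≥0∞} (hf : Measurable f) :
    ∫⁻ y, Fᶜ.indicator f y ∂green P α F x = ∫⁻ y, f y ∂green P α F x := by
  have h0 := lintegral_green_eq_zero P α hF x (hf.indicator hF.measurableSet)
    fun y hy => Set.indicator_of_notMem hy f
  rw [← add_zero (∫⁻ y, Fᶜ.indicator f y ∂_), ← h0,
    ← lintegral_add_right _ (hf.indicator hF.measurableSet)]
  exact lintegral_congr fun y => Set.indicator_compl_add_self_apply F f y

section

variable {P : ℂ → ProbabilityMeasure PathSp} (hP : ContMTCBM P) {μ : Measure ℂ} [SigmaFinite μ]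
  (hμ : μ ≠ 0) (hinv : InvariantFor P μ)

include hP hμ hinv

lemma exists_cycle_eq_smul (z : ℂ) {r R : ℝ} (hr : 0 < r) (hrR : r < R) :
    ∃ b : ℝ≥0, b ≠ 0 ∧ cycle P z r R = b • μ := by
  have := sigmaFinite_cycle hP z hr R
  refine exists_eq_smul_of_bind_expKernel hP (cycle_bind_expKernel hP z hr hrR.le)
    (bind_expKernel_of_invariant hP hinv) (fun h => ?_) hμ
  have h1 := cycle_ne_zero hP z hr.le hrR measurable_const fun _ => one_pos
  rw [h] at h1
  simp at h1

lemma measure_closedBall_pos (z : ℂ) {r : ℝ} (hr : 0 < r) : 0 < μ (Metric.closedBall z r) := by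
  have hs : MeasurableSet (Metric.closedBall z r) := Metric.isClosed_closedBall.measurableSet
  have hK := measurable_expKernel hP
  rw [pos_iff_ne_zero]
  intro h0
  rw [← bind_expKernel_of_invariant hP hinv, Measure.bind_apply hs hK.aemeasurable,
    lintegral_eq_zero_iff (by exact (Measure.measurable_coe hs).comp hK)] at h0
  have : (ae μ).NeBot := ae_neBot.2 hμ
  obtain ⟨x, hx⟩ := h0.exists
  have h1 := ae_volume_green_eq_zero hP hs hx
  have h2 : ∀ᵐ y, y ∉ Metric.ball z r := by
    filter_upwards [h1] with y hy hyb
    have hF := isClosed_outside z r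
    have hyF : y ∉ outside z r := fun h =>
      not_lt (α := ℝ).2 (show r ≤ dist y z from h) (Metric.mem_ball.1 hyb)
    have h3 := lintegral_green_pos hP 1 hF hyF measurable_const fun _ => one_pos
    have hm : Measurable ((outside z r)ᶜ.indicator fun _ => (1 : ℝ≥0∞)) :=
      measurable_const.indicator hF.measurableSet.compl
    rw [← lintegral_green_indicator P 1 hF y measurable_const] at h3
    refine (h3.trans_le ?_).ne' hy
    rw [← lintegral_indicator_one hs]
    refine (lintegral_green_mono P 1 hF isClosed_empty (Set.empty_subset _) y hm).trans
      (lintegral_mono fun w => ?_)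
    refine Set.indicator_le_indicator_of_subset (fun w hw => ?_) (fun _ => zero_le) w
    exact (not_le (α := ℝ).1 hw).le
  exact (Metric.measure_ball_pos volume z hr).ne' (measure_eq_zero_iff_ae_notMem.2 h2)

lemma exists_test_set (z : ℂ) {r : ℝ} (hr : 0 < r) :
    ∃ A ⊆ Metric.closedBall z r, MeasurableSet A ∧ μ A ≠ 0 ∧ μ A ≠ ∞ := by
  obtain ⟨A, hA, hAs, hA1, hA2⟩ := Measure.exists_subset_measure_lt_top
    Metric.isClosed_closedBall.measurableSet (measure_closedBall_pos hP hμ hinv z hr)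
  exact ⟨A, hAs, hA, hA1.ne', hA2.ne⟩

omit [SigmaFinite μ] hμ hinv in
lemma circGreen_apply_of_subset (z : ℂ) {r R : ℝ} {b : ℝ≥0} (hb : cycle P z r R = b • μ)
    {A : Set ℂ} (hA : MeasurableSet A) (hAr : A ⊆ Metric.closedBall z r) :
    circGreen P z r (outside z R) A = b * μ A := by
  have h := cycle_apply hP z (r := r) (R := R) (measurable_one.indicator hA) fun y hy =>
    Set.indicator_of_notMem (fun h => hy (hAr h)) _
  rw [lintegral_indicator_one hA, lintegral_indicator_one hA, hb] at h
  rw [← h]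
  rfl

lemma cycle_const_relations (z : ℂ) {L : ℝ → ℝ → ℝ≥0}
    (hL : ∀ r R, 0 < r → r < R → cycle P z r R = L r R • μ) {r₁ r₂ r₃ : ℝ} (h1 : 0 < r₁)
    (h12 : r₁ < r₂) (h23 : r₂ < r₃) :
    (L r₂ r₃ : ℝ≥0∞) = exitProb P z r₁ r₂ r₃ * L r₁ r₃ ∧ L r₁ r₃ = L r₁ r₂ + L r₂ r₃ := by
  obtain ⟨A, hAs, hA, hA0, hAt⟩ := exists_test_set hP hμ hinv z h1
  have hf : Measurable (A.indicator (1 : ℂ → ℝ≥0∞)) := measurable_one.indicator hA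
  have e1 := circGreen_exitProb hP z h1.le h12 h23 hf fun y hy =>
    Set.indicator_of_notMem (fun h => hy (hAs h)) _
  have e2 := circGreen_outside_split hP z h1.le h12.le h23.le hf
  have hAs2 : A ⊆ Metric.closedBall z r₂ := hAs.trans (Metric.closedBall_subset_closedBall h12.le)
  have c13 := circGreen_apply_of_subset hP z (hL r₁ r₃ h1 (h12.trans h23)) hA hAs
  have c12 := circGreen_apply_of_subset hP z (hL r₁ r₂ h1 h12) hA hAs
  have c23 := circGreen_apply_of_subset hP z (hL r₂ r₃ (h1.trans h12) h23) hA hAs2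
  simp only [lintegral_indicator_one hA, c13, c12, c23] at e1 e2
  constructor
  · rw [← mul_assoc] at e1
    exact (ENNReal.mul_left_inj hA0 hAt).1 e1
  · rw [← add_mul] at e2
    exact_mod_cast (ENNReal.mul_left_inj hA0 hAt).1 e2

end

/-- Two processes with the same invariant measure have proportional cycle measures around every
point. -/
lemma exists_cycle_ratio {P Q : ℂ → ProbabilityMeasure PathSp} (hP : ContMTCBM P)
    (hQ : ContMTCBM Q) {μ : Measure ℂ} [SigmaFinite μ] (hμ : μ ≠ 0) (hinvP : InvariantFor P μ)
    (hinvQ : InvariantFor Q μ) (z : ℂ) :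
    ∃ q : ℝ≥0, q ≠ 0 ∧ ∀ r R, 0 < r → r < R → cycle P z r R = q • cycle Q z r R := by
  have hP' : ∀ r R, ∃ b : ℝ≥0, 0 < r → r < R → b ≠ 0 ∧ cycle P z r R = b • μ := fun r R => by
    by_cases h : 0 < r ∧ r < R
    · obtain ⟨b, hb⟩ := exists_cycle_eq_smul hP hμ hinvP z h.1 h.2
      exact ⟨b, fun _ _ => hb⟩
    · exact ⟨0, fun h1 h2 => absurd ⟨h1, h2⟩ h⟩
  have hQ' : ∀ r R, ∃ b : ℝ≥0, 0 < r → r < R → b ≠ 0 ∧ cycle Q z r R = b • μ := fun r R => by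
    by_cases h : 0 < r ∧ r < R
    · obtain ⟨b, hb⟩ := exists_cycle_eq_smul hQ hμ hinvQ z h.1 h.2
      exact ⟨b, fun _ _ => hb⟩
    · exact ⟨0, fun h1 h2 => absurd ⟨h1, h2⟩ h⟩
  choose L hL using hP'
  choose M hM using hQ'
  have key : ∀ r₁ r₂ r₃, 0 < r₁ → r₁ < r₂ → r₂ < r₃ →
      L r₁ r₃ / M r₁ r₃ = L r₂ r₃ / M r₂ r₃ ∧ L r₁ r₃ / M r₁ r₃ = L r₁ r₂ / M r₁ r₂ :=
    fun r₁ r₂ r₃ h1 h12 h23 => by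
    obtain ⟨p1, p2⟩ := cycle_const_relations hP hμ hinvP z
      (fun r R h h' => (hL r R h h').2) h1 h12 h23
    obtain ⟨q1, q2⟩ := cycle_const_relations hQ hμ hinvQ z
      (fun r R h h' => (hM r R h h').2) h1 h12 h23
    rw [← exitProb_congr hP hQ] at q1
    have l13 := (hM r₁ r₃ h1 (h12.trans h23)).1
    have l12 := (hM r₁ r₂ h1 h12).1
    have l23 := (hM r₂ r₃ (h1.trans h12) h23).1
    have e : L r₁ r₃ * M r₂ r₃ = L r₂ r₃ * M r₁ r₃ := by
      have : (L r₁ r₃ * M r₂ r₃ : ℝ≥0∞) = L r₂ r₃ * M r₁ r₃ := by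
        rw [p1, q1]; ring
      exact_mod_cast this
    refine ⟨(div_eq_div_iff l13 l23).2 e, (div_eq_div_iff l13 l12).2 ?_⟩
    have p2' := congrArg ((↑) : ℝ≥0 → ℝ) p2
    have q2' := congrArg ((↑) : ℝ≥0 → ℝ) q2
    have e' := congrArg ((↑) : ℝ≥0 → ℝ) e
    apply NNReal.coe_injective
    push_cast at p2' q2' e' ⊢
    rw [show (M r₁ r₂ : ℝ) = M r₁ r₃ - M r₂ r₃ by linarith,
      show (L r₁ r₂ : ℝ) = L r₁ r₃ - L r₂ r₃ by linarith]
    linarith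
  refine ⟨L 1 2 / M 1 2, div_ne_zero (hL 1 2 one_pos one_lt_two).1
    (hM 1 2 one_pos one_lt_two).1, fun r R hr hrR => ?_⟩
  have hall : L r R / M r R = L 1 2 / M 1 2 := by
    obtain ⟨a, ha0, ha⟩ := exists_between (lt_min hr one_pos)
    obtain ⟨b, hb⟩ := exists_gt (max R 2)
    have hb1 := (le_max_left _ _).trans_lt hb
    have hb2 := (le_max_right _ _).trans_lt hb
    have ha1 := ha.trans_le (min_le_left _ _)
    have ha2 := ha.trans_le (min_le_right _ _)
    rw [← (key a r R ha0 ha1 hrR).1, ← (key a R b ha0 (ha1.trans hrR) hb1).2,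
      ← (key a 1 2 ha0 ha2 one_lt_two).1, ← (key a 2 b ha0 (ha2.trans one_lt_two) hb2).2]
  rw [← hall, (hL r R hr hrR).2, (hM r R hr hrR).2, smul_smul,
    div_mul_cancel₀ _ (hM r R hr hrR).1]

/-! ### Green measures on circles as densities against the invariant measure -/

lemma measure_le_of_partition {E : Type*} [MeasurableSpace E] {ν ν' : Measure E} {D : ℕ → Set E}
    (hD : ∀ n, MeasurableSet (D n)) (hdisj : Pairwise (Function.onFun Disjoint D))
    (hU : ⋃ n, D n = Set.univ) {A : Set E} (hA : MeasurableSet A)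
    (h : ∀ n, ν (A ∩ D n) ≤ ν' (A ∩ D n)) : ν A ≤ ν' A := by
  have hA' : A = ⋃ n, A ∩ D n := by rw [← Set.inter_iUnion, hU, Set.inter_univ]
  have hd : Pairwise (Function.onFun Disjoint fun n => A ∩ D n) := fun i j hij =>
    (hdisj hij).mono Set.inter_subset_right Set.inter_subset_right
  rw [hA', measure_iUnion hd fun n => hA.inter (hD n), measure_iUnion hd fun n => hA.inter (hD n)]
  exact ENNReal.tsum_le_tsum h

lemma measure_le_of_finite {E : Type*} [MeasurableSpace E] {ν ν' : Measure E} (μ : Measure E)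
    [SigmaFinite μ] (h : ∀ A, MeasurableSet A → μ A ≠ ∞ → ν A ≤ ν' A) : ν ≤ ν' := by
  refine Measure.le_iff.2 fun A hA => measure_le_of_partition
    (D := disjointed (spanningSets μ)) (fun n => .disjointed (measurableSet_spanningSets μ) n)
    (disjoint_disjointed _) (by rw [iUnion_disjointed, iUnion_spanningSets]) hA fun n => ?_
  refine h _ (hA.inter (.disjointed (measurableSet_spanningSets μ) n))
    (ne_top_of_le_ne_top (measure_spanningSets_lt_top μ n).ne (measure_mono ?_))
  exact Set.inter_subset_right.trans (disjointed_subset _ _)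

lemma withDensity_add_const {E : Type*} [MeasurableSpace E] (μ : Measure E) (g : E → ℝ≥0)
    (ε : ℝ≥0) {A : Set E} (hA : MeasurableSet A) :
    μ.withDensity (fun x => (g x : ℝ≥0∞) + ε) A = μ.withDensity (fun x => (g x : ℝ≥0∞)) A +
      ε * μ A := by
  rw [withDensity_apply _ hA, withDensity_apply _ hA, lintegral_add_right _ measurable_const,
    setLIntegral_const]

lemma level_partition {E : Type*} [MeasurableSpace E] {g : E → ℝ≥0} (hg : Measurable g)
    {ν ν' : Measure E} {ε : ℝ≥0} (hε : 0 < ε) {A : Set E} (hA : MeasurableSet A)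
    (h : ∀ (k : ℕ) (B : Set E), MeasurableSet B →
      (∀ w ∈ B, k * ε ≤ g w ∧ g w ≤ k * ε + ε) → ν B ≤ ν' B) : ν A ≤ ν' A := by
  have hm : Measurable fun w => ⌊g w / ε⌋₊ := Nat.measurable_floor.comp (hg.div_const ε)
  refine measure_le_of_partition (D := fun k => (fun w => ⌊g w / ε⌋₊) ⁻¹' {k})
    (fun k => hm (measurableSet_singleton k))
    (fun i j hij => Set.disjoint_left.2 fun w h1 h2 => hij (h1.symm.trans h2))
    (by ext w; simp) hA fun k => h k _ (hA.inter (hm (measurableSet_singleton k))) ?_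
  rintro w ⟨-, hw⟩
  have hw' : ⌊g w / ε⌋₊ = k := hw
  have h1 := Nat.floor_le (zero_le : (0 : ℝ≥0) ≤ g w / ε)
  have h2 := Nat.lt_floor_add_one (g w / ε)
  rw [hw'] at h1 h2
  refine ⟨(le_div_iff₀ hε).1 h1, ?_⟩
  have := (div_lt_iff₀ hε).1 h2
  rw [add_mul, one_mul] at this
  exact this.le

/-- A measure which is compared to `μ` by the level sets of `g` has density `g`. -/
lemma eq_withDensity_of_levels {E : Type*} [MeasurableSpace E] {μ ν : Measure E} [SigmaFinite μ]
    {g : E → ℝ≥0} (hg : Measurable g)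
    (hup : ∀ (C : ℝ≥0) (A : Set E), MeasurableSet A → (∀ w ∈ A, g w ≤ C) → ν A ≤ C * μ A)
    (hlo : ∀ (C : ℝ≥0) (A : Set E), MeasurableSet A → (∀ w ∈ A, C ≤ g w) → C * μ A ≤ ν A) :
    ν = μ.withDensity fun x => (g x : ℝ≥0∞) := by
  refine le_antisymm (measure_le_of_finite μ fun A hA hAt => ?_)
    (measure_le_of_finite μ fun A hA hAt => ?_)
  · have key : ∀ ε : ℝ≥0, 0 < ε → ν A ≤ μ.withDensity (fun x => (g x : ℝ≥0∞)) A + ε * μ A :=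
      fun ε hε => by
      rw [← withDensity_add_const μ g ε hA]
      refine level_partition hg hε hA fun k B hB hk => ?_
      refine (hup _ B hB fun w hw => (hk w hw).2).trans ?_
      rw [withDensity_add_const μ g ε hB, ENNReal.coe_add, add_mul, withDensity_apply _ hB,
        ← setLIntegral_const]
      exact add_le_add_left (setLIntegral_mono (by fun_prop) fun w hw =>
        ENNReal.coe_le_coe.2 (hk w hw).1) _
    have hlim : Tendsto (fun ε : ℝ≥0 => μ.withDensity (fun x => (g x : ℝ≥0∞)) A + ε * μ A)
        (𝓝[>] 0) (𝓝 (μ.withDensity (fun x => (g x : ℝ≥0∞)) A + (0 : ℝ≥0) * μ A)) :=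
      (tendsto_const_nhds.add (ENNReal.Tendsto.mul_const (ENNReal.tendsto_coe.2
        tendsto_id) (Or.inr hAt))).mono_left nhdsWithin_le_nhds
    have := ge_of_tendsto hlim (by filter_upwards [self_mem_nhdsWithin] with ε hε using key ε hε)
    simpa using this
  · have key : ∀ ε : ℝ≥0, 0 < ε → μ.withDensity (fun x => (g x : ℝ≥0∞)) A ≤ ν A + ε * μ A :=
      fun ε hε => by
      have := level_partition (ν' := ν + ε • μ) (ν := μ.withDensity fun x => (g x : ℝ≥0∞))
        hg hε hA fun k B hB hk => ?_
      · exact this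
      have h1 := hlo _ B hB fun w hw => (hk w hw).1
      calc _ ≤ ∫⁻ _ in B, (((k * ε + ε : ℝ≥0)) : ℝ≥0∞) ∂μ := by
            rw [withDensity_apply _ hB]
            exact setLIntegral_mono (by fun_prop) fun w hw => ENNReal.coe_le_coe.2 (hk w hw).2
        _ = ((k * ε : ℝ≥0) : ℝ≥0∞) * μ B + ε * μ B := by
            rw [setLIntegral_const, ENNReal.coe_add, add_mul]
        _ ≤ ν B + ε * μ B := by gcongr
    have hlim : Tendsto (fun ε : ℝ≥0 => ν A + ε * μ A)
        (𝓝[>] 0) (𝓝 (ν A + (0 : ℝ≥0) * μ A)) :=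
      (tendsto_const_nhds.add (ENNReal.Tendsto.mul_const (ENNReal.tendsto_coe.2
        tendsto_id) (Or.inr hAt))).mono_left nhdsWithin_le_nhds
    have := ge_of_tendsto hlim (by filter_upwards [self_mem_nhdsWithin] with ε hε using key ε hε)
    simpa using this

lemma exists_seq_le {T : Set ℝ} (h : T.Nonempty) (hb : BddBelow T) :
    ∃ u : ℕ → ℝ, Antitone u ∧ (∀ n, u n ∈ T) ∧ ∀ t ∈ T, ∃ n, u n ≤ t := by
  by_cases hm : sInf T ∈ T
  · exact ⟨fun _ => sInf T, antitone_const, fun _ => hm, fun t ht => ⟨0, csInf_le hb ht⟩⟩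
  · obtain ⟨u, hu, hlim, huT⟩ := exists_seq_tendsto_sInf h hb
    refine ⟨u, hu, huT, fun t ht => ?_⟩
    have : sInf T < t := (csInf_le hb ht).lt_of_ne fun h => hm (h ▸ ht)
    exact ((hlim.eventually_lt_const this).exists).imp fun n => le_of_lt

lemma exists_seq_ge {T : Set ℝ} (h : T.Nonempty) (hb : BddAbove T) :
    ∃ u : ℕ → ℝ, Monotone u ∧ (∀ n, u n ∈ T) ∧ ∀ t ∈ T, ∃ n, t ≤ u n := by
  by_cases hm : sSup T ∈ T
  · exact ⟨fun _ => sSup T, monotone_const, fun _ => hm, fun t ht => ⟨0, le_csSup hb ht⟩⟩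
  · obtain ⟨u, hu, hlim, huT⟩ := exists_seq_tendsto_sSup h hb
    refine ⟨u, hu, huT, fun t ht => ?_⟩
    have : t < sSup T := (le_csSup hb ht).lt_of_ne fun h => hm (h ▸ ht)
    exact ((hlim.eventually_const_lt this).exists).imp fun n => le_of_lt

section

variable {P : ℂ → ProbabilityMeasure PathSp} (hP : ContMTCBM P)

include hP

lemma circGreen_outside_eq_zero (z : ℂ) (r : ℝ) {R : ℝ} {A : Set ℂ} (hA : MeasurableSet A)
    (h : A ⊆ outside z R) : circGreen P z r (outside z R) A = 0 := by
  rw [← lintegral_indicator_one hA]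
  exact lintegral_circGreen_eq_zero hP z r (isClosed_outside z R) (measurable_one.indicator hA)
    fun y hy => Set.indicator_of_notMem (fun h' => hy (h h')) _

lemma circGreen_outside_split_apply (z : ℂ) {r s R : ℝ} (hr : 0 ≤ r) (hs : r ≤ s) (hR : s ≤ R)
    {A : Set ℂ} (hA : MeasurableSet A) :
    circGreen P z r (outside z R) A = circGreen P z r (outside z s) A +
      circGreen P z s (outside z R) A := by
  have := circGreen_outside_split hP z hr hs hR (measurable_one.indicator hA)
  simpa only [lintegral_indicator_one hA] using this

lemma circGreen_eq_withDensity {μ : Measure ℂ} [SigmaFinite μ] (hμ : μ ≠ 0)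
    (hinv : InvariantFor P μ) (z : ℂ) {r R : ℝ} (hr : 0 < r) (hrR : r < R) {L : ℝ → ℝ≥0}
    (hL : ∀ s, r ≤ s → s < R → cycle P z s R = L s • μ) :
    circGreen P z r (outside z R) = μ.withDensity fun w =>
      ((if R ≤ dist w z then 0 else L (max (dist w z) r) : ℝ≥0) : ℝ≥0∞) := by
  have hanti : ∀ s t, r ≤ s → s ≤ t → t < R → L t ≤ L s := fun s t hs hst ht => by
    obtain ⟨A, hAs, hA, hA0, hAt⟩ := exists_test_set hP hμ hinv z hr
    have h1 := circGreen_apply_of_subset hP z (hL s hs (hst.trans_lt ht)) hA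
      (hAs.trans (Metric.closedBall_subset_closedBall hs))
    have h2 := circGreen_apply_of_subset hP z (hL t (hs.trans hst) ht) hA
      (hAs.trans (Metric.closedBall_subset_closedBall (hs.trans hst)))
    have h3 := circGreen_outside_split_apply hP z (hr.le.trans hs) hst ht.le hA
    rw [h1, h2] at h3
    have h4 : (L t : ℝ≥0∞) * μ A ≤ L s * μ A := by rw [h3]; exact le_add_self
    exact_mod_cast (ENNReal.mul_le_mul_iff_left hA0 hAt).1 h4
  have hg0 : Antitone fun t : ℝ => if R ≤ t then 0 else L (max t r) := by
    intro s t hst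
    dsimp only
    split_ifs with h1 h2 h2
    · exact le_rfl
    · exact zero_le
    · exact absurd (h2.trans hst) h1
    · exact hanti _ _ (le_max_right _ _) (max_le_max_right r hst) (max_lt (not_le.1 h1) hrR)
  have hdist : Measurable fun w : ℂ => dist w z := by fun_prop
  have hρ : Measurable fun w : ℂ => max (dist w z) r := by fun_prop
  refine eq_withDensity_of_levels
    (g := fun w => if R ≤ dist w z then 0 else L (max (dist w z) r))
    (hg0.measurable.comp hdist) (fun C A hA h => ?_) fun C A hA h => ?_
  · rcases A.eq_empty_or_nonempty with rfl | hne
    · simp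
    obtain ⟨u, hu, huT, huA⟩ := exists_seq_le (hne.image fun w => max (dist w z) r)
      ⟨r, by rintro _ ⟨w, -, rfl⟩; exact le_max_right _ _⟩
    have hAu : A = ⋃ n, A ∩ {w | u n ≤ max (dist w z) r} := by
      rw [← Set.inter_iUnion, Set.inter_eq_left.2]
      intro w hw
      exact Set.mem_iUnion.2 (huA _ ⟨w, hw, rfl⟩)
    have hmono : Monotone fun n => A ∩ {w | u n ≤ max (dist w z) r} := fun m n hmn =>
      Set.inter_subset_inter_right _ fun w hw => (hu hmn).trans hw
    conv_lhs => rw [hAu]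
    rw [hmono.measure_iUnion]
    refine iSup_le fun n => ?_
    obtain ⟨w, hwA, hw⟩ := huT n
    have hB : MeasurableSet (A ∩ {w | u n ≤ max (dist w z) r}) :=
      hA.inter (measurableSet_le measurable_const hρ)
    have hrs : r ≤ u n := hw ▸ le_max_right _ _
    have hsub : r < u n → A ∩ {w | u n ≤ max (dist w z) r} ⊆ outside z (u n) := fun hlt y hy =>
      (le_max_iff.1 hy.2).resolve_right (not_le.2 hlt)
    rcases lt_or_ge (u n) R with hsR | hsR
    · rw [circGreen_outside_split_apply hP z hr.le hrs hsR.le hB]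
      have h0 : circGreen P z r (outside z (u n)) (A ∩ {w | u n ≤ max (dist w z) r}) = 0 := by
        rcases hrs.lt_or_eq with hlt | heq
        · exact circGreen_outside_eq_zero hP z r hB (hsub hlt)
        · rw [← heq, ← lintegral_indicator_one (heq ▸ hB)]
          exact lintegral_circGreen_outside_self hP z hr.le
            (measurable_one.indicator (heq ▸ hB))
      rw [h0, zero_add]
      calc _ ≤ cycle P z (u n) R (A ∩ {w | u n ≤ max (dist w z) r}) :=
            Measure.le_add_right le_rfl _
        _ = L (u n) * μ (A ∩ {w | u n ≤ max (dist w z) r}) := by rw [hL _ hrs hsR]; rfl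
        _ ≤ C * μ A := by
            gcongr
            · have := h w hwA
              rw [if_neg (not_le.2 ((le_max_left _ _).trans_lt (hw.trans_lt hsR)))] at this
              rw [← hw]
              exact_mod_cast this
            · exact Set.inter_subset_left
    · rw [circGreen_outside_eq_zero hP z r hB ((hsub (hrR.trans_le hsR)).trans
        fun y hy => hsR.trans hy)]
      exact zero_le
  · rcases eq_zero_or_pos C with rfl | hC
    · simp
    rcases A.eq_empty_or_nonempty with rfl | hne
    · simp
    have hlt : ∀ w ∈ A, dist w z < R := fun w hw => not_le.1 fun h' => by
      have := h w hw
      rw [if_pos h'] at this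
      exact absurd this (not_le.2 hC)
    obtain ⟨u, hu, huT, huA⟩ := exists_seq_ge (hne.image fun w => max (dist w z) r)
      ⟨R, by rintro _ ⟨w, hw, rfl⟩; exact max_le (hlt w hw).le hrR.le⟩
    have hAu : A = ⋃ n, A ∩ {w | max (dist w z) r ≤ u n} := by
      rw [← Set.inter_iUnion, Set.inter_eq_left.2]
      intro w hw
      exact Set.mem_iUnion.2 (huA _ ⟨w, hw, rfl⟩)
    have hmono : Monotone fun n => A ∩ {w | max (dist w z) r ≤ u n} := fun m n hmn =>
      Set.inter_subset_inter_right _ fun w hw => hw.out.trans (hu hmn)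
    conv_lhs => rw [hAu]
    rw [hmono.measure_iUnion, ENNReal.mul_iSup]
    refine iSup_le fun n => ?_
    obtain ⟨w, hwA, hw⟩ := huT n
    have hB : MeasurableSet (A ∩ {w | max (dist w z) r ≤ u n}) :=
      hA.inter (measurableSet_le hρ measurable_const)
    have hrs : r ≤ u n := hw ▸ le_max_right _ _
    have hsR : u n < R := by rw [← hw]; exact max_lt (hlt w hwA) hrR
    calc _ ≤ (L (u n) : ℝ≥0∞) * μ (A ∩ {w | max (dist w z) r ≤ u n}) := by
          gcongr
          have := h w hwA
          rw [if_neg (not_le.2 (hlt w hwA))] at this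
          rw [← hw]
          exact this
      _ = circGreen P z (u n) (outside z R) (A ∩ {w | max (dist w z) r ≤ u n}) :=
          (circGreen_apply_of_subset hP z (hL _ hrs hsR) hB fun y hy =>
            Metric.mem_closedBall.2 ((le_max_left _ _).trans hy.2)).symm
      _ ≤ circGreen P z r (outside z R) (A ∩ {w | max (dist w z) r ≤ u n}) := by
          rw [circGreen_outside_split_apply hP z hr.le hrs hsR.le hB]
          exact le_add_self
      _ ≤ _ := measure_mono Set.inter_subset_left

end

lemma exists_circGreen_ratio {P Q : ℂ → ProbabilityMeasure PathSp} (hP : ContMTCBM P)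
    (hQ : ContMTCBM Q) {μ : Measure ℂ} [SigmaFinite μ] (hμ : μ ≠ 0) (hinvP : InvariantFor P μ)
    (hinvQ : InvariantFor Q μ) (z : ℂ) :
    ∃ q : ℝ≥0, q ≠ 0 ∧ ∀ r R, 0 < r → r < R →
      circGreen P z r (outside z R) = q • circGreen Q z r (outside z R) := by
  obtain ⟨q, hq0, hq⟩ := exists_cycle_ratio hP hQ hμ hinvP hinvQ z
  refine ⟨q, hq0, fun r R hr hrR => ?_⟩
  have h : ∀ s, ∃ b : ℝ≥0, r ≤ s → s < R → cycle Q z s R = b • μ := fun s => by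
    by_cases h : r ≤ s ∧ s < R
    · obtain ⟨b, -, hb⟩ := exists_cycle_eq_smul hQ hμ hinvQ z (hr.trans_le h.1) h.2
      exact ⟨b, fun _ _ => hb⟩
    · exact ⟨0, fun h1 h2 => absurd ⟨h1, h2⟩ h⟩
  choose L hL using h
  rw [circGreen_eq_withDensity hQ hμ hinvQ z hr hrR hL,
    circGreen_eq_withDensity hP hμ hinvP z hr hrR (L := fun s => q * L s) fun s h1 h2 => by
      rw [hq s R (hr.trans_le h1) h2, hL s h1 h2, smul_smul],
    ENNReal.smul_def, ← withDensity_smul' _ _ ENNReal.coe_ne_top]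
  congr 1
  ext w
  simp only [Pi.smul_apply, smul_eq_mul]
  rw [← ENNReal.coe_mul, mul_ite, mul_zero]

/-! ### Mean exit times -/

/-- The paths that stay in the set `K` up to time `t`. -/
def stays (K : Set ℂ) (t : ℝ≥0) : Set PathSp := {X | ∀ u ≤ t, X u ∈ K}

lemma isClosed_stays {K : Set ℂ} (hK : IsClosed K) (t : ℝ≥0) : IsClosed (stays K t) := by
  have : stays K t = ⋂ u ∈ Set.Iic t, (fun X : PathSp => X u) ⁻¹' K := by
    ext X; simp [stays]
  rw [this]
  exact isClosed_biInter fun u _ => hK.preimage (continuous_eval_const u)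

lemma stays_antitone (K : Set ℂ) : Antitone (stays K) := fun _ _ hst _ hX u hu =>
  hX u (hu.trans hst)

lemma compl_hitBy_outside_subset (z : ℂ) (R : ℝ) (t : ℝ≥0) :
    (hitBy (outside z R) t)ᶜ ⊆ stays (Metric.closedBall z R) t := fun _ hX u hu =>
  Metric.mem_closedBall.2 (not_le.1 fun h => hX ⟨u, hu, h⟩).le

lemma planarGaussian_singleton {v : ℝ≥0} (hv : v ≠ 0) : planarGaussian v {0} = 0 := by
  have := nullSingletonClass_gaussianReal (μ := 0) hv
  rw [planarGaussian, Measure.map_apply measurable_equivRealProd_symm (measurableSet_singleton 0)]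
  have : (fun p => Complex.equivRealProd.symm p) ⁻¹' {0} = ({0} ×ˢ {0} : Set (ℝ × ℝ)) := by
    ext ⟨a, b⟩
    simp [Complex.ext_iff]
  rw [this, Measure.prod_prod]
  simp

lemma lintegral_halfLine_le_add {g : ℝ≥0 → ℝ≥0∞} (hg : Measurable g) (a : ℝ≥0)
    (h : ∀ t, g t ≤ 1) : ∫⁻ t, g t ∂halfLine ≤ a + ∫⁻ s, g (a + s) ∂halfLine := by
  rw [lintegral_halfLine_split hg a]
  gcongr
  calc _ ≤ ∫⁻ _ in Set.Iio a, 1 ∂halfLine := lintegral_mono fun t => h t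
    _ = a := by
      rw [setLIntegral_one, ← Set.Ico_bot, bot_eq_zero, halfLine_Ico]
      simp

section

variable {P : ℂ → ProbabilityMeasure PathSp} (hP : ContMTCBM P)

include hP

lemma measure_stays_singleton (z : ℂ) {t : ℝ≥0} (ht : 0 < t) :
    (P z : Measure PathSp) (stays {z} t) = 0 := by
  obtain ⟨Ω, mΩ, μ, B, τ, Y, hμ, hB, hτ, hY, hYB, hPz⟩ := hP.timeChange z
  rw [← hPz, Measure.map_apply hY (isClosed_stays isClosed_singleton t).measurableSet]
  have h1 : ∀ᵐ ω ∂μ, ∀ n : ℕ, B ((n : ℝ≥0) + 1)⁻¹ ω ≠ z := ae_all_iff.2 fun n => by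
    have hm : Measurable fun ω => B ((n : ℝ≥0) + 1)⁻¹ ω - B 0 ω := (hB.meas _).sub (hB.meas 0)
    have h := hB.incr 0 ((n : ℝ≥0) + 1)⁻¹ zero_le
    have h2 : ∀ᵐ w ∂planarGaussian (((n : ℝ≥0) + 1)⁻¹ - 0), w ≠ 0 := by
      rw [ae_iff]
      simpa using planarGaussian_singleton (v := ((n : ℝ≥0) + 1)⁻¹) (by positivity)
    rw [← h] at h2
    filter_upwards [ae_of_ae_map hm.aemeasurable h2, hB.start] with ω hω h0 hz
    exact hω (by rw [hz, h0, sub_self])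
  refine measure_eq_zero_iff_ae_notMem.2 ?_
  filter_upwards [h1, hτ, hYB] with ω hω hτω hYω hst
  have hpos : 0 < τ t ω := by rw [← hτω.1]; exact hτω.2.1 ht
  obtain ⟨n, hn⟩ : ∃ n : ℕ, ((n : ℝ≥0) + 1)⁻¹ < τ t ω := by
    obtain ⟨n, hn⟩ := exists_nat_one_div_lt (NNReal.coe_pos.2 hpos)
    rw [one_div] at hn
    exact ⟨n, by exact_mod_cast hn⟩
  obtain ⟨u, hu, hτu⟩ := intermediate_value_Icc ht.le hτω.2.2.1.continuousOn
    (show ((n : ℝ≥0) + 1)⁻¹ ∈ Set.Icc (τ 0 ω) (τ t ω) from ⟨by rw [hτω.1]; exact zero_le, hn.le⟩)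
  refine hω n ?_
  rw [← hτu, ← hYω u]
  exact hst u hu.2

lemma exists_measure_stays_lt (z : ℂ) (R : ℝ) (x : ℂ) :
    ∃ n : ℕ, (P x : Measure PathSp) (stays (Metric.closedBall z R) n) < 2⁻¹ := by
  have hm : Antitone fun n : ℕ => stays (Metric.closedBall z R) n := fun m n h =>
    stays_antitone _ (by exact_mod_cast h)
  have h0 : (P x : Measure PathSp) (⋂ n : ℕ, stays (Metric.closedBall z R) n) = 0 := by
    refine measure_mono_null ?_ (hP.ae_hits_outside x z (R + 1))
    intro X hX hX'
    obtain ⟨u, hu⟩ := hX'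
    obtain ⟨n, hn⟩ := exists_nat_ge u
    have h1 := Metric.mem_closedBall.1 (Set.mem_iInter.1 hX n u hn)
    have h2 : R + 1 ≤ dist (X u) z := hu
    linarith
  have hlim := tendsto_measure_iInter_atTop (μ := (P x : Measure PathSp))
    (fun n : ℕ => (isClosed_stays Metric.isClosed_closedBall _).nullMeasurableSet) hm
    ⟨0, measure_ne_top _ _⟩
  rw [h0] at hlim
  exact (hlim.eventually_lt_const (by simp)).exists

lemma exists_forall_measure_stays_le (z : ℂ) (R : ℝ) :
    ∃ n : ℕ, ∀ x, (P x : Measure PathSp) (stays (Metric.closedBall z R) n) ≤ 2⁻¹ := by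
  have hnhds : ∀ x ∈ Metric.closedBall z R, ∃ n : ℕ, ∀ᶠ y in 𝓝 x,
      (P y : Measure PathSp) (stays (Metric.closedBall z R) n) < 2⁻¹ := fun x _ => by
    obtain ⟨n, hn⟩ := exists_measure_stays_lt hP z R x
    refine ⟨n, ?_⟩
    have := ProbabilityMeasure.limsup_measure_closed_le_of_tendsto (hP.cont.tendsto x)
      (isClosed_stays (Metric.isClosed_closedBall (x := z) (ε := R)) n)
    exact eventually_lt_of_limsup_lt (this.trans_lt hn)
  choose! N hN using hnhds
  obtain ⟨T, hT, hcov⟩ := (isCompact_closedBall z R).elim_nhds_subcover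
    (fun x => {y | (P y : Measure PathSp) (stays (Metric.closedBall z R) (N x)) < 2⁻¹}) hN
  refine ⟨T.sup N, fun x => ?_⟩
  by_cases hx : x ∈ Metric.closedBall z R
  · obtain ⟨y, hy, hxy⟩ := Set.mem_iUnion₂.1 (hcov hx)
    refine (measure_mono (stays_antitone _ ?_)).trans hxy.out.le
    exact_mod_cast Finset.le_sup hy
  · have : (P x : Measure PathSp) (stays (Metric.closedBall z R) (T.sup N : ℕ)) = 0 := by
      refine measure_mono_null ?_ (hP.ae_start x)
      intro X hX hX'
      exact hx (hX' ▸ hX 0 zero_le)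
    rw [this]
    exact zero_le

/-- The mean exit time of a disc is bounded uniformly in the starting point. -/
lemma exists_lintegral_green_outside_le (z : ℂ) (R : ℝ) :
    ∃ C : ℝ≥0, ∀ x, ∫⁻ _, 1 ∂green P 0 (outside z R) x ≤ C := by
  obtain ⟨N, hN⟩ := exists_forall_measure_stays_le hP z R
  have hF := isClosed_outside z R
  have h1 : Measurable fun _ : ℂ => (1 : ℝ≥0∞) := measurable_const
  have key : ∀ α : ℝ≥0, α ≠ 0 → ∀ x, ∫⁻ _, 1 ∂green P α (outside z R) x ≤ 2 * N := by
    intro α hα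
    set a := ⨆ x, ∫⁻ _, 1 ∂green P α (outside z R) x with ha
    have hat : a ≠ ∞ := by
      refine ne_top_of_le_ne_top (ENNReal.inv_ne_top.2 (ENNReal.coe_ne_zero.2 hα))
        (iSup_le fun x => ?_)
      exact (lintegral_green_mono P α hF isClosed_empty (Set.empty_subset _) x h1).trans_eq
        (lintegral_green_empty_one P hα x)
    have hal : ∀ X t, alive (outside z R) (fun _ => 1) X t ≤ 1 := fun X t => by
      by_cases ht : X ∈ hitBy (outside z R) t
      · rw [alive_of_mem ht]; exact zero_le
      · rw [alive_of_notMem ht]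
    have hocc : ∀ X, occ α (outside z R) (fun _ => 1) X ≤ N +
        (hitBy (outside z R) N)ᶜ.indicator
          (fun X => occ α (outside z R) (fun _ => 1) (pathShift N X)) X := fun X => by
      have hm : Measurable fun t => disc α t * alive (outside z R) (fun _ => 1) X t :=
        (measurable_disc α).mul (measurable_alive hF h1 X)
      refine (lintegral_halfLine_le_add hm N fun t =>
        mul_le_one' (disc_le_one α t) (hal X t)).trans ?_
      gcongr
      · simp
      by_cases hX : X ∈ hitBy (outside z R) N
      · have : ∀ s, alive (outside z R) (fun _ => 1) X (N + s) = 0 := fun s =>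
          alive_of_mem (hitBy_mono _ le_self_add hX)
        simp [this]
      · rw [Set.indicator_of_mem (s := (hitBy (outside z R) N)ᶜ) hX,
          occ_shift α (fun u hu h => hX ⟨u, hu.le, h⟩)]
        refine lintegral_mono fun s => ?_
        gcongr
        rw [disc_add_right]
        exact mul_le_of_le_one_left' (disc_le_one α _)
    have hstep : ∀ x, ∫⁻ _, 1 ∂green P α (outside z R) x ≤ N + a * 2⁻¹ := fun x => by
      have hA : MeasurableSet[pastAlg (N : ℝ≥0)] (hitBy (outside z R) N)ᶜ :=
        (measurableSet_pastAlg_hitBy hF _).compl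
      have hA' := pastAlg_le _ _ hA
      have ho := measurable_occ α hF h1
      rw [lintegral_green P α hF x h1]
      refine (lintegral_mono hocc).trans ?_
      rw [lintegral_add_left measurable_const, lintegral_const, measure_univ, mul_one,
        lintegral_indicator hA', markov_lintegral hP.cont hP.markov x _ hA ho]
      gcongr
      calc _ ≤ ∫⁻ _ in (hitBy (outside z R) N)ᶜ, a ∂(P x : Measure PathSp) := by
            refine lintegral_mono fun X => ?_
            rw [← lintegral_green P α hF _ h1]
            exact le_iSup (fun x => ∫⁻ _, 1 ∂green P α (outside z R) x) _
        _ = a * (P x : Measure PathSp) (hitBy (outside z R) N)ᶜ := setLIntegral_const _ _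
        _ ≤ a * 2⁻¹ := by
            gcongr
            exact (measure_mono (compl_hitBy_outside_subset z R _)).trans (hN x)
    have h2 : a ≤ N + a * 2⁻¹ := iSup_le hstep
    have h3 : a ≤ 2 * N := by
      clear_value a
      lift a to ℝ≥0 using hat
      have h4 : (a : ℝ) ≤ N + a * 2⁻¹ := by
        have : a ≤ N + a * 2⁻¹ := by
          rw [← ENNReal.coe_le_coe]
          push_cast
          exact h2
        exact_mod_cast this
      have h5 : (a : ℝ) ≤ 2 * N := by linarith
      have h6 : a ≤ 2 * N := by exact_mod_cast h5
      exact_mod_cast h6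
    exact fun x => (le_iSup (fun x => ∫⁻ _, 1 ∂green P α (outside z R) x) x).trans h3
  refine ⟨2 * N, fun x => ?_⟩
  push_cast
  exact le_of_tendsto' (tendsto_lintegral_green P hF x h1) fun n => key _ (by positivity) x

end

/-! ### The ratio of two processes at a point -/

lemma occ_le_of_mem {F : Set ℂ} (hF : IsClosed F) {X : PathSp} {u : ℝ≥0} (h : X u ∈ F) :
    occ 0 F (fun _ => 1) X ≤ u := by
  have h1 : Measurable fun _ : ℂ => (1 : ℝ≥0∞) := measurable_const
  have hm : Measurable fun t => disc 0 t * alive F (fun _ => 1) X t :=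
    (measurable_disc 0).mul (measurable_alive hF h1 X)
  refine (lintegral_halfLine_le_add hm u fun t => ?_).trans_eq ?_
  · rw [disc_zero_left, one_mul]
    by_cases ht : X ∈ hitBy F t
    · rw [alive_of_mem ht]; exact zero_le
    · rw [alive_of_notMem ht]
  · have : ∀ s, alive F (fun _ => 1) X (u + s) = 0 := fun s =>
      alive_of_mem ⟨u, le_self_add, h⟩
    simp [this]

section

variable {P : ℂ → ProbabilityMeasure PathSp} (hP : ContMTCBM P)

include hP

lemma tendsto_mean_exit (z : ℂ) :
    Tendsto (fun m : ℕ => ∫⁻ _, 1 ∂green P 0 (outside z ((m : ℝ) + 1)⁻¹) z) atTop (𝓝 0) := by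
  have h1 : Measurable fun _ : ℂ => (1 : ℝ≥0∞) := measurable_const
  have hF := fun m : ℕ => isClosed_outside z ((m : ℝ) + 1)⁻¹
  obtain ⟨C, hC⟩ := exists_lintegral_green_outside_le hP z 1
  have hz : ∀ᵐ X ∂(P z : Measure PathSp), ∀ n : ℕ, X ∉ stays {z} ((n : ℝ≥0) + 1)⁻¹ :=
    ae_all_iff.2 fun n => measure_eq_zero_iff_ae_notMem.1
      (measure_stays_singleton hP z (by positivity))
  have hlim := tendsto_lintegral_of_dominated_convergence (μ := (P z : Measure PathSp))
    (F := fun m : ℕ => occ 0 (outside z ((m : ℝ) + 1)⁻¹) fun _ => 1) (f := fun _ => 0)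
    (occ 0 (outside z 1) fun _ => 1) (fun m => measurable_occ 0 (hF m) h1)
    (fun m => Eventually.of_forall fun X => ?_) ?_ ?_
  · rw [lintegral_zero] at hlim
    exact hlim.congr fun m => (lintegral_green P 0 (hF m) z h1).symm
  · refine lintegral_mono fun t => ?_
    gcongr
    have hsub : outside z 1 ⊆ outside z ((m : ℝ) + 1)⁻¹ := fun w hw =>
      le_trans (inv_le_one_of_one_le₀ (by simp)) hw.out
    by_cases ht : X ∈ hitBy (outside z ((m : ℝ) + 1)⁻¹) t
    · rw [alive_of_mem ht]; exact zero_le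
    · rw [alive_of_notMem ht, alive_of_notMem fun h => ht (hitBy_subset hsub t h)]
  · rw [← lintegral_green P 0 (isClosed_outside z 1) z h1]
    exact ne_top_of_le_ne_top ENNReal.coe_ne_top (hC z)
  · filter_upwards [hz] with X hX
    refine ENNReal.tendsto_nhds_zero.2 fun ε hε => ?_
    obtain ⟨n, hn⟩ : ∃ n : ℕ, (((n : ℝ≥0) + 1)⁻¹ : ℝ≥0) < ε := by
      obtain ⟨n, hn⟩ := ENNReal.exists_inv_nat_lt hε.ne'
      rcases Nat.eq_zero_or_pos n with rfl | hn0
      · simp at hn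
      obtain ⟨k, rfl⟩ := Nat.exists_eq_succ_of_ne_zero hn0.ne'
      refine ⟨k, ?_⟩
      rw [ENNReal.coe_inv (by positivity)]
      simpa using hn
    have hX' := hX n
    simp only [stays, Set.mem_ofPred_eq, not_forall] at hX'
    obtain ⟨u, hu, hXu⟩ := hX'
    have hd : 0 < dist (X u) z := dist_pos.2 hXu
    obtain ⟨k, hk⟩ := exists_nat_one_div_lt hd
    filter_upwards [eventually_ge_atTop k] with m hm
    refine (occ_le_of_mem (hF m) (u := u) ?_).trans ((ENNReal.coe_le_coe.2 hu).trans hn.le)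
    refine le_trans ?_ hk.le
    rw [one_div]
    gcongr

end

lemma green_le_of_circGreen_le {P Q : ℂ → ProbabilityMeasure PathSp} (hP : ContMTCBM P)
    (hQ : ContMTCBM Q) {z : ℂ} {R : ℝ} {q : ℝ≥0} (hR : 0 < R)
    (h : ∀ r, 0 < r → r < R →
      circGreen P z r (outside z R) ≤ q • circGreen Q z r (outside z R)) :
    green P 0 (outside z R) z ≤ q • green Q 0 (outside z R) z := by
  refine Measure.le_iff.2 fun A hA => ?_
  have e : ∀ {P' : ℂ → ProbabilityMeasure PathSp} (_ : ContMTCBM P') (s : ℝ), 0 < s → s < R →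
      green P' 0 (outside z R) z A = green P' 0 (outside z s) z A +
        circGreen P' z s (outside z R) A := fun {P'} hP' s h0 hs => by
    have := circGreen_outside_split_apply hP' z le_rfl h0.le hs.le hA
    simp only [circGreen, circ_zero] at this
    rwa [Measure.dirac_bind (measurable_green hP'.cont 0 (isClosed_outside z R)),
      Measure.dirac_bind (measurable_green hP'.cont 0 (isClosed_outside z s))] at this
  have hlim : Tendsto (fun m : ℕ => ∫⁻ _, 1 ∂green P 0 (outside z ((m : ℝ) + 1)⁻¹) z +
      (q • green Q 0 (outside z R) z) A) atTop (𝓝 (0 + (q • green Q 0 (outside z R) z) A)) :=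
    (tendsto_mean_exit hP z).add tendsto_const_nhds
  rw [zero_add] at hlim
  refine ge_of_tendsto hlim ?_
  obtain ⟨k, hk⟩ := exists_nat_one_div_lt hR
  filter_upwards [eventually_ge_atTop k] with m hm
  have h0 : (0 : ℝ) < ((m : ℝ) + 1)⁻¹ := by positivity
  have hs : ((m : ℝ) + 1)⁻¹ < R := by
    refine lt_of_le_of_lt ?_ hk
    rw [one_div]
    gcongr
  rw [e hP _ h0 hs]
  refine add_le_add ?_ ((h _ h0 hs A).trans ?_)
  · rw [lintegral_one]
    exact measure_mono (Set.subset_univ A)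
  · rw [Measure.smul_apply, Measure.smul_apply, e hQ _ h0 hs]
    rw [ENNReal.smul_def, ENNReal.smul_def, smul_eq_mul, smul_eq_mul]
    gcongr
    exact le_add_self

lemma exists_green_ratio {P Q : ℂ → ProbabilityMeasure PathSp} (hP : ContMTCBM P)
    (hQ : ContMTCBM Q) {μ : Measure ℂ} [SigmaFinite μ] (hμ : μ ≠ 0) (hinvP : InvariantFor P μ)
    (hinvQ : InvariantFor Q μ) (z : ℂ) :
    ∃ q : ℝ≥0, q ≠ 0 ∧
      (∀ R, 0 < R → green P 0 (outside z R) z = q • green Q 0 (outside z R) z) ∧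
      ∀ r R, 0 < r → r < R →
        circGreen P z r (outside z R) = q • circGreen Q z r (outside z R) := by
  obtain ⟨q, hq0, hq⟩ := exists_circGreen_ratio hP hQ hμ hinvP hinvQ z
  refine ⟨q, hq0, fun R hR => le_antisymm
    (green_le_of_circGreen_le hP hQ hR fun r h0 h1 => (hq r R h0 h1).le) ?_, hq⟩
  have := green_le_of_circGreen_le hQ hP hR (q := q⁻¹) fun r h0 h1 => by
    rw [hq r R h0 h1, smul_smul, inv_mul_cancel₀ hq0, one_smul]
  calc q • green Q 0 (outside z R) z ≤ q • q⁻¹ • green P 0 (outside z R) z := fun A => by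
        have h := this A
        rw [Measure.smul_apply, Measure.smul_apply, ENNReal.smul_def, ENNReal.smul_def,
          smul_eq_mul, smul_eq_mul]
        gcongr
    _ = _ := by rw [smul_smul, mul_inv_cancel₀ hq0, one_smul]

/-! ### Continuity properties of mean exit times -/

lemma tendsto_lintegral_green_of_antitone (P : ℂ → ProbabilityMeasure PathSp) (α : ℝ≥0)
    {F : ℕ → Set ℂ} {F' : Set ℂ} (hF : ∀ n, IsClosed (F n)) (hF' : IsClosed F')
    (hanti : Antitone F) (hsub : ∀ n, F' ⊆ F n)
    (h : ∀ (X : PathSp) t, X ∉ hitBy F' t → ∃ n, X ∉ hitBy (F n) t) (x : ℂ)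
    {f : ℂ → ℝ≥0∞} (hf : Measurable f) :
    Tendsto (fun n => ∫⁻ y, f y ∂green P α (F n) x) atTop (𝓝 (∫⁻ y, f y ∂green P α F' x)) := by
  simp only [lintegral_green P _ (hF _) x hf, lintegral_green P _ hF' x hf]
  have hal : ∀ X t, Monotone fun n => alive (F n) f X t := fun X t m n hmn => by
    by_cases hX : X ∈ hitBy (F m) t
    · simp only [alive_of_mem hX]; exact zero_le
    · simp only [alive_of_notMem hX,
        alive_of_notMem fun h' => hX (hitBy_subset (hanti hmn) t h')]
      exact le_rfl
  have hmono : ∀ X, Monotone fun n => occ α (F n) f X := fun X m n hmn =>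
    lintegral_mono fun t => by
      have := hal X t hmn
      dsimp only at this ⊢
      gcongr
  refine lintegral_tendsto_of_tendsto_of_monotone
    (fun n => (measurable_occ _ (hF n) hf).aemeasurable) (.of_forall hmono)
    (.of_forall fun X => ?_)
  refine lintegral_tendsto_of_tendsto_of_monotone
    (fun n => ((measurable_disc _).mul (measurable_alive (hF n) hf X)).aemeasurable)
    (.of_forall fun t m n hmn => ?_) (.of_forall fun t => ?_)
  · have := hal X t hmn
    dsimp only at this ⊢
    gcongr
  · refine tendsto_const_nhds.congr' ?_
    by_cases hX : X ∈ hitBy F' t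
    · refine .of_forall fun n => ?_
      dsimp only
      rw [alive_of_mem hX, alive_of_mem (hitBy_subset (hsub n) t hX)]
    · obtain ⟨n, hn⟩ := h X t hX
      filter_upwards [eventually_ge_atTop n] with m hm
      rw [alive_of_notMem hX, alive_of_notMem fun h' => hn (hitBy_subset (hanti hm) t h')]

lemma exists_lt_of_notMem_hitBy_outside {z : ℂ} {R : ℝ} {X : PathSp} {t : ℝ≥0}
    (h : X ∉ hitBy (outside z R) t) : ∃ s < R, ∀ u ≤ t, dist (X u) z ≤ s := by
  obtain ⟨u, hu, hmax⟩ := (isCompact_Icc (a := (0 : ℝ≥0)) (b := t)).exists_isMaxOn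
    ⟨0, le_rfl, zero_le⟩ (f := fun u => dist (X u) z) (by fun_prop)
  exact ⟨dist (X u) z, not_le.1 fun h' => h ⟨u, hu.2, h'⟩, fun v hv => hmax ⟨zero_le, hv⟩⟩

lemma outside_antitone (z : ℂ) : Antitone (outside z) := fun _ _ h _ hw => h.trans hw.out

lemma tendsto_lintegral_green_outside (P : ℂ → ProbabilityMeasure PathSp) (α : ℝ≥0) (z : ℂ)
    {s : ℕ → ℝ} {R : ℝ} (hs : Monotone s) (hsR : ∀ n, s n ≤ R) (hlim : Tendsto s atTop (𝓝 R))
    (x : ℂ) {f : ℂ → ℝ≥0∞} (hf : Measurable f) :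
    Tendsto (fun n => ∫⁻ y, f y ∂green P α (outside z (s n)) x) atTop
      (𝓝 (∫⁻ y, f y ∂green P α (outside z R) x)) := by
  refine tendsto_lintegral_green_of_antitone P α (fun n => isClosed_outside z _)
    (isClosed_outside z R) (fun m n h => outside_antitone z (hs h))
    (fun n => outside_antitone z (hsR n)) (fun X t hX => ?_) x hf
  obtain ⟨a, ha, haX⟩ := exists_lt_of_notMem_hitBy_outside hX
  obtain ⟨n, hn⟩ := (hlim.eventually_const_lt ha).exists
  exact ⟨n, fun ⟨u, hu, hXu⟩ => (hn.trans_le (hXu.out.trans (haX u hu))).false⟩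

lemma tendsto_lintegral_green_outside_atTop (P : ℂ → ProbabilityMeasure PathSp) (α : ℝ≥0) (z : ℂ)
    (x : ℂ) {f : ℂ → ℝ≥0∞} (hf : Measurable f) :
    Tendsto (fun n : ℕ => ∫⁻ y, f y ∂green P α (outside z n) x) atTop
      (𝓝 (∫⁻ y, f y ∂green P α ∅ x)) := by
  refine tendsto_lintegral_green_of_antitone P α (fun n => isClosed_outside z _)
    isClosed_empty (fun m n h => outside_antitone z (by exact_mod_cast h))
    (fun n => Set.empty_subset _) (fun X t hX => ?_) x hf
  obtain ⟨u, hu, hmax⟩ := (isCompact_Icc (a := (0 : ℝ≥0)) (b := t)).exists_isMaxOn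
    ⟨0, le_rfl, zero_le⟩ (f := fun u => dist (X u) z) (by fun_prop)
  obtain ⟨n, hn⟩ := exists_nat_gt (dist (X u) z)
  exact ⟨n, fun ⟨v, hv, hXv⟩ => (hn.trans_le (hXv.out.trans (hmax ⟨zero_le, hv⟩))).false⟩

lemma lintegral_green_one (P : ℂ → ProbabilityMeasure PathSp) (α : ℝ≥0) {F : Set ℂ}
    (hF : IsClosed F) (x : ℂ) :
    ∫⁻ _, 1 ∂green P α F x =
      ∫⁻ t, disc α t * (P x : Measure PathSp) (hitBy F t)ᶜ ∂halfLine := by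
  have h1 : Measurable fun _ : ℂ => (1 : ℝ≥0∞) := measurable_const
  have hm2 : Measurable fun p : ℝ≥0 × PathSp => disc α p.1 * alive F (fun _ => 1) p.2 p.1 :=
    ((measurable_disc α).comp measurable_fst).mul (measurable_alive_uncurry hF h1)
  rw [lintegral_green P α hF x h1]
  simp only [occ]
  rw [← lintegral_lintegral_swap (μ := halfLine) (ν := (P x : Measure PathSp))
    (f := fun t X => disc α t * alive F (fun _ => 1) X t) hm2.aemeasurable]
  refine lintegral_congr fun t => ?_
  rw [lintegral_const_mul _ (by exact (measurable_alive_uncurry hF h1).comp measurable_prodMk_left),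
    ← lintegral_indicator_one (isClosed_hitBy hF t).measurableSet.compl]
  rfl

lemma measurable_measure_compl_hitBy (P : ℂ → ProbabilityMeasure PathSp) (F : Set ℂ) (x : ℂ) :
    Measurable fun t => (P x : Measure PathSp) (hitBy F t)ᶜ :=
  Antitone.measurable fun _ _ h => measure_mono (Set.compl_subset_compl.2 (hitBy_mono F h))

lemma measurable_measure_stays (P : ℂ → ProbabilityMeasure PathSp) (K : Set ℂ) (x : ℂ) :
    Measurable fun t => (P x : Measure PathSp) (stays K t) :=
  Antitone.measurable fun _ _ h => measure_mono (stays_antitone K h)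

section

variable {P : ℂ → ProbabilityMeasure PathSp} (hP : ContMTCBM P)

include hP

omit hP in
lemma outside_subset_outside {z w : ℂ} {R R' : ℝ} (h : dist z w ≤ R' - R) :
    outside w R' ⊆ outside z R := fun y hy => by
  have := dist_triangle y z w
  have h2 : R' ≤ dist y w := hy
  change R ≤ dist y z
  linarith

lemma mean_exit_le_liminf {z : ℂ} {R R' : ℝ} (hR : R < R') {zs : ℕ → ℂ}
    (hzs : Tendsto zs atTop (𝓝 z)) :
    ∫⁻ _, 1 ∂green P 0 (outside z R) z ≤
      liminf (fun n => ∫⁻ _, 1 ∂green P 0 (outside (zs n) R') (zs n)) atTop := by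
  simp only [lintegral_green_one P 0 (isClosed_outside _ _), disc_zero_left, one_mul]
  refine le_trans (lintegral_mono fun t => ?_)
    (lintegral_liminf_le fun n => measurable_measure_compl_hitBy P _ _)
  refine (ProbabilityMeasure.le_liminf_measure_open_of_tendsto ((hP.cont.tendsto z).comp hzs)
    (isClosed_hitBy (isClosed_outside z R) t).isOpen_compl).trans (liminf_le_liminf ?_)
  have : ∀ᶠ n in atTop, dist (zs n) z < R' - R :=
    hzs (Metric.ball_mem_nhds z (sub_pos.2 hR))
  filter_upwards [this] with n hn
  rw [dist_comm] at hn
  exact measure_mono (Set.compl_subset_compl.2 (hitBy_subset (outside_subset_outside hn.le) t))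

lemma limsup_mean_exit_le {z : ℂ} {R R' : ℝ} (hR : R < R') {zs : ℕ → ℂ}
    (hzs : Tendsto zs atTop (𝓝 z)) :
    limsup (fun n => ∫⁻ _, 1 ∂green P 0 (outside (zs n) R) (zs n)) atTop ≤
      ∫⁻ _, 1 ∂green P 0 (outside z R') z := by
  obtain ⟨C, hC⟩ := exists_lintegral_green_outside_le hP z R'
  set R₁ := (R + R') / 2 with hR₁
  have hRR : R < R₁ := by linarith
  have hRR' : R₁ < R' := by linarith
  have key : ∀ γ : ℝ≥0, γ ≠ 0 →
      limsup (fun n => ∫⁻ _, 1 ∂green P 0 (outside (zs n) R) (zs n)) atTop ≤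
        ∫⁻ _, 1 ∂green P 0 (outside z R') z + γ * (C * C) := fun γ hγ => by
    have hdist : ∀ᶠ n in atTop, dist (zs n) z < R₁ - R :=
      hzs (Metric.ball_mem_nhds z (sub_pos.2 hRR))
    have h1 : ∀ᶠ n in atTop, ∫⁻ _, 1 ∂green P 0 (outside (zs n) R) (zs n) ≤
        (∫⁻ t, disc γ t * (P (zs n) : Measure PathSp) (stays (Metric.closedBall z R₁) t) ∂halfLine)
          + γ * (C * C) := by
      filter_upwards [hdist] with n hn
      refine (lintegral_green_mono P 0 (isClosed_outside (zs n) R) (isClosed_outside z R₁)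
        (outside_subset_outside hn.le) _ measurable_const).trans ?_
      rw [green_resolvent hP 0 γ (isClosed_outside z R₁) _ measurable_const, zero_add]
      refine add_le_add ?_ (mul_le_mul_right ?_ _)
      · rw [lintegral_green_one P γ (isClosed_outside _ _)]
        refine lintegral_mono fun t => mul_le_mul_right ?_ _
        exact measure_mono (compl_hitBy_outside_subset z R₁ t)
      · have hCC : ∀ α y, ∫⁻ _, 1 ∂green P α (outside z R₁) y ≤ C := fun α y => by
          refine le_trans ?_ (hC y)
          refine le_trans ?_ (lintegral_green_mono P 0 (isClosed_outside z R₁)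
            (isClosed_outside z R') (outside_antitone z hRR'.le) y measurable_const)
          rw [lintegral_green_one P α (isClosed_outside _ _),
            lintegral_green_one P 0 (isClosed_outside _ _)]
          refine lintegral_mono fun t => mul_le_mul_left ?_ _
          exact disc_antitone_left t zero_le
        calc _ ≤ ∫⁻ _, C ∂green P 0 (outside z R₁) (zs n) := lintegral_mono fun y => hCC γ y
          _ = C * ∫⁻ _, 1 ∂green P 0 (outside z R₁) (zs n) := by simp
          _ ≤ C * C := by gcongr; exact hCC 0 _
    have h2 : limsup (fun n => ∫⁻ t, disc γ t *
          (P (zs n) : Measure PathSp) (stays (Metric.closedBall z R₁) t) ∂halfLine) atTop ≤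
        ∫⁻ _, 1 ∂green P 0 (outside z R') z := by
      refine (limsup_lintegral_le (disc γ) (fun n => (measurable_disc γ).mul
        (measurable_measure_stays P _ _)) (fun n => .of_forall fun t =>
          mul_le_of_le_one_right' prob_le_one) ?_).trans ?_
      · rw [lintegral_disc γ hγ]
        simpa using hγ
      · rw [lintegral_green_one P 0 (isClosed_outside _ _)]
        refine lintegral_mono fun t => ?_
        rw [disc_zero_left, one_mul]
        refine le_trans ?_ ((ProbabilityMeasure.limsup_measure_closed_le_of_tendsto
          ((hP.cont.tendsto z).comp hzs) (isClosed_stays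
            (Metric.isClosed_closedBall (x := z) (ε := R₁)) t)).trans (measure_mono ?_))
        · exact limsup_le_limsup (.of_forall fun n => mul_le_of_le_one_left' (disc_le_one γ t))
        · rintro X hX ⟨u, hu, hXu⟩
          exact (hRR'.trans_le (hXu.out.trans (hX u hu))).false
    refine (limsup_le_limsup h1).trans ?_
    rw [limsup_add_const _ _ _ (by isBoundedDefault)
      (by isBoundedDefault)]
    exact add_le_add_left h2 _
  have hlim : Tendsto (fun n : ℕ => ∫⁻ _, 1 ∂green P 0 (outside z R') z +
      (((n : ℝ≥0) + 1)⁻¹ : ℝ≥0) * ((C : ℝ≥0∞) * C)) atTop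
      (𝓝 (∫⁻ _, 1 ∂green P 0 (outside z R') z + (0 : ℝ≥0) * ((C : ℝ≥0∞) * C))) := by
    refine tendsto_const_nhds.add (ENNReal.Tendsto.mul_const (ENNReal.tendsto_coe.2 ?_)
      (.inr (ENNReal.mul_ne_top ENNReal.coe_ne_top ENNReal.coe_ne_top)))
    have := tendsto_one_div_add_atTop_nhds_zero_nat (𝕜 := ℝ≥0)
    simpa using this
  rw [ENNReal.coe_zero, zero_mul, add_zero] at hlim
  exact ge_of_tendsto' hlim fun n => key _ (by positivity)

end

/-! ### Semicontinuity of the ratio of mean exit times -/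

lemma lintegral_nnreal_smul {α : Type*} [MeasurableSpace α] (c : ℝ≥0) (μ : Measure α)
    (f : α → ℝ≥0∞) : ∫⁻ x, f x ∂(c • μ) = c * ∫⁻ x, f x ∂μ := by
  rw [lintegral_smul_measure, ENNReal.smul_def, smul_eq_mul]

lemma lintegral_green_outside_mono (P : ℂ → ProbabilityMeasure PathSp) (z x : ℂ) {f : ℂ → ℝ≥0∞}
    (hf : Measurable f) : Monotone fun R => ∫⁻ y, f y ∂green P 0 (outside z R) x := fun _ _ h =>
  lintegral_green_mono P 0 (isClosed_outside z _) (isClosed_outside z _) (outside_antitone z h) x hf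

section

variable {P Q : ℂ → ProbabilityMeasure PathSp} (hP : ContMTCBM P) (hQ : ContMTCBM Q)

include hQ in
lemma exists_radii (z : ℂ) {p a : ℝ≥0} (ha : p < a) :
    ∃ R R' R'' : ℝ, 0 < R ∧ R < R' ∧ R' < R'' ∧
      p * ∫⁻ _, 1 ∂green Q 0 (outside z R'') z < a * ∫⁻ _, 1 ∂green Q 0 (outside z R) z := by
  set h : ℝ → ℝ≥0∞ := fun R => ∫⁻ _, 1 ∂green Q 0 (outside z R) z with hh
  have hfin : ∀ R, h R ≠ ∞ := fun R => by
    obtain ⟨C, hC⟩ := exists_lintegral_green_outside_le hQ z R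
    exact ne_top_of_le_ne_top ENNReal.coe_ne_top (hC z)
  have hmono : Monotone h := lintegral_green_outside_mono Q z z measurable_const
  have hmono' : Monotone fun R => (h R).toReal := fun R S hRS =>
    ENNReal.toReal_mono (hfin S) (hmono hRS)
  obtain ⟨R₀, hR₀, hR₀'⟩ := (hmono'.countable_not_continuousAt.dense_compl ℝ).exists_mem_open
    (isOpen_Ioi (a := (0 : ℝ))) ⟨1, Set.mem_Ioi.2 one_pos⟩
  have hc : ContinuousAt (fun R => (h R).toReal) R₀ := by
    by_contra hcon
    exact hR₀ hcon
  have hpos : 0 < (h R₀).toReal := ENNReal.toReal_pos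
    (lintegral_green_pos hQ 0 (isClosed_outside z R₀) (by
      intro h'; have h2 : R₀ ≤ dist z z := h'; rw [dist_self] at h2; exact h2.not_gt hR₀')
      measurable_const fun _ => one_pos).ne' (hfin _)
  have h1 : Tendsto (fun e : ℝ => a * (h (R₀ - e)).toReal - p * (h (R₀ + e)).toReal) (𝓝 0)
      (𝓝 (a * (h R₀).toReal - p * (h R₀).toReal)) := by
    have e1 : Tendsto (fun e : ℝ => R₀ - e) (𝓝 0) (𝓝 R₀) := by
      have : Continuous fun e : ℝ => R₀ - e := by fun_prop
      simpa using this.tendsto 0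
    have e2 : Tendsto (fun e : ℝ => R₀ + e) (𝓝 0) (𝓝 R₀) := by
      have : Continuous fun e : ℝ => R₀ + e := by fun_prop
      simpa using this.tendsto 0
    exact ((hc.tendsto.comp e1).const_mul _).sub ((hc.tendsto.comp e2).const_mul _)
  have h2 : 0 < a * (h R₀).toReal - p * (h R₀).toReal := by
    rw [← sub_mul]
    exact mul_pos (sub_pos.2 (by exact_mod_cast ha)) hpos
  have h3 : ∀ᶠ e : ℝ in 𝓝[>] 0, 0 < a * (h (R₀ - e)).toReal - p * (h (R₀ + e)).toReal :=
    (h1.eventually_const_lt h2).filter_mono nhdsWithin_le_nhds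
  have h4 : ∀ᶠ e : ℝ in 𝓝[>] 0, e < R₀ :=
    (eventually_lt_nhds hR₀').filter_mono nhdsWithin_le_nhds
  obtain ⟨e, he, he', he0⟩ := (h3.and (h4.and self_mem_nhdsWithin)).exists
  have he0 : 0 < e := he0
  refine ⟨R₀ - e, R₀, R₀ + e, by linarith, by linarith, by linarith, ?_⟩
  rw [← ENNReal.toReal_lt_toReal (ENNReal.mul_ne_top ENNReal.coe_ne_top (hfin _))
    (ENNReal.mul_ne_top ENNReal.coe_ne_top (hfin _)), ENNReal.toReal_mul, ENNReal.toReal_mul]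
  simpa using sub_pos.1 he

include hP hQ in
lemma eventually_ratio_lt {q : ℂ → ℝ≥0}
    (hq : ∀ z R, 0 < R → green P 0 (outside z R) z = q z • green Q 0 (outside z R) z)
    {z : ℂ} {a : ℝ≥0} (ha : q z < a) : ∀ᶠ w in 𝓝 z, q w < a := by
  by_contra hcon
  obtain ⟨zs, hzs, hzq⟩ := exists_seq_forall_of_frequently (not_eventually.1 hcon)
  obtain ⟨R, R', R'', h0, h1, h2, h3⟩ := exists_radii hQ z ha
  have hh : ∀ w S, 0 < S → ∫⁻ _, 1 ∂green P 0 (outside w S) w =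
      q w * ∫⁻ _, 1 ∂green Q 0 (outside w S) w := fun w S hS => by
    rw [hq w S hS, lintegral_nnreal_smul]
  refine h3.not_ge ?_
  rw [← hh z R'' (by linarith)]
  refine le_trans ?_ (limsup_mean_exit_le hP h2 hzs)
  calc _ ≤ a * liminf (fun n => ∫⁻ _, 1 ∂green Q 0 (outside (zs n) R') (zs n)) atTop := by
        gcongr
        exact mean_exit_le_liminf hQ h1 hzs
    _ ≤ liminf (fun n => a * ∫⁻ _, 1 ∂green Q 0 (outside (zs n) R') (zs n)) atTop :=
        (ENNReal.liminf_const_mul_of_ne_top ENNReal.coe_ne_top).ge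
    _ ≤ liminf (fun n => ∫⁻ _, 1 ∂green P 0 (outside (zs n) R') (zs n)) atTop := by
        refine liminf_le_liminf (.of_forall fun n => ?_)
        rw [hh (zs n) R' (by linarith)]
        have := not_lt.1 (hzq n)
        gcongr
    _ ≤ _ := liminf_le_limsup

end

/-! ### A maximum principle for functions with the sub-mean value property -/

lemma measurable_integrable_circ {w : ℂ → ℝ} (hw : Measurable w) {M : ℝ} (hM : ∀ z, |w z| ≤ M)
    (z : ℂ) (r : ℝ) : Integrable w (circ z r) :=
  .of_bound hw.aestronglyMeasurable M (.of_forall hM)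

lemma integrable_dist_sq_circ (x z : ℂ) {r : ℝ} (hr : 0 ≤ r) :
    Integrable (fun y => dist y x ^ 2) (circ z r) := by
  refine .of_bound (by fun_prop) ((r + dist z x) ^ 2) ?_
  filter_upwards [ae_circ z hr] with y hy
  rw [Real.norm_of_nonneg (by positivity)]
  have := dist_triangle y z x
  rw [hy] at this
  gcongr

lemma integral_dist_sq_circ (x z : ℂ) {r : ℝ} (hr : 0 ≤ r) :
    ∫ y, dist y x ^ 2 ∂circ z r = dist z x ^ 2 + r ^ 2 := by
  have hrot : ∀ y, rotAbout z Real.pi y = z - (y - z) := fun y => by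
    simp [rotAbout, Complex.exp_pi_mul_I, sub_eq_add_neg]
  have hi := integrable_dist_sq_circ x z hr
  have h1 : ∫ y, dist y x ^ 2 ∂circ z r = ∫ y, dist (z - (y - z)) x ^ 2 ∂circ z r := by
    conv_lhs => rw [← circ_rotate z r Real.pi]
    rw [integral_map (measurable_rotAbout z _).aemeasurable (by fun_prop)]
    simp only [hrot]
  have hi' : Integrable (fun y => dist (z - (y - z)) x ^ 2) (circ z r) := by
    have := (circ_rotate z r Real.pi).symm ▸ hi
    rw [integrable_map_measure (by fun_prop) (measurable_rotAbout z _).aemeasurable] at this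
    simpa only [Function.comp_def, hrot] using this
  have h2 : ∫ y, (dist y x ^ 2 + dist (z - (y - z)) x ^ 2) ∂circ z r =
      ∫ _, (2 * (dist z x ^ 2 + r ^ 2)) ∂circ z r := by
    refine integral_congr_ae ?_
    filter_upwards [ae_circ z hr] with y hy
    rw [← hy]
    simp only [Complex.dist_eq, ← Complex.normSq_eq_norm_sq, Complex.normSq_apply, Complex.sub_re,
      Complex.sub_im]
    ring
  rw [integral_add hi hi', ← h1] at h2
  simp at h2
  linarith

/-- A bounded function on a disc with the sub-mean value property on small circles around each
point, and with non-positive upper limits at the boundary, is non-positive. -/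
lemma nonpos_of_le_circ {x₀ : ℂ} {R ε M : ℝ} (hR : 0 < R) (hε : 0 < ε) {w : ℂ → ℝ}
    (hw : Measurable w) (hM : ∀ z, |w z| ≤ M)
    (hb : ∀ δ > 0, ∃ η > 0, ∀ z, R - η < dist z x₀ → w z ≤ δ)
    (hs : ∀ z, dist z x₀ < R → w z ≤ ∫ y, w y ∂circ z (min ε (R - dist z x₀))) {z : ℂ}
    (hz : dist z x₀ < R) : w z ≤ 0 := by
  by_contra hcon
  push Not at hcon
  set m := w z with hm
  set c := m / (4 * R ^ 2) with hc
  have hc0 : 0 < c := by positivity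
  have hcR : c * R ^ 2 = m / 4 := by rw [hc]; field_simp
  set φ : ℂ → ℝ := fun y => w y + c * dist y x₀ ^ 2 with hφ
  set K := φ '' Metric.closedBall x₀ R
  have hgR : ∀ y ∈ Metric.closedBall x₀ R, c * dist y x₀ ^ 2 ≤ m / 4 := fun y hy => by
    rw [← hcR]
    have := Metric.mem_closedBall.1 hy
    gcongr
  have hKb : BddAbove K := ⟨M + m / 4, by
    rintro _ ⟨y, hy, rfl⟩
    exact add_le_add ((le_abs_self _).trans (hM y)) (hgR y hy)⟩
  have hφz : φ z ∈ K := ⟨z, hz.le, rfl⟩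
  have hmS : m ≤ sSup K := le_trans (by simp only [hφ, ← hm]; nlinarith [sq_nonneg (dist z x₀)])
    (le_csSup hKb hφz)
  obtain ⟨η, hη, hηw⟩ := hb (m / 2) (by positivity)
  have hρ0 : 0 < min ε η := lt_min hε hη
  obtain ⟨_, ⟨y, hy, rfl⟩, hyS⟩ := exists_lt_of_lt_csSup (s := K)
    (b := max (sSup K - c * min ε η ^ 2) (3 * m / 4)) ⟨_, hφz⟩
    (max_lt (by have : 0 < c * min ε η ^ 2 := by positivity
                linarith) (by linarith))
  have hy1 := (le_max_left _ _).trans_lt hyS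
  have hy2 := (le_max_right _ _).trans_lt hyS
  have hyR : dist y x₀ ≤ R - η := by
    by_contra h
    have h1 := hηw y (not_le.1 h)
    have h2 := hgR y hy
    simp only [hφ] at hy2
    linarith
  set ρ := min ε (R - dist y x₀) with hρ
  have hρρ : min ε η ≤ ρ := min_le_min le_rfl (by linarith)
  have hρR : ρ ≤ R - dist y x₀ := min_le_right _ _
  have hi : Integrable φ (circ y ρ) := (measurable_integrable_circ hw hM y ρ).add
    ((integrable_dist_sq_circ x₀ y (hρ0.le.trans hρρ)).const_mul c)
  have h1 : ∫ v, φ v ∂circ y ρ ≤ ∫ _, sSup K ∂circ y ρ := by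
    refine integral_mono_ae hi (integrable_const _) ?_
    filter_upwards [ae_circ y (hρ0.le.trans hρρ)] with v hv
    refine le_csSup hKb ⟨v, ?_, rfl⟩
    have := dist_triangle v y x₀
    rw [Metric.mem_closedBall]
    linarith
  have h2 : ∫ v, φ v ∂circ y ρ = ∫ v, w v ∂circ y ρ + c * (dist y x₀ ^ 2 + ρ ^ 2) := by
    rw [integral_add (measurable_integrable_circ hw hM y ρ)
      ((integrable_dist_sq_circ x₀ y (hρ0.le.trans hρρ)).const_mul c), integral_const_mul,
      integral_dist_sq_circ x₀ y (hρ0.le.trans hρρ)]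
  have h3 := hs y (by linarith)
  rw [← hρ] at h3
  have h4 : c * min ε η ^ 2 ≤ c * ρ ^ 2 := by gcongr
  simp only [integral_const, probReal_univ, one_smul] at h1
  simp only [hφ] at hy1
  nlinarith

/-! ### Decay of Green potentials at the boundary -/

section

variable {P : ℂ → ProbabilityMeasure PathSp} (hP : ContMTCBM P)

include hP

lemma exitProb_mul_le (z : ℂ) {r s R : ℝ} (hr : 0 ≤ r) (hrs : r < s) (hsR : s < R) :
    exitProb P z r s R * ∫⁻ _, 1 ∂circGreen P z r (outside z R) ≤
      ∫⁻ _, 1 ∂circGreen P z s (outside z R) := by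
  have hG := isClosed_outside z R
  rw [circGreen_split hP z s (isClosed_offRing z r R) hG Set.subset_union_right
    (fun x => hP.ae_hits_offRing x z r R) measurable_const,
    lintegral_balayage_offRing hP z hr hrs hsR
      (measurable_lintegral_green hP 0 hG measurable_const),
    lintegral_circGreen hP z r hG measurable_const]
  exact le_add_left le_self_add

lemma tendsto_circGreen_one (z : ℂ) {r R : ℝ} (hr : 0 ≤ r) (hrR : r < R) {δ : ℝ≥0∞} (hδ : 0 < δ) :
    ∃ η > 0, ∀ s, R - η < s → r < s → s < R →
      ∫⁻ _, 1 ∂circGreen P z s (outside z R) ≤ δ := by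
  have hfin : ∫⁻ _, 1 ∂green P 0 (outside z R) z ≠ ∞ := by
    obtain ⟨C, hC⟩ := exists_lintegral_green_outside_le hP z R
    exact ne_top_of_le_ne_top ENNReal.coe_ne_top (hC z)
  have hsplit : ∀ s, 0 ≤ s → s ≤ R → ∫⁻ _, 1 ∂green P 0 (outside z R) z =
      ∫⁻ _, 1 ∂green P 0 (outside z s) z + ∫⁻ _, 1 ∂circGreen P z s (outside z R) := by
    intro s hs hsR
    have := circGreen_outside_split hP z le_rfl hs hsR (f := fun _ => 1) measurable_const
    simpa only [lintegral_circGreen hP z 0 (isClosed_outside z _) measurable_const, circ_zero,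
      lintegral_dirac' _ (measurable_lintegral_green hP 0 (isClosed_outside z _) measurable_const)]
      using this
  have hlim := tendsto_lintegral_green_outside P 0 z (s := fun n : ℕ => R - 1 / ((n : ℝ) + 1))
    (R := R) (fun m n h => by
      have := Nat.one_div_le_one_div (α := ℝ) h
      dsimp only; linarith) (fun n => by
      have := Nat.one_div_pos_of_nat (α := ℝ) (n := n)
      linarith) (by simpa using tendsto_one_div_add_atTop_nhds_zero_nat.const_sub R) z
    (f := fun _ => 1) measurable_const
  rcases eq_or_ne (∫⁻ _, 1 ∂green P 0 (outside z R) z) 0 with h0 | h0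
  · refine ⟨R, hr.trans_lt hrR, fun s _ hs hsR => ?_⟩
    have := hsplit s (hr.trans hs.le) hsR.le
    rw [h0] at this
    rw [(add_eq_zero.1 this.symm).2]
    exact zero_le
  have hlt : ∫⁻ _, 1 ∂green P 0 (outside z R) z - δ < ∫⁻ _, 1 ∂green P 0 (outside z R) z :=
    ENNReal.sub_lt_self hfin h0 hδ.ne'
  obtain ⟨n, hn⟩ := (hlim.eventually_const_lt hlt).exists
  refine ⟨1 / ((n : ℝ) + 1), Nat.one_div_pos_of_nat, fun s hs hs' hsR => ?_⟩
  have h1 := hsplit s (hr.trans hs'.le) hsR.le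
  have h2 := lintegral_green_outside_mono P z z (f := fun _ => 1) measurable_const hs.le
  have h3 : ∫⁻ _, 1 ∂green P 0 (outside z R) z ≤ ∫⁻ _, 1 ∂green P 0 (outside z s) z + δ :=
    tsub_le_iff_right.1 (hn.le.trans h2)
  rw [h1] at h3
  refine (ENNReal.add_le_add_iff_left (ne_top_of_le_ne_top hfin ?_)).1 h3
  rw [h1]
  exact le_self_add

lemma exists_green_le_of_boundary (z : ℂ) {r R : ℝ} (hr : 0 < r) (hrR : r < R) {f : ℂ → ℝ≥0∞}
    (hf : Measurable f) (hf1 : ∀ y, f y ≤ 1) (hfr : ∀ y ∉ Metric.closedBall z r, f y = 0)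
    {δ : ℝ≥0} (hδ : 0 < δ) :
    ∃ η > 0, ∀ x, R - η < dist x z → ∫⁻ y, f y ∂green P 0 (outside z R) x ≤ δ := by
  obtain ⟨C, hC⟩ := exists_lintegral_green_outside_le hP z R
  have hG := isClosed_outside z R
  have hvC : ∀ x, ∫⁻ y, f y ∂green P 0 (outside z R) x ≤ C := fun x =>
    (lintegral_mono hf1).trans (hC x)
  set h : ℝ≥0∞ := ∫⁻ _, 1 ∂circGreen P z r (outside z R) with hh
  have hpos : h ≠ 0 := by
    rw [hh, lintegral_circGreen hP z r hG measurable_const, ne_eq,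
      lintegral_eq_zero_iff (measurable_lintegral_green hP 0 hG measurable_const)]
    intro h0
    have : ∀ᵐ x ∂circ z r, False := by
      filter_upwards [h0, ae_circ z hr.le] with x hx hxr
      refine (lintegral_green_pos hP 0 hG (x := x) ?_ (f := fun _ => 1) measurable_const
        fun _ => one_pos).ne' hx
      intro h'
      have h' : R ≤ dist x z := h'
      linarith
    exact IsProbabilityMeasure.ne_zero (circ z r) (by simpa using this)
  have hfin : h ≠ ∞ := by
    rw [hh, lintegral_circGreen hP z r hG measurable_const]
    refine ne_top_of_le_ne_top (b := (C : ℝ≥0∞)) ENNReal.coe_ne_top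
      ((lintegral_mono fun x => hC x).trans ?_)
    simp
  obtain ⟨η, hη, hη'⟩ := tendsto_circGreen_one hP z hr.le hrR (δ := δ * h / (C + 1)) (by
    refine ENNReal.div_pos (mul_ne_zero (by exact_mod_cast hδ.ne') hpos) ?_
    simp)
  refine ⟨min η (R - r), lt_min hη (sub_pos.2 hrR), fun x hx => ?_⟩
  have hxη : R - η < dist x z := (sub_le_sub_left (min_le_left _ _) R).trans_lt hx
  have hxr : r < dist x z := by
    have := min_le_right η (R - r)
    linarith
  rcases le_or_gt R (dist x z) with hxR | hxR
  · rw [lintegral_green_of_mem hP 0 hG hxR hf]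
    exact zero_le
  have hF := isClosed_offRing z r R
  have hmv := measurable_lintegral_green hP 0 hG hf
  have h1 : ∫⁻ y, f y ∂green P 0 (outside z R) x ≤ C * exitProb P z r (dist x z) R := by
    rw [green_split hP hF hG Set.subset_union_right (hP.ae_hits_offRing x z r R) hf,
      lintegral_green_eq_zero P 0 hF x hf fun y hy => hfr y fun h' => hy (Or.inl h'), zero_add,
      ← hitLaw_offRing_closedBall hP, ← setLIntegral_const,
      ← lintegral_indicator measurableSet_closedBall]
    refine lintegral_mono_ae ?_
    filter_upwards [ae_hitLaw_mem hF (hP.ae_hits_offRing x z r R)] with y hy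
    rcases hy with hy | hy
    · rw [Set.indicator_of_mem hy]
      exact hvC y
    · rw [lintegral_green_of_mem hP 0 hG hy hf]
      exact zero_le
  have h2 := (exitProb_mul_le hP z hr.le hxr hxR).trans (hη' _ hxη hxr hxR)
  have hC1 : (C : ℝ≥0∞) + 1 ≠ 0 := by simp
  have hC1' : (C : ℝ≥0∞) + 1 ≠ ∞ := by simp
  have h3 : exitProb P z r (dist x z) R ≤ δ / (C + 1) := by
    rw [← hh] at h2
    refine (ENNReal.mul_le_mul_iff_left hpos hfin).1 (h2.trans_eq ?_)
    rw [div_eq_mul_inv, div_eq_mul_inv, mul_right_comm]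
  calc _ ≤ (C : ℝ≥0∞) * (δ / (C + 1)) := h1.trans (by gcongr)
    _ ≤ (C + 1) * (δ / (C + 1)) := by gcongr; exact le_self_add
    _ = δ := ENNReal.mul_div_cancel hC1 hC1'

end

/-! ### Comparison of Green potentials from local comparison -/

section

variable {P : ℂ → ProbabilityMeasure PathSp} (hP : ContMTCBM P)

include hP

lemma hitLaw_outside_self (z : ℂ) {ρ : ℝ} (hρ : 0 ≤ ρ) : hitLaw P (outside z ρ) z = circ z ρ := by
  rw [← balayage_outside hP z le_rfl hρ, circ_zero, balayage,
    Measure.dirac_bind (measurable_hitLaw hP.cont (isClosed_outside z ρ))]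

lemma green_circ_split (z : ℂ) {ρ : ℝ} (hρ : 0 ≤ ρ) {F : Set ℂ} (hF : IsClosed F)
    (h : F ⊆ outside z ρ) {f : ℂ → ℝ≥0∞} (hf : Measurable f) :
    ∫⁻ y, f y ∂green P 0 F z = ∫⁻ y, f y ∂green P 0 (outside z ρ) z +
      ∫⁻ y, ∫⁻ w, f w ∂green P 0 F y ∂circ z ρ := by
  rw [green_split hP (isClosed_outside z ρ) hF h (hP.ae_hits_outside z z ρ) hf,
    hitLaw_outside_self hP z hρ]

lemma toReal_green_circ_split (z : ℂ) {ρ : ℝ} (hρ : 0 ≤ ρ) {F : Set ℂ} (hF : IsClosed F)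
    (h : F ⊆ outside z ρ) {f : ℂ → ℝ≥0∞} (hf : Measurable f) {C : ℝ≥0}
    (hC : ∀ x, ∫⁻ y, f y ∂green P 0 F x ≤ C) :
    (∫⁻ y, f y ∂green P 0 F z).toReal = (∫⁻ y, f y ∂green P 0 (outside z ρ) z).toReal +
      ∫ y, (∫⁻ w, f w ∂green P 0 F y).toReal ∂circ z ρ := by
  have hs := green_circ_split hP z hρ hF h hf
  have hfin : ∫⁻ y, f y ∂green P 0 F z ≠ ∞ := ne_top_of_le_ne_top ENNReal.coe_ne_top (hC z)
  rw [integral_toReal (measurable_lintegral_green hP 0 hF hf).aemeasurable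
    (.of_forall fun y => (hC y).trans_lt ENNReal.coe_lt_top), hs, ENNReal.toReal_add]
  · rw [hs] at hfin
    exact (ENNReal.add_ne_top.1 hfin).1
  · rw [hs] at hfin
    exact (ENNReal.add_ne_top.1 hfin).2

end

lemma green_comparison {P Q : ℂ → ProbabilityMeasure PathSp} (hP : ContMTCBM P) (hQ : ContMTCBM Q)
    (x₀ : ℂ) {r R ε : ℝ} (hr : 0 < r) (hrR : r < R) (hε : 0 < ε) {f : ℂ → ℝ≥0∞}
    (hf : Measurable f) (hf1 : ∀ y, f y ≤ 1) (hfr : ∀ y ∉ Metric.closedBall x₀ r, f y = 0)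
    {a : ℝ≥0} (h : ∀ z, dist z x₀ < R →
      a * ∫⁻ y, f y ∂green Q 0 (outside z (min ε (R - dist z x₀))) z ≤
        ∫⁻ y, f y ∂green P 0 (outside z (min ε (R - dist z x₀))) z) (z : ℂ) :
    a * ∫⁻ y, f y ∂green Q 0 (outside x₀ R) z ≤ ∫⁻ y, f y ∂green P 0 (outside x₀ R) z := by
  obtain ⟨C₁, hC₁⟩ := exists_lintegral_green_outside_le hP x₀ R
  obtain ⟨C₂, hC₂⟩ := exists_lintegral_green_outside_le hQ x₀ R
  have hG := isClosed_outside x₀ R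
  set v₁ : ℂ → ℝ≥0∞ := fun x => ∫⁻ y, f y ∂green P 0 (outside x₀ R) x with hv₁
  set v₂ : ℂ → ℝ≥0∞ := fun x => ∫⁻ y, f y ∂green Q 0 (outside x₀ R) x with hv₂
  have hvC₁ : ∀ x, v₁ x ≤ C₁ := fun x => (lintegral_mono hf1).trans (hC₁ x)
  have hvC₂ : ∀ x, v₂ x ≤ C₂ := fun x => (lintegral_mono hf1).trans (hC₂ x)
  have hm₁ : Measurable v₁ := measurable_lintegral_green hP 0 hG hf
  have hm₂ : Measurable v₂ := measurable_lintegral_green hQ 0 hG hf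
  have hfin₁ : ∀ x, v₁ x ≠ ∞ := fun x => ne_top_of_le_ne_top ENNReal.coe_ne_top (hvC₁ x)
  have hfin₂ : ∀ x, v₂ x ≠ ∞ := fun x => ne_top_of_le_ne_top ENNReal.coe_ne_top (hvC₂ x)
  have hr₁ : ∀ x, (v₁ x).toReal ≤ C₁ := fun x =>
    (ENNReal.toReal_mono ENNReal.coe_ne_top (hvC₁ x)).trans_eq (ENNReal.coe_toReal _)
  have hr₂ : ∀ x, (v₂ x).toReal ≤ C₂ := fun x =>
    (ENNReal.toReal_mono ENNReal.coe_ne_top (hvC₂ x)).trans_eq (ENNReal.coe_toReal _)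
  rcases le_or_gt R (dist z x₀) with hz | hz
  · rw [lintegral_green_of_mem hQ 0 hG hz hf, mul_zero]
    exact zero_le
  set w : ℂ → ℝ := fun x => a * (v₂ x).toReal - (v₁ x).toReal with hw
  have hwb : ∀ x, |w x| ≤ a * C₂ + C₁ := fun x => by
    have e1 : a * (v₂ x).toReal ≤ a * C₂ := by gcongr; exact hr₂ x
    have e2 := hr₁ x
    have e3 : 0 ≤ a * (v₂ x).toReal := by positivity
    have e4 : 0 ≤ (v₁ x).toReal := ENNReal.toReal_nonneg
    have e5 : (0 : ℝ) ≤ C₁ := C₁.coe_nonneg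
    have e6 : (0 : ℝ) ≤ a * C₂ := by positivity
    rw [abs_le]
    constructor <;> simp only [hw] <;> linarith
  have key := nonpos_of_le_circ (hr.trans hrR) hε (w := w) (by fun_prop) hwb ?_ ?_ hz
  · rw [← ENNReal.toReal_le_toReal (ENNReal.mul_ne_top ENNReal.coe_ne_top (hfin₂ z)) (hfin₁ z),
      ENNReal.toReal_mul, ENNReal.coe_toReal]
    exact sub_nonpos.1 key
  · intro δ hδ
    lift δ to ℝ≥0 using hδ.le
    have hδ' : 0 < δ := by exact_mod_cast hδ
    obtain ⟨η, hη, hη'⟩ := exists_green_le_of_boundary hQ x₀ hr hrR hf hf1 hfr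
      (δ := δ / (a + 1)) (by positivity)
    refine ⟨η, hη, fun x hx => ?_⟩
    have e1 : (v₂ x).toReal ≤ (δ / (a + 1) : ℝ≥0) :=
      (ENNReal.toReal_mono ENNReal.coe_ne_top (hη' x hx)).trans_eq (ENNReal.coe_toReal _)
    have e4 : 0 ≤ (v₁ x).toReal := ENNReal.toReal_nonneg
    have e5 : a * (δ / (a + 1)) ≤ δ := by
      rw [← mul_div_assoc, div_le_iff₀ (by positivity), mul_comm]
      gcongr
      exact le_self_add
    have e6 : (a : ℝ) * (δ / (a + 1) : ℝ≥0) ≤ δ := by exact_mod_cast e5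
    have e7 : a * (v₂ x).toReal ≤ a * (δ / (a + 1) : ℝ≥0) := by gcongr
    simp only [hw]
    linarith
  · intro x hx
    set ρ := min ε (R - dist x x₀) with hρ
    have hρ0 : 0 < ρ := lt_min hε (sub_pos.2 hx)
    have hsub : outside x₀ R ⊆ outside x ρ := fun y hy => by
      have h1 : R ≤ dist y x₀ := hy
      have h2 := dist_triangle y x x₀
      have h3 : ρ ≤ R - dist x x₀ := min_le_right _ _
      change ρ ≤ dist y x
      linarith
    have s₁ := toReal_green_circ_split hP x hρ0.le hG hsub hf hvC₁
    have s₂ := toReal_green_circ_split hQ x hρ0.le hG hsub hf hvC₂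
    have hle := h x hx
    rw [← hρ] at hle
    have hGfin : ∫⁻ y, f y ∂green P 0 (outside x ρ) x ≠ ∞ :=
      ne_top_of_le_ne_top (hfin₁ x) (lintegral_green_mono P 0 (isClosed_outside x ρ) hG hsub x hf)
    have hle' := ENNReal.toReal_mono hGfin hle
    rw [ENNReal.toReal_mul, ENNReal.coe_toReal] at hle'
    have i₁ : Integrable (fun y => (v₁ y).toReal) (circ x ρ) :=
      measurable_integrable_circ (by fun_prop) (M := C₁) (fun y => by
        rw [abs_of_nonneg ENNReal.toReal_nonneg]; exact hr₁ y) x ρ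
    have i₂ : Integrable (fun y => (v₂ y).toReal) (circ x ρ) :=
      measurable_integrable_circ (by fun_prop) (M := C₂) (fun y => by
        rw [abs_of_nonneg ENNReal.toReal_nonneg]; exact hr₂ y) x ρ
    have h_circ : ∫ y, w y ∂circ x ρ =
        a * ∫ y, (v₂ y).toReal ∂circ x ρ - ∫ y, (v₁ y).toReal ∂circ x ρ := by
      rw [← integral_const_mul, ← integral_sub (i₂.const_mul _) i₁]
    rw [h_circ]
    have t₁ : (v₁ x).toReal = _ := s₁
    have t₂ : (v₂ x).toReal = _ := s₂
    simp only [hw]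
    rw [t₁, t₂, mul_add]
    linarith

/-! ### The ratio of Green measures is constant -/

lemma green_empty_closedBall_pos {P : ℂ → ProbabilityMeasure PathSp} (hP : ContMTCBM P) (x w : ℂ)
    {ε : ℝ} (hε : 0 < ε) :
    0 < ∫⁻ y, (Metric.closedBall w ε).indicator 1 y ∂green P 0 ∅ x := by
  set f : ℂ → ℝ≥0∞ := (Metric.closedBall w ε).indicator 1 with hf'
  have hf : Measurable f := measurable_one.indicator measurableSet_closedBall
  have hF := Metric.isClosed_closedBall (x := w) (ε := ε / 2)
  have hx := hP.ae_hits_closedBall x w (half_pos hε)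
  have := isProbabilityMeasure_hitLaw P hF x
  rw [green_split hP hF isClosed_empty (Set.empty_subset _) hx hf]
  refine lt_of_lt_of_le ?_ (le_add_left le_rfl)
  rw [pos_iff_ne_zero, ne_eq,
    lintegral_eq_zero_iff (measurable_lintegral_green hP 0 isClosed_empty hf)]
  intro h0
  have : ∀ᵐ y ∂hitLaw P (Metric.closedBall w (ε / 2)) x, False := by
    filter_upwards [h0, ae_hitLaw_mem hF hx] with y hy hyF
    have hG := isClosed_outside w ε
    have h1 := lintegral_green_pos hP 0 hG (x := y) (fun h' => by
      have h' : ε ≤ dist y w := h'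
      have := Metric.mem_closedBall.1 hyF
      linarith) (f := fun _ => 1) measurable_const fun _ => one_pos
    rw [← lintegral_green_indicator P 0 hG y measurable_const] at h1
    have h2 : ∫⁻ y, f y ∂green P 0 ∅ y = 0 := hy
    refine (h1.trans_le ?_).ne' h2
    refine le_trans (lintegral_mono fun v => ?_)
      (lintegral_green_mono P 0 hG isClosed_empty (Set.empty_subset _) y hf)
    refine Set.indicator_le_indicator_of_subset (fun u hu => ?_) (fun _ => zero_le) v
    exact (not_le.1 (show ¬ ε ≤ dist u w from hu)).le
  exact IsProbabilityMeasure.ne_zero (hitLaw P (Metric.closedBall w (ε / 2)) x)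
      (by simpa using this)

section

variable {P Q : ℂ → ProbabilityMeasure PathSp} (hP : ContMTCBM P) (hQ : ContMTCBM Q)
  {q : ℂ → ℝ≥0}

include hP hQ

lemma ratio_le (hq0 : ∀ z, q z ≠ 0)
    (hq : ∀ z R, 0 < R → green P 0 (outside z R) z = q z • green Q 0 (outside z R) z) (x w : ℂ) :
    q w ≤ q x := by
  by_contra hcon
  obtain ⟨a, hxa, haw⟩ := exists_between (not_le.1 hcon)
  have ha0 : 0 < a := (zero_le).trans_lt hxa
  have hnear : ∀ᶠ v in 𝓝 w, a < q v := by
    have := eventually_ratio_lt hQ hP (q := fun z => (q z)⁻¹) (fun z R hR => by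
      rw [hq z R hR, smul_smul, inv_mul_cancel₀ (hq0 z), one_smul]) (z := w) (a := a⁻¹)
      (inv_strictAnti₀ ha0 haw)
    filter_upwards [this] with v hv
    exact (inv_lt_inv₀ (pos_iff_ne_zero.2 (hq0 v)) ha0).1 hv
  obtain ⟨ε', hε', hball⟩ := Metric.eventually_nhds_iff.1 hnear
  set ε := ε' / 2 with hε
  have hε0 : 0 < ε := half_pos hε'
  set f : ℂ → ℝ≥0∞ := (Metric.closedBall w ε).indicator 1 with hf'
  have hf : Measurable f := measurable_one.indicator measurableSet_closedBall
  have hf1 : ∀ y, f y ≤ 1 := fun y => Set.indicator_le_self' (fun _ _ => zero_le) y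
  have hr : 0 < dist x w + ε := by positivity
  have hfr : ∀ y ∉ Metric.closedBall x (dist x w + ε), f y = 0 := fun y hy =>
    Set.indicator_of_notMem (fun h => hy (by
      have h1 := Metric.mem_closedBall.1 h
      have h2 := dist_triangle y w x
      rw [dist_comm w x] at h2
      rw [Metric.mem_closedBall]
      linarith)) _
  obtain ⟨n, hn, hnpos⟩ := ((eventually_gt_atTop ⌈dist x w + ε⌉₊).and
    ((tendsto_lintegral_green_outside_atTop Q 0 x x hf).eventually_const_lt
      (green_empty_closedBall_pos hQ x w hε0))).exists
  have hrn : dist x w + ε < n := (Nat.le_ceil _).trans_lt (by exact_mod_cast hn)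
  have key := green_comparison hP hQ x hr hrn hε0 hf hf1 hfr (a := a) (fun z hz => ?_) x
  · rw [hq x n (hr.trans hrn), lintegral_nnreal_smul] at key
    obtain ⟨C, hC⟩ := exists_lintegral_green_outside_le hQ x n
    have hfin : ∫⁻ y, f y ∂green Q 0 (outside x n) x ≠ ∞ :=
      ne_top_of_le_ne_top ENNReal.coe_ne_top ((lintegral_mono hf1).trans (hC x))
    have := (ENNReal.mul_le_mul_iff_left hnpos.ne' hfin).1 key
    exact hxa.not_ge (by exact_mod_cast this)
  · have hρ0 : 0 < min ε (n - dist z x) := lt_min hε0 (sub_pos.2 hz)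
    by_cases hzw : dist z w < ε'
    · rw [hq z _ hρ0, lintegral_nnreal_smul]
      have := (hball hzw).le
      gcongr
    · rw [lintegral_green_eq_zero Q 0 (isClosed_outside _ _) z hf, mul_zero]
      · exact zero_le
      · intro y hy
        refine Set.indicator_of_notMem (fun h => hy ?_) _
        have h1 := Metric.mem_closedBall.1 h
        have h2 := dist_triangle z y w
        rw [dist_comm z y] at h2
        have h3 := min_le_left ε (n - dist z x)
        change _ ≤ dist y z
        linarith

lemma smul_green_le {a : ℝ≥0}
    (h : ∀ z R, 0 < R → a • green Q 0 (outside z R) z ≤ green P 0 (outside z R) z)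
    (x₀ : ℂ) {R : ℝ} (hR : 0 < R) (x : ℂ) :
    a • green Q 0 (outside x₀ R) x ≤ green P 0 (outside x₀ R) x := by
  have hG := isClosed_outside x₀ R
  refine Measure.le_iff.2 fun A hA => ?_
  have hA0 : (a • green Q 0 (outside x₀ R) x) A =
      (a • green Q 0 (outside x₀ R) x) (A ∩ (outside x₀ R)ᶜ) := by
    refine measure_eq_measure_of_null_sdiff Set.inter_subset_left ?_ |>.symm
    rw [Measure.smul_apply, ENNReal.smul_def, smul_eq_mul,
      ← lintegral_indicator_one (hA.diff (hA.inter hG.measurableSet.compl)),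
      lintegral_green_eq_zero Q 0 hG x (measurable_one.indicator
        (hA.diff (hA.inter hG.measurableSet.compl))), mul_zero]
    exact fun y hy => Set.indicator_of_notMem (fun h' => h'.2 ⟨h'.1, hy⟩) _
  have hU : A ∩ (outside x₀ R)ᶜ =
      ⋃ n : ℕ, A ∩ Metric.closedBall x₀ (R - R / 2 * (1 / ((n : ℝ) + 1))) := by
    rw [← Set.inter_iUnion]
    congr 1
    ext y
    simp only [Set.mem_compl_iff, Set.mem_iUnion, Metric.mem_closedBall]
    constructor
    · intro hy
      have hy : dist y x₀ < R := not_le.1 hy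
      obtain ⟨n, hn⟩ := exists_nat_one_div_lt (div_pos (sub_pos.2 hy) (half_pos hR))
      rw [lt_div_iff₀ (half_pos hR)] at hn
      exact ⟨n, by linarith⟩
    · rintro ⟨n, hn⟩ hy
      have hy : R ≤ dist y x₀ := hy
      have : 0 < R / 2 * (1 / ((n : ℝ) + 1)) := by positivity
      linarith
  have hmono : Monotone fun n : ℕ =>
      A ∩ Metric.closedBall x₀ (R - R / 2 * (1 / ((n : ℝ) + 1))) := fun m n hmn => by
    refine Set.inter_subset_inter_right _ (Metric.closedBall_subset_closedBall ?_)
    have := Nat.one_div_le_one_div (α := ℝ) hmn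
    gcongr
  rw [hA0, hU, hmono.measure_iUnion]
  refine iSup_le fun n => ?_
  set r := R - R / 2 * (1 / ((n : ℝ) + 1)) with hr
  have h1 : 0 < 1 / ((n : ℝ) + 1) := by positivity
  have h2 : 1 / ((n : ℝ) + 1) ≤ 1 := by
    rw [div_le_one (by positivity)]
    linarith [(Nat.cast_nonneg n : (0 : ℝ) ≤ n)]
  have hrR : r < R := by nlinarith
  have hr0 : 0 < r := by nlinarith
  have hB : MeasurableSet (A ∩ Metric.closedBall x₀ r) := hA.inter measurableSet_closedBall
  have key := green_comparison hP hQ x₀ hr0 hrR one_pos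
    (f := (A ∩ Metric.closedBall x₀ r).indicator 1)
    (measurable_one.indicator hB) (fun y => Set.indicator_le_self' (fun _ _ => zero_le) y)
    (fun y hy => Set.indicator_of_notMem (fun h' => hy h'.2) _) (a := a) (fun z hz => ?_) x
  · rw [lintegral_indicator_one hB, lintegral_indicator_one hB] at key
    rw [Measure.smul_apply, ENNReal.smul_def, smul_eq_mul]
    exact key.trans (measure_mono Set.inter_subset_left)
  · rw [← lintegral_nnreal_smul]
    exact lintegral_mono' (h z _ (lt_min one_pos (sub_pos.2 hz))) le_rfl

/-- The Green measures of two families with a common invariant measure are proportional. -/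
lemma exists_green_eq_smul {μ : Measure ℂ} [SigmaFinite μ] (hμ : μ ≠ 0)
    (hinvP : InvariantFor P μ) (hinvQ : InvariantFor Q μ) :
    ∃ c : ℝ≥0, c ≠ 0 ∧ ∀ x₀ R, 0 < R → ∀ x,
      green P 0 (outside x₀ R) x = c • green Q 0 (outside x₀ R) x := by
  choose q hq0 hq _ using exists_green_ratio hP hQ hμ hinvP hinvQ
  have hc : ∀ z, q z = q 0 := fun z =>
    le_antisymm (ratio_le hP hQ hq0 hq 0 z) (ratio_le hP hQ hq0 hq z 0)
  refine ⟨q 0, hq0 0, fun x₀ R hR x => le_antisymm ?_ ?_⟩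
  · have := smul_green_le hQ hP (a := (q 0)⁻¹) (fun z R hR => by
      rw [hq z R hR, hc z, smul_smul, inv_mul_cancel₀ (hq0 0), one_smul]) x₀ hR x
    calc green P 0 (outside x₀ R) x = q 0 • (q 0)⁻¹ • green P 0 (outside x₀ R) x := by
          rw [smul_smul, mul_inv_cancel₀ (hq0 0), one_smul]
      _ ≤ q 0 • green Q 0 (outside x₀ R) x := fun A => by
          have h := this A
          rw [Measure.smul_apply _ ((q 0)⁻¹ • _), Measure.smul_apply _ (green Q 0 _ _)]
          generalize ((q 0)⁻¹ • green P 0 (outside x₀ R) x) A = u at h ⊢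
          rw [ENNReal.smul_def, ENNReal.smul_def, smul_eq_mul, smul_eq_mul]
          gcongr
  · exact smul_green_le hP hQ (fun z R hR => by rw [hq z R hR, hc z]) x₀ hR x

end

/-! ### Proportional Green measures have proportional resolvents -/

lemma le_of_add_lintegral_eq {κ : ℂ → Measure ℂ} {u v : ℂ → ℝ≥0∞} {γ C B : ℝ≥0}
    (hu : Measurable u) (hv : Measurable v) (hκ : ∀ x, κ x Set.univ ≤ C) (hC : γ * C ≤ 2⁻¹)
    (huB : ∀ x, u x ≤ B) (hvB : ∀ x, v x ≤ B)
    (h : ∀ x, u x + γ * ∫⁻ y, u y ∂κ x = v x + γ * ∫⁻ y, v y ∂κ x) :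
    ∀ x, u x ≤ v x ∧ v x ≤ u x := by
  have half : ∀ S : ℝ≥0, ∀ u v : ℂ → ℝ≥0∞, Measurable u → (∀ x, u x ≤ B) →
      (∀ x, u x + γ * ∫⁻ y, u y ∂κ x = v x + γ * ∫⁻ y, v y ∂κ x) →
      (∀ x, v x ≤ u x + S) → ∀ x, u x ≤ v x + (2⁻¹ * S : ℝ≥0) := by
    intro S u v hu huB h hvu x
    have hfin : (γ : ℝ≥0∞) * ∫⁻ y, u y ∂κ x ≠ ∞ := by
      refine ENNReal.mul_ne_top ENNReal.coe_ne_top (ne_top_of_le_ne_top ?_ (lintegral_mono huB))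
      rw [lintegral_const]
      exact ENNReal.mul_ne_top ENNReal.coe_ne_top (ne_top_of_le_ne_top ENNReal.coe_ne_top (hκ x))
    refine (ENNReal.add_le_add_iff_right hfin).1 ?_
    rw [h x, add_assoc]
    gcongr
    calc (γ : ℝ≥0∞) * ∫⁻ y, v y ∂κ x ≤ γ * ∫⁻ y, (u y + S) ∂κ x := by
          gcongr with y
          exact hvu y
      _ = γ * ∫⁻ y, u y ∂κ x + γ * (S * κ x Set.univ) := by
          rw [lintegral_add_left hu, lintegral_const, mul_add]
      _ ≤ γ * ∫⁻ y, u y ∂κ x + γ * (S * C) := by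
          gcongr
          exact hκ x
      _ = γ * ∫⁻ y, u y ∂κ x + (γ * C * S : ℝ≥0) := by push_cast; ring
      _ ≤ γ * ∫⁻ y, u y ∂κ x + (2⁻¹ * S : ℝ≥0) := by gcongr
      _ = (2⁻¹ * S : ℝ≥0) + γ * ∫⁻ y, u y ∂κ x := add_comm _ _
  have key : ∀ n : ℕ, ∀ x, u x ≤ v x + (2⁻¹ ^ n * B : ℝ≥0) ∧ v x ≤ u x + (2⁻¹ ^ n * B : ℝ≥0) := by
    intro n
    induction n with
    | zero =>
      intro x
      simp only [pow_zero, one_mul]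
      exact ⟨(huB x).trans le_add_self, (hvB x).trans le_add_self⟩
    | succ n ih =>
      intro x
      rw [pow_succ', mul_assoc]
      exact ⟨half _ u v hu huB h (fun x => (ih x).2) x,
        half _ v u hv hvB (fun x => (h x).symm) (fun x => (ih x).1) x⟩
  have lim : ∀ a : ℝ≥0∞, Tendsto (fun n : ℕ => a + (2⁻¹ ^ n * B : ℝ≥0)) atTop (𝓝 a) := fun a => by
    have h1 : Tendsto (fun n : ℕ => (2⁻¹ : ℝ≥0) ^ n * B) atTop (𝓝 (0 * B)) :=
      (NNReal.tendsto_pow_atTop_nhds_zero_of_lt_one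
        (inv_lt_one_of_one_lt₀ one_lt_two)).mul tendsto_const_nhds
    have := (tendsto_const_nhds (x := a)).add (ENNReal.tendsto_coe.2 h1)
    simpa using this
  exact fun x => ⟨ge_of_tendsto' (lim _) fun n => (key n x).1,
    ge_of_tendsto' (lim _) fun n => (key n x).2⟩

section

variable {P Q : ℂ → ProbabilityMeasure PathSp} (hP : ContMTCBM P) (hQ : ContMTCBM Q)
include hP hQ

lemma green_eq_smul_step {F : Set ℂ} (hF : IsClosed F) {c α γ C D : ℝ≥0}
    (hC : ∀ α x, ∫⁻ _, 1 ∂green P α F x ≤ C) (hD : ∀ α x, ∫⁻ _, 1 ∂green Q α F x ≤ D)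
    (hγ : γ * C ≤ 2⁻¹) (h : ∀ x, green P α F x = c • green Q (c * α) F x) (x : ℂ) :
    green P (α + γ) F x = c • green Q (c * (α + γ)) F x := by
  refine Measure.ext fun A hA => ?_
  set f : ℂ → ℝ≥0∞ := A.indicator 1 with hf
  have hfm : Measurable f := measurable_one.indicator hA
  have hf1 : ∀ y, f y ≤ 1 := fun y => Set.indicator_le_self _ _ y
  rw [← lintegral_indicator_one hA, ← lintegral_indicator_one hA, lintegral_nnreal_smul]
  have := le_of_add_lintegral_eq (κ := green P α F)
    (u := fun x => ∫⁻ y, f y ∂green P (α + γ) F x)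
    (v := fun x => c * ∫⁻ y, f y ∂green Q (c * (α + γ)) F x) (B := max C (c * D))
    (measurable_lintegral_green hP _ hF hfm)
    ((measurable_lintegral_green hQ _ hF hfm).const_mul _)
    (fun x => by simpa using hC α x) hγ
    (fun x => ((lintegral_mono hf1).trans (hC _ x)).trans (by exact_mod_cast le_max_left _ _))
    (fun x => by
      calc (c : ℝ≥0∞) * ∫⁻ y, f y ∂green Q (c * (α + γ)) F x ≤ c * D := by
            gcongr
            exact (lintegral_mono hf1).trans (hD _ x)
        _ ≤ _ := by exact_mod_cast le_max_right _ _)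
    (fun x => by
      rw [← green_resolvent hP α γ hF x hfm, h x, lintegral_nnreal_smul, lintegral_nnreal_smul,
        lintegral_const_mul _ (measurable_lintegral_green hQ _ hF hfm),
        green_resolvent hQ (c * α) (c * γ) hF x hfm, mul_add, mul_add]
      push_cast
      ring) x
  exact le_antisymm this.1 this.2

lemma green_outside_eq_smul {z : ℂ} {R : ℝ} {c : ℝ≥0}
    (h : ∀ x, green P 0 (outside z R) x = c • green Q 0 (outside z R) x) (α : ℝ≥0) (x : ℂ) :
    green P α (outside z R) x = c • green Q (c * α) (outside z R) x := by
  have hF : IsClosed (outside z R) := isClosed_outside z R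
  obtain ⟨C, hC⟩ := exists_lintegral_green_outside_le hP z R
  obtain ⟨D, hD⟩ := exists_lintegral_green_outside_le hQ z R
  have mono : ∀ {P : ℂ → ProbabilityMeasure PathSp}, ∀ α x,
      ∫⁻ _, 1 ∂green P α (outside z R) x ≤ ∫⁻ _, 1 ∂green P 0 (outside z R) x := by
    intro P α x
    rw [lintegral_green P _ hF x measurable_const, lintegral_green P _ hF x measurable_const]
    refine lintegral_mono fun X => lintegral_mono fun t => ?_
    rw [disc_zero_left]
    gcongr
    exact disc_le_one α t
  obtain ⟨n, hn⟩ := exists_nat_ge (2 * (α * C))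
  set γ : ℝ≥0 := α / (n + 1) with hγ
  have hγC : γ * C ≤ 2⁻¹ := by
    rw [hγ, div_mul_eq_mul_div, div_le_iff₀ (by positivity), inv_mul_eq_div,
      le_div_iff₀ two_pos, mul_comm]
    exact hn.trans (by simp)
  have key : ∀ k : ℕ, ∀ x, green P (k * γ) (outside z R) x =
      c • green Q (c * (k * γ)) (outside z R) x := by
    intro k
    induction k with
    | zero => simpa using h
    | succ k ih =>
      have hk : ((k + 1 : ℕ) : ℝ≥0) * γ = k * γ + γ := by push_cast; ring
      rw [hk]
      exact green_eq_smul_step hP hQ hF (fun α x => (mono α x).trans (hC x))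
        (fun α x => (mono α x).trans (hD x)) hγC ih
  have hα : ((n + 1 : ℕ) : ℝ≥0) * γ = α := by
    rw [hγ]; push_cast; field_simp
  rw [← hα]
  exact key (n + 1) x

lemma green_empty_eq_smul {c : ℝ≥0}
    (h : ∀ x₀ R, 0 < R → ∀ x, green P 0 (outside x₀ R) x = c • green Q 0 (outside x₀ R) x)
    (α : ℝ≥0) (x : ℂ) {f : ℂ → ℝ≥0∞} (hf : Measurable f) :
    ∫⁻ y, f y ∂green P α ∅ x = c * ∫⁻ y, f y ∂green Q (c * α) ∅ x := by
  have h1 := tendsto_lintegral_green_outside_atTop P α 0 x hf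
  have h2 := ENNReal.Tendsto.const_mul (a := c)
    (tendsto_lintegral_green_outside_atTop Q (c * α) 0 x hf) (Or.inr ENNReal.coe_ne_top)
  refine tendsto_nhds_unique h1 (h2.congr' ?_)
  filter_upwards [eventually_gt_atTop 0] with n hn
  rw [green_outside_eq_smul hP hQ (h 0 n (by exact_mod_cast hn)) α x, lintegral_nnreal_smul]

end

/-! ### Uniqueness of Laplace transforms -/

/-- The function `t ↦ exp (-t)` as a bounded continuous function on the half-line. -/
def expNeg : BoundedContinuousFunction ℝ≥0 ℝ :=
  BoundedContinuousFunction.ofNormedAddCommGroup (fun t : ℝ≥0 => Real.exp (-t))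
    (by fun_prop) 1 fun t => by simp [abs_of_pos (Real.exp_pos _)]

lemma disc_natCast (n : ℕ) (t : ℝ≥0) : disc n t = ENNReal.ofReal (expNeg t ^ n) := by
  rw [disc]
  congr 1
  change _ = Real.exp (-t) ^ n
  rw [← Real.exp_nat_mul]
  congr 1
  push_cast
  ring

lemma ext_of_lintegral_disc {m₁ m₂ : Measure ℝ≥0} [IsFiniteMeasure m₁] [IsFiniteMeasure m₂]
    (h : ∀ n : ℕ, ∫⁻ t, disc n t ∂m₁ = ∫⁻ t, disc n t ∂m₂) : m₁ = m₂ := by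
  have hpow : ∀ m : Measure ℝ≥0, ∀ n : ℕ, ∫ t, (expNeg ^ n) t ∂m = (∫⁻ t, disc n t ∂m).toReal := by
    intro m n
    simp only [disc_natCast]
    rw [← integral_eq_lintegral_of_nonneg_ae]
    · rfl
    · exact ae_of_all _ fun t => pow_nonneg (Real.exp_pos _).le n
    · exact (expNeg.continuous.pow n).aestronglyMeasurable
  let A : StarSubalgebra ℝ (BoundedContinuousFunction ℝ≥0 ℝ) :=
    { Algebra.adjoin ℝ {expNeg} with
      star_mem' := fun {a} ha => by
        rwa [show star a = a from BoundedContinuousFunction.ext fun t => star_trivial (a t)] }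
  refine ext_of_forall_mem_subalgebra_integral_eq_of_polish (𝕜 := ℝ) (A := A) ?_ ?_
  · intro s t hst
    refine ⟨fun t : ℝ≥0 => Real.exp (-t), ⟨expNeg.toContinuousMap, ⟨expNeg, ?_, rfl⟩, rfl⟩, ?_⟩
    · exact Algebra.subset_adjoin rfl
    · simpa using hst
  · intro g hg
    replace hg : g ∈ Algebra.adjoin ℝ {expNeg} := hg
    rw [Algebra.adjoin_singleton_eq_range_aeval] at hg
    obtain ⟨p, rfl⟩ := hg
    induction p using Polynomial.induction_on' with
    | add p q hp hq =>
      have key : ∀ m : Measure ℝ≥0, IsFiniteMeasure m →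
          ∫ t, (Polynomial.aeval expNeg (p + q)) t ∂m =
            ∫ t, (Polynomial.aeval expNeg p) t ∂m + ∫ t, (Polynomial.aeval expNeg q) t ∂m :=
        fun m _ => by
          rw [map_add, ← integral_add (BoundedContinuousFunction.integrable m _)
            (BoundedContinuousFunction.integrable m _)]
          rfl
      exact (key m₁ inferInstance).trans ((congrArg₂ _ hp hq).trans (key m₂ inferInstance).symm)
    | monomial n a =>
      have key : ∀ m : Measure ℝ≥0, ∫ t, (Polynomial.aeval expNeg (Polynomial.monomial n a)) t ∂m =
          a * ∫ t, (expNeg ^ n) t ∂m := fun m => by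
        rw [Polynomial.aeval_monomial, ← integral_const_mul]
        rfl
      exact (key m₁).trans (Eq.trans (by rw [hpow, hpow, h]) (key m₂).symm)

lemma lintegral_halfLine_mul_left {c : ℝ≥0} (hc : c ≠ 0) {g : ℝ≥0 → ℝ≥0∞} (hg : Measurable g) :
    c * ∫⁻ t, g (c * t) ∂halfLine = ∫⁻ t, g t ∂halfLine := by
  have hc0 : (0 : ℝ) < c := NNReal.coe_pos.2 (pos_iff_ne_zero.2 hc)
  have hm : Measurable ((Set.Ici (0 : ℝ)).indicator fun x => g x.toNNReal) :=
    (hg.comp measurable_real_toNNReal).indicator measurableSet_Ici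
  rw [lintegral_halfLine hg,
    lintegral_halfLine (g := fun t => g (c * t)) (by exact hg.comp (measurable_const_mul c)),
    ← lintegral_indicator measurableSet_Ici, ← lintegral_indicator measurableSet_Ici]
  have h1 : ∫⁻ x, (Set.Ici (0 : ℝ)).indicator (fun x => g x.toNNReal) (c * x) =
      ∫⁻ x, (Set.Ici (0 : ℝ)).indicator (fun x => g (c * x.toNNReal)) x := by
    refine lintegral_congr fun x => ?_
    by_cases hx : 0 ≤ x
    · rw [Set.indicator_of_mem (Set.mem_Ici.2 hx),
        Set.indicator_of_mem (Set.mem_Ici.2 (mul_nonneg hc0.le hx)),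
        Real.toNNReal_mul hc0.le, Real.toNNReal_coe]
    · have hx' : ¬ 0 ≤ c * x := by
        rw [not_le] at hx ⊢
        exact mul_neg_of_pos_of_neg hc0 hx
      rw [Set.indicator_of_notMem (by exact hx'), Set.indicator_of_notMem (by exact hx)]
  rw [← h1, ← lintegral_map (f := (Set.Ici (0 : ℝ)).indicator fun x => g x.toNNReal) hm
    (measurable_const_mul (c : ℝ)), Real.map_volume_mul_left hc0.ne', lintegral_smul_measure,
    smul_eq_mul, ← mul_assoc, abs_of_pos (inv_pos.2 hc0), ENNReal.ofReal_inv_of_pos hc0,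
    ENNReal.ofReal_coe_nnreal, ENNReal.mul_inv_cancel (by exact_mod_cast hc) ENNReal.coe_ne_top,
    one_mul]

lemma lintegral_green_empty (P : ℂ → ProbabilityMeasure PathSp) (α : ℝ≥0) (x : ℂ)
    {f : ℂ → ℝ≥0∞} (hf : Measurable f) :
    ∫⁻ y, f y ∂green P α ∅ x =
      ∫⁻ t, disc α t * ∫⁻ X, f (X t) ∂(P x : Measure PathSp) ∂halfLine := by
  have hm : Measurable fun p : ℝ≥0 × PathSp => disc α p.1 * f (p.2 p.1) :=
    ((measurable_disc α).comp measurable_fst).mul (hf.comp measurable_eval_uncurry)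
  rw [lintegral_green P α isClosed_empty x hf]
  simp only [occ, alive_empty]
  rw [← lintegral_lintegral_swap (μ := halfLine) (ν := (P x : Measure PathSp))
    (f := fun t X => disc α t * f (X t)) hm.aemeasurable]
  exact lintegral_congr fun t => lintegral_const_mul _ (hf.comp (measurable_eval t))

lemma eq_of_lintegral_disc_mul {φ ψ : ℝ≥0 → ℝ≥0} (hφ : Continuous φ) (hψ : Continuous ψ)
    {C : ℝ≥0} (hφC : ∀ t, φ t ≤ C)
    (h : ∀ n : ℕ, ∫⁻ t, disc (n + 1) t * φ t ∂halfLine = ∫⁻ t, disc (n + 1) t * ψ t ∂halfLine) :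
    φ = ψ := by
  have hm : ∀ φ : ℝ≥0 → ℝ≥0, Continuous φ → Measurable fun t => disc 1 t * (φ t : ℝ≥0∞) :=
    fun φ hφ => (measurable_disc 1).mul hφ.measurable.coe_nnreal_ennreal
  have hd : ∀ φ : ℝ≥0 → ℝ≥0, Continuous φ → ∀ n : ℕ,
      ∫⁻ t, disc n t ∂halfLine.withDensity (fun t => disc 1 t * φ t) =
        ∫⁻ t, disc (n + 1) t * φ t ∂halfLine := fun φ hφ n => by
    rw [lintegral_withDensity_eq_lintegral_mul _ (hm φ hφ) (measurable_disc n)]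
    refine lintegral_congr fun t => ?_
    rw [disc_add_left, Pi.mul_apply]
    ring
  have hfinφ : ∫⁻ t, disc 1 t * φ t ∂halfLine ≠ ∞ := by
    refine ne_top_of_le_ne_top (b := ∫⁻ t, disc 1 t * C ∂halfLine) ?_
      (lintegral_mono fun t => by gcongr; exact hφC t)
    rw [lintegral_mul_const _ (measurable_disc 1), lintegral_disc 1 one_ne_zero]
    simp
  have hfinψ : ∫⁻ t, disc 1 t * ψ t ∂halfLine ≠ ∞ := by
    have := h 0
    simp only [Nat.cast_zero, zero_add] at this
    rwa [← this]
  have := isFiniteMeasure_withDensity hfinφ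
  have := isFiniteMeasure_withDensity hfinψ
  have heq := ext_of_lintegral_disc (m₁ := halfLine.withDensity fun t => disc 1 t * φ t)
    (m₂ := halfLine.withDensity fun t => disc 1 t * ψ t)
    fun n => by rw [hd φ hφ, hd ψ hψ, h]
  have hae := (withDensity_eq_iff (hm φ hφ).aemeasurable (hm ψ hψ).aemeasurable hfinφ).1 heq
  have : halfLine.IsOpenPosMeasure := ⟨fun U hU ⟨t, ht⟩ =>
    (halfLine_pos_of_mem_nhds (hU.mem_nhds ht)).ne'⟩
  refine (hφ.ae_eq_iff_eq halfLine hψ).1 ?_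
  filter_upwards [hae] with t ht
  have := (ENNReal.mul_right_inj (disc_ne_zero 1 t) (disc_ne_top 1 t)).1 ht
  exact_mod_cast this

/-! ### Laws of Markov processes with proportional resolvents -/

/-- The linear time change `X ↦ (t ↦ X (c * t))`. -/
def speed (c : ℝ≥0) (X : PathSp) : PathSp := X.comp ⟨fun t => c * t, continuous_const_mul c⟩

@[simp] lemma speed_apply (c : ℝ≥0) (X : PathSp) (t : ℝ≥0) : speed c X t = X (c * t) := rfl

lemma measurable_speed (c : ℝ≥0) : Measurable (speed c) :=
  measurable_path_iff.2 fun t => measurable_eval (c * t)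

lemma measurableSet_preimage_speed (c : ℝ≥0) {s : ℝ≥0} {A : Set PathSp}
    (hA : MeasurableSet[pastAlg s] A) : MeasurableSet[pastAlg (c * s)] (speed c ⁻¹' A) := by
  have : @Measurable _ _ (pastAlg (c * s)) (pastAlg s) (speed c) := by
    refine @Measurable.of_comap_le _ _ (pastAlg (c * s)) (pastAlg s) _ ?_
    rw [pastAlg, MeasurableSpace.comap_iSup]
    refine iSup_le fun u => ?_
    rw [MeasurableSpace.comap_iSup]
    refine iSup_le fun hu => ?_
    rw [MeasurableSpace.comap_comp]
    exact (measurable_eval_pastAlg (mul_le_mul_right hu.out c)).comap_le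
  exact this hA

lemma hasKernel_law {P : ℂ → ProbabilityMeasure PathSp} (hP : ContMTCBM P) (z : ℂ) :
    HasKernel (P z : Measure PathSp) fun t x => (P x : Measure PathSp).map fun X => X t := by
  intro s t A hA f hf
  refine (markov_lintegral hP.cont hP.markov z s hA (hf.comp (measurable_eval t))).trans ?_
  exact lintegral_congr fun X => (lintegral_map hf (measurable_eval t)).symm

lemma hasKernel_map_speed {ν : Measure PathSp} {K : ℝ≥0 → ℂ → Measure ℂ}
    (hK : ∀ t, Measurable (K t))
    (h : HasKernel ν K) (c : ℝ≥0) : HasKernel (ν.map (speed c)) fun t => K (c * t) := by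
  intro s t A hA f hf
  have hA' := pastAlg_le s A hA
  have hKf : Measurable fun X : PathSp => ∫⁻ y, f y ∂K (c * t) (X s) :=
    ((Measure.measurable_lintegral hf).comp (hK _)).comp (measurable_eval s)
  rw [setLIntegral_map (f := fun X : PathSp => f (X (s + t))) hA'
    (hf.comp (measurable_eval _)) (measurable_speed c),
    setLIntegral_map hA' hKf (measurable_speed c)]
  simp only [speed_apply, mul_add]
  exact h (c * s) (c * t) _ (measurableSet_preimage_speed c hA) f hf

lemma continuous_lintegral_eval (ν : Measure PathSp) [IsProbabilityMeasure ν]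
    (f : BoundedContinuousFunction ℂ ℝ≥0) : Continuous fun t => ∫⁻ X : PathSp, f (X t) ∂ν := by
  rw [continuous_iff_continuousAt]
  intro t
  refine tendsto_lintegral_filter_of_dominated_convergence (fun _ => (nndist 0 f : ℝ≥0∞))
    (Eventually.of_forall fun s =>
      (f.continuous.measurable.comp (measurable_eval s)).coe_nnreal_ennreal)
    (Eventually.of_forall fun s => ae_of_all _ fun X => ?_) (by simp)
    (ae_of_all _ fun X => ?_)
  · exact ENNReal.coe_le_coe.2 (f.apply_le_nndist_zero _)
  · exact (ENNReal.continuous_coe.comp (f.continuous.comp X.continuous)).tendsto t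

lemma lintegral_eval_le (ν : Measure PathSp) [IsProbabilityMeasure ν]
    (f : BoundedContinuousFunction ℂ ℝ≥0) (t : ℝ≥0) :
    ∫⁻ X : PathSp, f (X t) ∂ν ≤ (nndist 0 f : ℝ≥0∞) := by
  calc ∫⁻ X : PathSp, f (X t) ∂ν ≤ ∫⁻ _, (nndist 0 f : ℝ≥0∞) ∂ν :=
        lintegral_mono fun X => ENNReal.coe_le_coe.2 (f.apply_le_nndist_zero _)
    _ = _ := by simp

section

variable {P Q : ℂ → ProbabilityMeasure PathSp} {c : ℝ≥0} (hc : c ≠ 0)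
  (h : ∀ (α : ℝ≥0) (x : ℂ) {f : ℂ → ℝ≥0∞}, Measurable f →
    ∫⁻ y, f y ∂green P α ∅ x = c * ∫⁻ y, f y ∂green Q (c * α) ∅ x)
include hc h

lemma map_eval_eq (x : ℂ) (t : ℝ≥0) :
    (P x : Measure PathSp).map (fun X => X t) =
      (Q x : Measure PathSp).map fun X => X (c⁻¹ * t) := by
  have := Measure.isProbabilityMeasure_map (μ := (P x : Measure PathSp))
    (measurable_eval t).aemeasurable
  have := Measure.isProbabilityMeasure_map (μ := (Q x : Measure PathSp))
    (measurable_eval (c⁻¹ * t)).aemeasurable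
  refine ext_of_forall_lintegral_eq_of_IsFiniteMeasure fun f => ?_
  have hf : Measurable fun y => (f y : ℝ≥0∞) := f.continuous.measurable.coe_nnreal_ennreal
  rw [lintegral_map hf (measurable_eval t), lintegral_map hf (measurable_eval _)]
  set φ : (ℂ → ProbabilityMeasure PathSp) → ℝ≥0 → ℝ≥0 := fun P t =>
    (∫⁻ X : PathSp, f (X t) ∂(P x : Measure PathSp)).toNNReal with hφ
  have hfin : ∀ (P : ℂ → ProbabilityMeasure PathSp) t,
      ∫⁻ X : PathSp, f (X t) ∂(P x : Measure PathSp) ≠ ∞ := fun P t =>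
    ne_top_of_le_ne_top ENNReal.coe_ne_top (lintegral_eval_le _ f t)
  have hcoe : ∀ (P : ℂ → ProbabilityMeasure PathSp) t,
      (φ P t : ℝ≥0∞) = ∫⁻ X : PathSp, f (X t) ∂(P x : Measure PathSp) := fun P t =>
    ENNReal.coe_toNNReal (hfin P t)
  have hcont : ∀ P : ℂ → ProbabilityMeasure PathSp, Continuous (φ P) := fun P =>
    ENNReal.continuousOn_toNNReal.comp_continuous (continuous_lintegral_eval _ f) (hfin P)
  rw [← hcoe, ← hcoe]
  congr 1
  refine congrFun (eq_of_lintegral_disc_mul (φ := φ P) (ψ := fun t => φ Q (c⁻¹ * t)) (hcont P)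
    ((hcont Q).comp (continuous_const_mul _)) (C := nndist 0 f) (fun t => ?_) fun n => ?_) t
  · rw [← ENNReal.coe_le_coe, hcoe]
    exact lintegral_eval_le _ f t
  · have := h (n + 1) x hf
    rw [lintegral_green_empty P _ x hf, lintegral_green_empty Q _ x hf] at this
    simp only [hcoe]
    refine this.trans ?_
    have hm : Measurable fun t => disc (n + 1) t *
        ∫⁻ X : PathSp, f (X (c⁻¹ * t)) ∂(Q x : Measure PathSp) :=
      (measurable_disc _).mul
        ((continuous_lintegral_eval _ f).comp (continuous_const_mul _)).measurable
    rw [← lintegral_halfLine_mul_left hc hm]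
    congr 1
    refine lintegral_congr fun t => ?_
    rw [inv_mul_cancel_left₀ hc, disc, disc]
    push_cast
    ring_nf

end

lemma law_eq_map_speed {P Q : ℂ → ProbabilityMeasure PathSp} (hP : ContMTCBM P)
    (hQ : ContMTCBM Q) {c : ℝ≥0} (hc : c ≠ 0)
    (h : ∀ (α : ℝ≥0) (x : ℂ) {f : ℂ → ℝ≥0∞}, Measurable f →
      ∫⁻ y, f y ∂green P α ∅ x = c * ∫⁻ y, f y ∂green Q (c * α) ∅ x) (z : ℂ) :
    (P z : Measure PathSp) = (Q z : Measure PathSp).map (speed c⁻¹) := by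
  have hK : ∀ {P : ℂ → ProbabilityMeasure PathSp}, ContMTCBM P → ∀ t : ℝ≥0,
      Measurable fun x => (P x : Measure PathSp).map fun X => X t := fun hP t =>
    (Measure.measurable_map _ (measurable_eval t)).comp (measurable_law hP.cont)
  have := Measure.isProbabilityMeasure_map (μ := (Q z : Measure PathSp))
    (measurable_speed c⁻¹).aemeasurable
  refine eq_of_hasKernel (hK hP) ?_ (hasKernel_law hP z) ?_
  · rw [Measure.map_map (measurable_eval 0) (measurable_speed _), map_eval_eq hc h]
    rfl
  · have := hasKernel_map_speed (hK hQ) (hasKernel_law hQ z) c⁻¹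
    convert this using 3 with t x
    exact map_eval_eq hc h x t

theorem stmt12 (P₁ P₂ : ℂ → ProbabilityMeasure PathSp)
    (hP₁c : Continuous P₁) (hP₂c : Continuous P₂)
    (hP₁ : DefinesMTCBM P₁) (hP₂ : DefinesMTCBM P₂)
    (μ : Measure ℂ) [SigmaFinite μ] (hμ : μ ≠ 0)
    (hinv₁ : InvariantFor P₁ μ) (hinv₂ : InvariantFor P₂ μ) :
    ∃ c : ℝ≥0, 0 < c ∧ ∀ z : ℂ,
      (P₁ z : Measure PathSp) =
        (P₂ z : Measure PathSp).map fun X : PathSp =>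
          X.comp ⟨fun t => c * t, continuous_mul_left c⟩ := by
  have hP : ContMTCBM P₁ := ⟨hP₁c, hP₁.1, hP₁.2.1, hP₁.2.2⟩
  have hQ : ContMTCBM P₂ := ⟨hP₂c, hP₂.1, hP₂.2.1, hP₂.2.2⟩
  obtain ⟨c, hc, h⟩ := exists_green_eq_smul hP hQ hμ hinv₁ hinv₂
  exact ⟨c⁻¹, inv_pos.2 (pos_iff_ne_zero.2 hc), fun z => law_eq_map_speed hP hQ hc
    (fun α x _ hf => green_empty_eq_smul hP hQ h α x hf) z⟩
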